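/- arXiv:1506.05540 — 3 statements merged into one kernel-verified Lean document; each statement's English description precedes it below -/
import Mathlib

section
/- Every 2-connected claw-o-heavy and P6-free graph is hamiltonian. -/
/-- A graph is 2-connected if it has at least 3 vertices and deleting any
single vertex leaves a connected graph. -/
def TwoConnected {V : Type*} [Fintype V] (G : SimpleGraph V) : Prop :=
  3 ≤ Fintype.card V ∧ ∀ v : V, (G.induce ({v}ᶜ : Set V)).Connected

/-- A graph `G` of order `n` is claw-o-heavy if every induced copy of the claw `K_{1,3}`
(with center `a` and leaves `b₁, b₂, b₃`) contains two nonadjacent vertices whose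
degree sum in `G` is at least `n`. -/
def ClawOHeavy {V : Type*} [Fintype V] (G : SimpleGraph V) [DecidableRel G.Adj] : Prop :=
  ∀ a b₁ b₂ b₃ : V, b₁ ≠ b₂ → b₁ ≠ b₃ → b₂ ≠ b₃ →
    G.Adj a b₁ → G.Adj a b₂ → G.Adj a b₃ →
    ¬ G.Adj b₁ b₂ → ¬ G.Adj b₁ b₃ → ¬ G.Adj b₂ b₃ →
    ∃ u v : V, u ∈ ({a, b₁, b₂, b₃} : Set V) ∧ v ∈ ({a, b₁, b₂, b₃} : Set V) ∧
      u ≠ v ∧ ¬ G.Adj u v ∧ Fintype.card V ≤ G.degree u + G.degree v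

/-- `v 0, v 1, …, v 5` is an induced path on 6 vertices in `G`. -/
def IsInducedP6 {V : Type*} (G : SimpleGraph V) (v : Fin 6 → V) : Prop :=
  Function.Injective v ∧
    ∀ i j : Fin 6, G.Adj (v i) (v j) ↔ (i.val + 1 = j.val ∨ j.val + 1 = i.val)

section

open List

/-- Two vertices are linked when they are adjacent, or distinct with degree sum at least the
order of the graph. -/
def OLinked {V : Type*} [Fintype V] (G : SimpleGraph V) [DecidableRel G.Adj] (u v : V) : Prop :=
  G.Adj u v ∨ (u ≠ v ∧ Fintype.card V ≤ G.degree u + G.degree v)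

/-- The list `x :: l` of distinct elements is a closed sequence for the relation `R`. -/
def IsClosedChain {V : Type*} (R : V → V → Prop) (x : V) (l : List V) : Prop :=
  (x :: l).Nodup ∧ List.IsChain R (x :: (l ++ [x]))

/-- The number of consecutive pairs of a list that are not edges of the graph. -/
def jumps {V : Type*} (G : SimpleGraph V) [DecidableRel G.Adj] : List V → ℕ
  | a :: b :: l => (if G.Adj a b then 0 else 1) + jumps G (b :: l)
  | _ => 0

section Lists

variable {V : Type*}

theorem IsClosedChain.rotate {R : V → V → Prop} {x y : V} {A B : List V}
    (h : IsClosedChain R x (A ++ y :: B)) : IsClosedChain R y (B ++ x :: A) := by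
  obtain ⟨hn, hc⟩ := h
  refine ⟨?_, ?_⟩
  · have hp : (y :: (B ++ x :: A)) ~ (x :: (A ++ y :: B)) := by
      have := List.perm_append_comm (l₁ := y :: B) (l₂ := x :: A)
      simpa using this
    exact hp.nodup_iff.mpr hn
  · have h1 : List.IsChain R ((x :: A) ++ y :: (B ++ [x])) := by simpa using hc
    rw [isChain_split] at h1
    have h2 : List.IsChain R ((y :: B) ++ x :: (A ++ [y])) := by
      rw [isChain_split]
      exact ⟨by simpa using h1.2, by simpa using h1.1⟩
    simpa using h2

variable (G : SimpleGraph V) [DecidableRel G.Adj]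

theorem jumps_append (l₁ l₂ : List V) (c d : V) :
    jumps G (l₁ ++ c :: d :: l₂) =
      jumps G (l₁ ++ [c]) + (if G.Adj c d then 0 else 1) + jumps G (d :: l₂) := by
  induction l₁ with
  | nil => simp [jumps]
  | cons a t ih =>
    cases t with
    | nil => simp [jumps]; omega
    | cons b t => simp only [List.cons_append, jumps] at ih ⊢; omega

theorem jumps_split (l₁ l₂ : List V) (c : V) :
    jumps G (l₁ ++ c :: l₂) = jumps G (l₁ ++ [c]) + jumps G (c :: l₂) := by
  cases l₂ with
  | nil => simp [jumps]
  | cons d l₂ => rw [jumps_append]; simp [jumps]; omega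

theorem jumps_reverse (l : List V) : jumps G l.reverse = jumps G l := by
  induction l with
  | nil => rfl
  | cons a t ih =>
    cases t with
    | nil => rfl
    | cons b t =>
      rw [jumps, List.reverse_cons, List.reverse_cons, List.append_assoc, List.singleton_append,
        jumps_append, ← List.reverse_cons, ih]
      simp [jumps, G.adj_comm]; omega

theorem isChain_of_jumps_eq_zero (l : List V) (h : jumps G l = 0) : List.IsChain G.Adj l := by
  rw [isChain_iff_forall_rel_of_append_cons_cons]
  intro a b l₁ l₂ hl
  subst hl
  rw [jumps_append] at h
  by_contra hab
  simp [hab] at h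

theorem exists_split_of_length_lt (P Q : V → Prop) [DecidablePred P] [DecidablePred Q]
    (a : V) (l : List V) (hQ : ∀ z ∈ (a :: l).getLast?, ¬ Q z)
    (hcount : l.length < l.countP P + (a :: l).countP Q) :
    ∃ l₁ b c l₂, a :: l = l₁ ++ b :: c :: l₂ ∧ Q b ∧ P c := by
  induction l generalizing a with
  | nil => simp at hQ; simp [hQ] at hcount
  | cons c t ih =>
    by_cases hac : Q a ∧ P c
    · exact ⟨[], a, c, t, rfl, hac⟩
    · obtain ⟨l₁, b, d, l₂, he, hb⟩ := ih c (by simpa using hQ) (by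
        rw [List.countP_cons (l := t), List.countP_cons (a := a)] at hcount
        simp only [List.length_cons] at hcount
        by_cases h1 : Q a <;> by_cases h2 : P c <;> simp [h1, h2] at hac hcount ⊢ <;> omega)
      exact ⟨a :: l₁, b, d, l₂, by rw [he]; rfl, hb⟩

end Lists

section Linked

variable {V : Type*} [Fintype V] {G : SimpleGraph V} [DecidableRel G.Adj]

theorem OLinked.of_adj {u v : V} (h : G.Adj u v) : OLinked G u v := .inl h

theorem OLinked.symm {u v : V} (h : OLinked G u v) : OLinked G v u := by
  rcases h with h | ⟨h, h'⟩
  · exact .inl h.symm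
  · exact .inr ⟨h.symm, by omega⟩

theorem OLinked.ne {u v : V} (h : OLinked G u v) : u ≠ v := by
  rcases h with h | ⟨h, -⟩
  · exact h.ne
  · exact h

theorem isChain_oLinked {l : List V} (h : List.IsChain G.Adj l) : List.IsChain (OLinked G) l :=
  h.imp fun _ _ => Or.inl

theorem isChain_oLinked_reverse {l : List V} (h : List.IsChain (OLinked G) l) :
    List.IsChain (OLinked G) l.reverse := by
  rw [isChain_reverse]
  exact h.imp fun _ _ => OLinked.symm

/-- If the endvertices of a list have large degree sum and no common neighbour off the list, their
neighbours on the list are numerous. -/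
theorem length_le_countP_add_countP [DecidableEq V] {u v : V} {L : List V} (hL : L.Nodup)
    (hdeg : Fintype.card V ≤ G.degree u + G.degree v)
    (hout : ∀ w, w ∉ L → G.Adj u w → ¬ G.Adj v w) :
    L.length ≤ L.countP (G.Adj u ·) + L.countP (G.Adj v ·) := by
  have key : ∀ z, L.countP (G.Adj z ·) = (L.toFinset.filter (G.Adj z)).card := by
    intro z
    rw [List.countP_eq_length_filter, ← List.toFinset_card_of_nodup (hL.filter _)]
    congr 1
    ext w; simp
  have split : ∀ z, G.degree z =
      (L.toFinset.filter (G.Adj z)).card + (L.toFinsetᶜ.filter (G.Adj z)).card := by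
    intro z
    rw [← G.card_neighborFinset_eq_degree, ← Finset.card_union_of_disjoint]
    · congr 1
      ext w
      simp only [SimpleGraph.mem_neighborFinset, Finset.mem_union, Finset.mem_filter,
        Finset.mem_compl]
      tauto
    · exact Finset.disjoint_filter_filter disjoint_compl_right
  have hdis : (L.toFinsetᶜ.filter (G.Adj u)).card + (L.toFinsetᶜ.filter (G.Adj v)).card
      ≤ (L.toFinsetᶜ).card := by
    rw [← Finset.card_union_of_disjoint]
    · apply Finset.card_le_card
      intro w; simp only [Finset.mem_union, Finset.mem_filter]; tauto
    · rw [Finset.disjoint_left]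
      intro w h1 h2
      simp only [Finset.mem_filter, Finset.mem_compl, List.mem_toFinset] at h1 h2
      exact hout w h1.1 h1.2 h2.2
  have hc := Finset.card_add_card_compl L.toFinset
  rw [List.toFinset_card_of_nodup hL] at hc
  rw [key, key]
  have := split u
  have := split v
  omega

/-- A longest closed sequence of linked vertices can be turned into a cycle of the graph of the
same length. -/
theorem exists_isClosedChain_adj [DecidableEq V] {N : ℕ}
    (hmax : ∀ x l, IsClosedChain (OLinked G) x l → l.length + 1 ≤ N) (k : ℕ) :
    ∀ x l, IsClosedChain (OLinked G) x l → l.length + 1 = N → jumps G (x :: (l ++ [x])) ≤ k →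
      ∃ x' l', IsClosedChain G.Adj x' l' ∧ l'.length + 1 = N := by
  induction k with
  | zero =>
    intro x l hl hN hj
    exact ⟨x, l, ⟨hl.1, isChain_of_jumps_eq_zero G _ (by omega)⟩, hN⟩
  | succ k ih =>
    intro x l hl hN hj
    by_cases hch : List.IsChain G.Adj (x :: (l ++ [x]))
    · exact ⟨x, l, ⟨hl.1, hch⟩, hN⟩
    -- rotate so that the closing pair is not an edge
    obtain ⟨a, b, m, hm, hlen, hjm, hab⟩ : ∃ a b m, IsClosedChain (OLinked G) b (m ++ [a]) ∧
        m.length + 2 = N ∧ jumps G (b :: (m ++ [a, b])) ≤ k + 1 ∧ ¬ G.Adj a b := by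
      have rot : ∀ A b B, l = A ++ b :: B →
          jumps G (b :: (B ++ x :: A ++ [b])) = jumps G (x :: (l ++ [x])) := by
        rintro A b B rfl
        have h1 := jumps_split G (x :: A) (B ++ [x]) b
        have h2 := jumps_split G (b :: B) (A ++ [b]) x
        simp only [List.cons_append, List.append_assoc] at h1 h2 ⊢
        rw [h1, h2]
        omega
      rw [isChain_iff_forall_rel_of_append_cons_cons] at hch
      push Not at hch
      obtain ⟨a, b, l₁, l₂, he, hab⟩ := hch
      rcases l₁ with _ | ⟨z, l₁⟩
      · simp only [List.nil_append, List.cons.injEq] at he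
        obtain ⟨rfl, he⟩ := he
        rcases l with _ | ⟨c, l⟩
        · have := hl.2
          simp at this
          exact absurd rfl this.ne
        · simp only [List.cons_append, List.cons.injEq] at he
          obtain ⟨rfl, he⟩ := he
          have hr := IsClosedChain.rotate (A := []) hl
          refine ⟨x, c, l, hr, by simpa using hN, ?_, hab⟩
          have := rot [] c l rfl
          simp at this hj ⊢
          omega
      · simp only [List.cons_append, List.cons.injEq] at he
        obtain ⟨rfl, he⟩ := he
        rcases List.eq_nil_or_concat l₂ with rfl | ⟨l₂, y, rfl⟩
        · have : l ++ [x] = (l₁ ++ [a]) ++ [b] := by simpa using he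
          obtain ⟨rfl, hb⟩ := List.append_inj' this rfl
          simp at hb
          subst hb
          exact ⟨a, x, l₁, hl, by simpa using hN, by simpa using hj, hab⟩
        · have : l ++ [x] = (l₁ ++ a :: b :: l₂) ++ [y] := by simpa using he
          obtain ⟨rfl, hb⟩ := List.append_inj' this rfl
          simp at hb
          subst hb
          have hr := IsClosedChain.rotate (A := l₁ ++ [a]) (B := l₂) (y := b) (by simpa using hl)
          refine ⟨a, b, l₂ ++ x :: l₁, by simpa using hr, by simp at hN ⊢; omega, ?_, hab⟩
          have := rot (l₁ ++ [a]) b l₂ (by simp)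
          simp at this hj ⊢
          omega
    have hlink : OLinked G a b := by
      have h2 := hm.2
      have : List.IsChain (OLinked G) ((b :: m) ++ a :: [b]) := by simpa using h2
      rw [isChain_split] at this
      simpa using this.2
    obtain ⟨hne, hdeg⟩ : a ≠ b ∧ Fintype.card V ≤ G.degree a + G.degree b := by
      rcases hlink with h | h
      · exact absurd h hab
      · exact h
    have hout : ∀ w, w ∉ b :: (m ++ [a]) → G.Adj b w → ¬ G.Adj a w := by
      intro w hw hbw haw
      have hcl : IsClosedChain (OLinked G) w (b :: (m ++ [a])) := by
        refine ⟨List.nodup_cons.mpr ⟨hw, hm.1⟩, ?_⟩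
        have h2 : List.IsChain (OLinked G) ((b :: m) ++ a :: [b]) := by simpa using hm.2
        rw [isChain_split] at h2
        have h3 : List.IsChain (OLinked G) ((w :: b :: m) ++ a :: [w]) := by
          rw [isChain_split]
          refine ⟨?_, by simpa using OLinked.of_adj haw⟩
          have : List.IsChain (OLinked G) (b :: (m ++ [a])) := by simpa using h2.1
          simp only [List.cons_append]
          exact isChain_cons_cons.mpr ⟨.inl hbw.symm, this⟩
        simpa using h3
      have := hmax _ _ hcl
      simp at this
      omega
    have hcount := length_le_countP_add_countP hm.1 (by omega) hout
    have hbb : (b :: (m ++ [a])).countP (G.Adj b ·) = (m ++ [a]).countP (G.Adj b ·) := by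
      rw [List.countP_cons]; simp
    obtain ⟨l₁, c, d, l₂, he, hac, hbd⟩ := exists_split_of_length_lt (G.Adj b) (G.Adj a) b (m ++ [a])
      (by rw [← List.cons_append, List.getLast?_concat]; simp) (by
        have hlen' : (b :: (m ++ [a])).length = (m ++ [a]).length + 1 := rfl
        omega)
    -- the tail of the list ends at `a`, the initial part starts at `b`
    obtain ⟨s, hs⟩ : ∃ s, d :: l₂ = s ++ [a] := by
      rcases List.eq_nil_or_concat (d :: l₂) with h | ⟨s, z, h⟩
      · simp at h
      · have h' : (b :: m) ++ [a] = (l₁ ++ c :: s) ++ [z] := by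
          have : l₁ ++ c :: (d :: l₂) = l₁ ++ c :: (s ++ [z]) := by rw [h, List.concat_eq_append]
          simpa [this] using he
        have := (List.append_inj' h' rfl).2
        simp at this
        exact ⟨s, by rw [h, this, List.concat_eq_append]⟩
    obtain ⟨t, ht⟩ : ∃ t, l₁ ++ [c] = b :: t := by
      rcases l₁ with _ | ⟨z, l₁⟩
      · simp at he; exact ⟨[], by simp [he.1]⟩
      · simp at he; exact ⟨l₁ ++ [c], by simp [he.1]⟩
    have hperm : (b :: (t ++ a :: s.reverse)) ~ (b :: (m ++ [a])) := by
      have e1 : b :: (t ++ a :: s.reverse) = (l₁ ++ [c]) ++ (d :: l₂).reverse := by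
        rw [hs, ht]; simp
      rw [e1, he]
      have : l₁ ++ c :: d :: l₂ = (l₁ ++ [c]) ++ (d :: l₂) := by simp
      rw [this]
      exact List.Perm.append_left _ (List.reverse_perm _)
    have hold : b :: (m ++ [a, b]) = l₁ ++ c :: d :: (l₂ ++ [b]) := by
      have : b :: (m ++ [a, b]) = (b :: (m ++ [a])) ++ [b] := by simp
      rw [this, he]; simp
    have hchain : List.IsChain (OLinked G) (l₁ ++ c :: d :: (l₂ ++ [b])) := by
      rw [← hold]; simpa using hm.2
    rw [isChain_append_cons_cons] at hchain
    have hds : List.IsChain (OLinked G) (s ++ [a]) := by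
      rw [← hs]
      exact List.IsChain.left_of_append (l₂ := [b]) (by simpa using hchain.2.2)
    have hnew : b :: ((t ++ a :: s.reverse) ++ [b]) =
        l₁ ++ c :: a :: (s.reverse ++ [b]) := by
      have : b :: ((t ++ a :: s.reverse) ++ [b]) = (b :: t) ++ a :: (s.reverse ++ [b]) := by simp
      rw [this, ← ht]; simp
    have hrev : a :: s.reverse = l₂.reverse ++ [d] := by
      have := congrArg List.reverse hs
      simpa using this.symm
    have hnew2 : a :: (s.reverse ++ [b]) = l₂.reverse ++ d :: [b] := by
      rw [← List.cons_append, hrev]; simp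
    refine ih b (t ++ a :: s.reverse) ⟨hperm.nodup_iff.mpr hm.1, ?_⟩ ?_ ?_
    · rw [hnew, isChain_append_cons_cons]
      refine ⟨hchain.1, .inl hac.symm, ?_⟩
      rw [hnew2, isChain_split]
      refine ⟨?_, by simpa using OLinked.of_adj hbd.symm⟩
      rw [← hrev]
      have := isChain_oLinked_reverse hds
      simpa using this
    · have := hperm.length_eq
      simp at this ⊢
      omega
    · have j1 : jumps G (b :: (m ++ [a, b])) =
          jumps G (l₁ ++ [c]) + (if G.Adj c d then 0 else 1) + (jumps G (s ++ [a]) + 1) := by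
        rw [hold, jumps_append]
        congr 1
        have : d :: (l₂ ++ [b]) = s ++ a :: [b] := by
          rw [← List.cons_append, hs]; simp
        rw [this, jumps_split]
        simp [jumps, hab]
      have j2 : jumps G (b :: ((t ++ a :: s.reverse) ++ [b])) =
          jumps G (l₁ ++ [c]) + jumps G (s ++ [a]) := by
        rw [hnew, jumps_append, if_pos hac.symm, hnew2, jumps_split G l₂.reverse, ← hrev]
        have : a :: s.reverse = (s ++ [a]).reverse := by simp
        rw [this, jumps_reverse]
        simp [jumps, hbd.symm]
      omega

end Linked

section Connectivity

variable {V : Type*}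

theorem List.exists_first_split (p : V → Prop) (L : List V) (h : ∃ z ∈ L, p z) :
    ∃ U y W, L = U ++ y :: W ∧ p y ∧ ∀ u ∈ U, ¬ p u := by
  induction L with
  | nil => simp at h
  | cons a t ih =>
    by_cases ha : p a
    · exact ⟨[], a, t, rfl, ha, by simp⟩
    · obtain ⟨U, y, W, he, hy, hU⟩ := ih (by simpa [ha] using h)
      exact ⟨a :: U, y, W, by rw [he]; rfl, hy, by simpa [ha] using hU⟩

/-- A path with nonempty interior `U` outside `C` joining distinct vertices `x`, `y` of `C`. -/
structure IsEar (G : SimpleGraph V) (C : List V) (x : V) (U : List V) (y : V) : Prop where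
  left_mem : x ∈ C
  right_mem : y ∈ C
  ne : x ≠ y
  ne_nil : U ≠ []
  nodup : U.Nodup
  notMem : ∀ u ∈ U, u ∉ C
  chain : List.IsChain G.Adj (x :: (U ++ [y]))

theorem IsEar.symm {G : SimpleGraph V} {C : List V} {x y : V} {U : List V}
    (h : IsEar G C x U y) : IsEar G C y U.reverse x where
  left_mem := h.right_mem
  right_mem := h.left_mem
  ne := h.ne.symm
  ne_nil := by simpa using h.ne_nil
  nodup := by simpa using h.nodup
  notMem := by simpa using h.notMem
  chain := by
    have h1 : List.IsChain G.Adj (x :: (U ++ [y])).reverse := by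
      rw [isChain_reverse]
      exact h.chain.imp fun _ _ => SimpleGraph.Adj.symm
    simpa using h1

variable [Fintype V] {G : SimpleGraph V}

theorem TwoConnected.exists_path_avoiding (h : TwoConnected G) {v a b : V} (ha : a ≠ v)
    (hb : b ≠ v) (hab : a ≠ b) :
    ∃ m, (a :: (m ++ [b])).Nodup ∧ v ∉ a :: (m ++ [b]) ∧ List.IsChain G.Adj (a :: (m ++ [b])) := by
  obtain ⟨p, hp⟩ := ((h.2 v).preconnected ⟨a, ha⟩ ⟨b, hb⟩).exists_isPath
  have hne : (⟨a, ha⟩ : ({v}ᶜ : Set V)) ≠ ⟨b, hb⟩ := fun h => hab (congrArg Subtype.val h)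
  obtain ⟨m, hm⟩ : ∃ m, p.support = ⟨a, ha⟩ :: (m ++ [⟨b, hb⟩]) := by
    have h1 := p.cons_tail_support
    have h2 := p.getLast_support
    rcases List.eq_nil_or_concat p.support.tail with h3 | ⟨m, z, h3⟩
    · rw [h3] at h1
      simp only [← h1, List.getLast_singleton] at h2
      exact absurd h2 hne
    · rw [h3, List.concat_eq_append] at h1
      simp only [← h1] at h2
      have : z = ⟨b, hb⟩ := by simpa using h2
      exact ⟨m, by rw [← h1, this]⟩
  have hmap : a :: (m.map Subtype.val ++ [b]) = p.support.map Subtype.val := by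
    rw [hm]; simp
  refine ⟨m.map Subtype.val, ?_, ?_, ?_⟩
  · rw [hmap]
    exact hp.support_nodup.map Subtype.val_injective
  · rw [hmap]
    intro hv
    obtain ⟨w, -, hw⟩ := List.mem_map.mp hv
    exact w.2 hw
  · rw [hmap, isChain_map]
    exact p.isChain_adj_support

theorem TwoConnected.exists_adj_ne [DecidableEq V] (h : TwoConnected G) {v w : V} (hvw : v ≠ w) :
    ∃ a, G.Adj v a ∧ a ≠ w := by
  obtain ⟨u, hu⟩ : ∃ u, u ∉ ({v, w} : Finset V) := by
    by_contra! hcon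
    have h1 : (Finset.univ : Finset V) ⊆ {v, w} := fun u _ => hcon u
    have h2 := Finset.card_le_card h1
    have h3 : ({v, w} : Finset V).card ≤ 2 := Finset.card_le_two
    have := h.1
    rw [Finset.card_univ] at h2
    omega
  simp only [Finset.mem_insert, Finset.mem_singleton, not_or] at hu
  obtain ⟨m, -, hw, hc⟩ := h.exists_path_avoiding hvw hu.2 (Ne.symm hu.1)
  cases m with
  | nil => exact ⟨u, by simpa using hc, hu.2⟩
  | cons a m =>
    simp only [List.cons_append, isChain_cons_cons] at hc
    refine ⟨a, hc.1, ?_⟩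
    rintro rfl
    simp at hw

theorem TwoConnected.exists_isClosedChain [DecidableEq V] (h : TwoConnected G) :
    ∃ x l, IsClosedChain G.Adj x l ∧ 3 ≤ l.length + 1 := by
  obtain ⟨v, w, hvw⟩ : ∃ v w : V, v ≠ w :=
    Fintype.exists_pair_of_one_lt_card (by have := h.1; omega)
  obtain ⟨a, hva, -⟩ := h.exists_adj_ne hvw
  obtain ⟨b, hvb, hba⟩ := h.exists_adj_ne hva.ne
  obtain ⟨m, hn, hv, hc⟩ := h.exists_path_avoiding hva.ne.symm hvb.ne.symm hba.symm
  refine ⟨v, a :: (m ++ [b]), ⟨List.nodup_cons.mpr ⟨hv, hn⟩, ?_⟩, by simp⟩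
  have : List.IsChain G.Adj ((v :: a :: m) ++ b :: [v]) := by
    rw [isChain_split]
    refine ⟨?_, by simpa using hvb.symm⟩
    simp only [List.cons_append]
    exact isChain_cons_cons.mpr ⟨hva, hc⟩
  simpa using this

theorem TwoConnected.exists_isEar (h : TwoConnected G) {C : List V} {z c₁ c₂ : V}
    (hz : z ∉ C) (h₁ : c₁ ∈ C) (h₂ : c₂ ∈ C) (hc : c₁ ≠ c₂) : ∃ x U y, IsEar G C x U y := by
  have ne_of : ∀ {a b}, a ∉ C → b ∈ C → a ≠ b := fun ha hb e => ha (e ▸ hb)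
  obtain ⟨u, x, hu, hx, hux⟩ : ∃ u x, u ∉ C ∧ x ∈ C ∧ G.Adj u x := by
    obtain ⟨m, -, -, hch⟩ := h.exists_path_avoiding (ne_of hz h₂) hc (ne_of hz h₁)
    obtain ⟨U, x, W, he, hx, hU⟩ := List.exists_first_split (· ∈ C) (z :: (m ++ [c₁]))
      ⟨c₁, by simp, h₁⟩
    rcases List.eq_nil_or_concat U with rfl | ⟨U, u, rfl⟩
    · simp at he
      exact absurd hx (he.1 ▸ hz)
    · refine ⟨u, x, hU u (by simp), hx, ?_⟩
      rw [he] at hch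
      have : List.IsChain G.Adj (U ++ u :: x :: W) := by simpa using hch
      exact (isChain_append_cons_cons.mp this).2.1
  obtain ⟨y', hy', hxy'⟩ : ∃ y' ∈ C, y' ≠ x := by
    by_cases e : c₁ = x
    · exact ⟨c₂, h₂, fun e' => hc (e.trans e'.symm)⟩
    · exact ⟨c₁, h₁, e⟩
  obtain ⟨m, hn, hxm, hch⟩ := h.exists_path_avoiding (ne_of hu hx) hxy' (ne_of hu hy')
  obtain ⟨U, y, W, he, hy, hU⟩ := List.exists_first_split (· ∈ C) (u :: (m ++ [y']))
    ⟨y', by simp, hy'⟩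
  rw [he] at hn hxm hch
  rcases U with _ | ⟨u', U⟩
  · simp at he
    exact absurd hy (he.1 ▸ hu)
  · obtain rfl : u = u' := by simp at he; exact he.1
    refine ⟨x, u :: U, y, hx, hy, ?_, by simp, (List.nodup_append.mp hn).1, hU, ?_⟩
    · rintro rfl
      simp at hxm
    · rw [isChain_split] at hch
      simp only [List.cons_append]
      exact isChain_cons_cons.mpr ⟨hux.symm, by simpa using hch.1⟩

theorem SimpleGraph.exists_walk_support_eq {W : Type*} (G : SimpleGraph W) (l : List W) (a b : W)
    (h : List.IsChain G.Adj (a :: (l ++ [b]))) : ∃ p : G.Walk a b, p.support = a :: (l ++ [b]) := by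
  induction l generalizing a with
  | nil =>
    have : G.Adj a b := by simpa using h
    exact ⟨.cons this .nil, by simp⟩
  | cons c l ih =>
    simp only [List.cons_append, isChain_cons_cons] at h
    obtain ⟨p, hp⟩ := ih c h.2
    exact ⟨.cons h.1 p, by simp [hp]⟩

theorem isHamiltonian_of_isClosedChain [DecidableEq V] (h3 : 3 ≤ Fintype.card V) {x : V}
    {l : List V} (h : IsClosedChain G.Adj x l) (hl : l.length + 1 = Fintype.card V) :
    G.IsHamiltonian := by
  intro _
  obtain ⟨p, hp⟩ := G.exists_walk_support_eq l x x h.2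
  have hlen : p.length = Fintype.card V := by
    have := p.length_support
    rw [hp] at this
    simp at this
    omega
  have hnil : ¬ p.Nil := by
    rw [SimpleGraph.Walk.not_nil_iff_lt_length]
    omega
  refine ⟨x, p, SimpleGraph.Walk.isHamiltonianCycle_iff_isCycle_and_length_eq.mpr ⟨?_, hlen⟩⟩
  rw [SimpleGraph.Walk.isCycle_iff_isPath_tail_and_le_length]
  refine ⟨?_, by omega⟩
  rw [SimpleGraph.Walk.isPath_def, SimpleGraph.Walk.support_tail_of_not_nil _ hnil, hp]
  have := h.1
  simp [List.nodup_append] at this ⊢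
  exact ⟨this.2, fun a ha e => this.1 (e ▸ ha)⟩

end Connectivity

section LongestCycle

variable {V : Type*} [Fintype V] {G : SimpleGraph V} [DecidableRel G.Adj]

/-- A cycle `x A y B` of the graph, as long as any closed sequence of linked vertices, together
with a path joining `x` to `y` through a nonempty list `U` of vertices off the cycle. -/
structure IsEaredCycle (G : SimpleGraph V) [DecidableRel G.Adj] (x : V) (U : List V) (y : V)
    (A B : List V) : Prop where
  max : ∀ z l, IsClosedChain (OLinked G) z l → l.length ≤ A.length + B.length + 1
  cycle : IsClosedChain G.Adj x (A ++ y :: B)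
  ear : IsEar G (x :: (A ++ y :: B)) x U y

namespace IsEaredCycle

variable {x y : V} {U A B : List V}

theorem symm (h : IsEaredCycle G x U y A B) : IsEaredCycle G y U.reverse x B A where
  max := fun z l hl => by have := h.max z l hl; omega
  cycle := h.cycle.rotate
  ear := by
    have e := h.ear.symm
    have hm : ∀ z, z ∈ y :: (B ++ x :: A) ↔ z ∈ x :: (A ++ y :: B) := by
      intro z; simp; tauto
    exact ⟨(hm _).2 e.left_mem, (hm _).2 e.right_mem, e.ne, e.ne_nil, e.nodup,
      fun u hu hu' => e.notMem u hu ((hm _).1 hu'), e.chain⟩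

theorem not_longer (h : IsEaredCycle G x U y A B) {W l : List V} (hW : W ≠ []) (hWU : W <+: U)
    (hp : (x :: l) ~ (W ++ x :: (A ++ y :: B))) : ¬ List.IsChain (OLinked G) (x :: (l ++ [x])) := by
  intro hc
  have hn : (x :: l).Nodup := by
    rw [hp.nodup_iff]
    refine List.Nodup.append (h.ear.nodup.sublist hWU.sublist) h.cycle.1 ?_
    intro u hu hu'
    exact h.ear.notMem u (hWU.subset hu) hu'
  have h1 := h.max x l ⟨hn, hc⟩
  have h2 := hp.length_eq
  have h3 := List.length_pos_iff.mpr hW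
  simp at h2
  omega

theorem chain_left (h : IsEaredCycle G x U y A B) : List.IsChain G.Adj (x :: (A ++ [y])) := by
  have h1 : List.IsChain G.Adj ((x :: A) ++ y :: (B ++ [x])) := by simpa using h.cycle.2
  simpa using (isChain_split.mp h1).1

theorem chain_right (h : IsEaredCycle G x U y A B) : List.IsChain G.Adj (y :: (B ++ [x])) :=
  h.symm.chain_left

theorem ne_nil_right (h : IsEaredCycle G x U y A B) : A ≠ [] := by
  rintro rfl
  refine h.not_longer (l := U ++ y :: B) h.ear.ne_nil (List.prefix_refl U) ?_ ?_
  · simpa using (List.perm_middle (a := x) (l₁ := U) (l₂ := y :: B)).symm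
  · have : List.IsChain (OLinked G) ((x :: U) ++ y :: (B ++ [x])) := by
      rw [isChain_split]
      exact ⟨isChain_oLinked (by simpa using h.ear.chain), isChain_oLinked h.chain_right⟩
    simpa using this

theorem ne_nil_left (h : IsEaredCycle G x U y A B) : B ≠ [] := h.symm.ne_nil_right

/-- The two cycle neighbours of an end of the ear are linked. -/
theorem oLinked_neighbours (h : IsEaredCycle G x U y A B) (hclaw : ClawOHeavy G) :
    ∀ p ∈ B.getLast?, ∀ q ∈ A.head?, OLinked G p q := by
  intro p hp q hq
  obtain ⟨u, U', rfl⟩ := List.exists_cons_of_ne_nil h.ear.ne_nil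
  obtain ⟨A', rfl⟩ : ∃ A', A = q :: A' := by
    cases A with
    | nil => simp at hq
    | cons a A' => simp at hq; exact ⟨A', by rw [hq]⟩
  obtain ⟨B', rfl⟩ : ∃ B', B = B' ++ [p] := by
    rcases List.eq_nil_or_concat B with rfl | ⟨B', b, rfl⟩
    · simp at hp
    · simp at hp; exact ⟨B', by simp [hp]⟩
  have hxu : G.Adj x u := by
    have := h.ear.chain
    simp only [List.cons_append, isChain_cons_cons] at this
    exact this.1
  have hxq : G.Adj x q := by
    have := h.chain_left
    simp only [List.cons_append, isChain_cons_cons] at this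
    exact this.1
  have hpx : G.Adj p x := by
    have : List.IsChain G.Adj ((y :: B') ++ p :: [x]) := by simpa using h.chain_right
    simpa using (isChain_split.mp this).2
  have huq : ¬ OLinked G u q := by
    intro huq
    refine h.not_longer (W := [u]) (l := u :: ((q :: A') ++ y :: (B' ++ [p]))) (by simp)
      (by simp) (List.Perm.swap _ _ _) ?_
    have hc := isChain_oLinked h.cycle.2
    simp only [List.cons_append, isChain_cons_cons] at hc ⊢
    exact ⟨.of_adj hxu, huq, hc.2⟩
  have hup : ¬ OLinked G u p := by
    intro hup
    refine h.not_longer (W := [u]) (l := ((q :: A') ++ y :: (B' ++ [p])) ++ [u]) (by simp)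
      (by simp) ?_ ?_
    · simpa using List.perm_append_comm (l₁ := x :: ((q :: A') ++ y :: (B' ++ [p]))) (l₂ := [u])
    · have hc : List.IsChain (OLinked G) ((x :: q :: A' ++ y :: B') ++ p :: [x]) := by
        simpa using isChain_oLinked h.cycle.2
      have : List.IsChain (OLinked G) ((x :: q :: A' ++ y :: B') ++ p :: [u, x]) := by
        rw [isChain_split] at hc ⊢
        exact ⟨hc.1, by simpa using ⟨hup.symm, OLinked.of_adj hxu.symm⟩⟩
      simpa using this
  by_contra hpq
  have hcyc := h.cycle.1
  have hpq_ne : p ≠ q := by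
    rintro rfl
    simp at hcyc
  have hun := h.ear.notMem u (by simp)
  have huq_ne : u ≠ q := by rintro rfl; simp at hun
  have hup_ne : u ≠ p := by rintro rfl; simp at hun
  obtain ⟨s, t, hs, ht, hst, hnadj, hdeg⟩ := hclaw x u p q hup_ne huq_ne hpq_ne hxu hpx.symm hxq
    (fun e => hup (.inl e)) (fun e => huq (.inl e)) (fun e => hpq (.inl e))
  have hl : OLinked G s t := .inr ⟨hst, hdeg⟩
  have hl' := hl.symm
  have hx1 := hxu.symm
  have hx2 := hpx.symm
  have hx3 := hxq.symm
  simp only [Set.mem_insert_iff, Set.mem_singleton_iff] at hs ht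
  rcases hs with rfl | rfl | rfl | rfl <;> rcases ht with rfl | rfl | rfl | rfl <;>
    first | exact hst rfl | exact hnadj ‹_› | contradiction

/-- The cycle may be closed up at `x` through an initial part of `A` whose last vertex is linked
to `x`. -/
theorem chain_closing (h : IsEaredCycle G x U y A B) (hclaw : ClawOHeavy G) {A₁ A₂ : List V}
    (hA : A = A₁ ++ A₂) (hx : List.IsChain (OLinked G) (A₁ ++ [x])) :
    List.IsChain (OLinked G) (B ++ (A₁ ++ [x])) := by
  have hB : List.IsChain (OLinked G) (B ++ [x]) := isChain_oLinked h.chain_right.tail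
  rcases A₁ with _ | ⟨c, A₁⟩
  · simpa using hB
  · rw [isChain_append]
    refine ⟨hB.left_of_append, hx, ?_⟩
    intro p hp q hq
    exact h.oLinked_neighbours hclaw p hp q (by rw [hA]; simpa using hq)

theorem not_oLinked_right (h : IsEaredCycle G x U y A B) (hclaw : ClawOHeavy G) {A₁ A₂ : List V}
    {a : V} (hA : A = A₁ ++ a :: A₂) (hx : List.IsChain (OLinked G) (A₁ ++ [x])) :
    ¬ OLinked G a y := by
  intro hay
  have hclose := h.chain_closing hclaw hA hx
  refine h.not_longer (l := U ++ y :: (a :: A₂ ++ (B ++ A₁))) h.ear.ne_nil (List.prefix_refl U)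
    ?_ ?_
  · classical
    rw [List.perm_iff_count]; intro z; simp [hA, List.count_cons]; omega
  · have : List.IsChain (OLinked G) ((x :: U) ++ y :: (a :: A₂ ++ (B ++ (A₁ ++ [x])))) := by
      rw [isChain_split]
      refine ⟨isChain_oLinked (by simpa using h.ear.chain), ?_⟩
      rw [List.cons_append, isChain_cons_cons]
      refine ⟨hay.symm, ?_⟩
      rw [← List.cons_append, isChain_append]
      refine ⟨?_, hclose, ?_⟩
      · have h1 : List.IsChain (OLinked G) (A ++ [y]) := isChain_oLinked h.chain_left.tail
        exact (hA ▸ h1.left_of_append).right_of_append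
      · intro p hp q hq
        refine h.symm.oLinked_neighbours hclaw p ?_ q ?_
        · rw [hA, List.getLast?_append]; simp at hp ⊢; simp [hp]
        · obtain ⟨b, B', rfl⟩ := List.exists_cons_of_ne_nil h.ne_nil_left
          simpa using hq
    simpa using this

theorem not_oLinked_ear (h : IsEaredCycle G x U y A B) (hclaw : ClawOHeavy G) {A₁ A₂ : List V}
    {a u : V} (hA : A = A₁ ++ a :: A₂) (hx : List.IsChain (OLinked G) (A₁ ++ [x])) (hu : u ∈ U) :
    ¬ OLinked G a u := by
  intro hau
  obtain ⟨U₁, U₂, hU⟩ := List.append_of_mem hu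
  have hclose := h.chain_closing hclaw hA hx
  refine h.not_longer (W := U₁ ++ [u]) (l := (U₁ ++ [u]) ++ a :: (A₂ ++ y :: (B ++ A₁)))
    (by simp) (by rw [hU]; simp) ?_ ?_
  · classical
    rw [List.perm_iff_count]; intro z; simp [hA, List.count_cons]; omega
  · have : List.IsChain (OLinked G) ((x :: U₁) ++ u :: a :: (A₂ ++ y :: (B ++ (A₁ ++ [x])))) := by
      rw [isChain_append_cons_cons]
      refine ⟨?_, hau.symm, ?_⟩
      · have h1 : List.IsChain G.Adj ((x :: U₁) ++ u :: (U₂ ++ [y])) := by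
          simpa [hU] using h.ear.chain
        exact isChain_oLinked (isChain_split.mp h1).1
      · rw [← List.cons_append, isChain_split]
        constructor
        · have h1 : List.IsChain (OLinked G) (A ++ [y]) := isChain_oLinked h.chain_left.tail
          rw [hA, List.append_assoc] at h1
          exact h1.right_of_append
        · obtain ⟨b, B', hB⟩ := List.exists_cons_of_ne_nil h.ne_nil_left
          have h1 := isChain_oLinked h.chain_right
          rw [hB] at hclose h1 ⊢
          simp only [List.cons_append, isChain_cons_cons] at h1 hclose ⊢
          exact ⟨h1.1, hclose⟩
    simpa using this

theorem not_oLinked_across (h : IsEaredCycle G x U y A B) (hclaw : ClawOHeavy G)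
    {A₁ A₂ B₁ B₂ : List V} {a b : V} (hA : A = A₁ ++ a :: A₂)
    (hx : List.IsChain (OLinked G) (A₁ ++ [x])) (hB : B = B₁ ++ b :: B₂)
    (hy : List.IsChain (OLinked G) (B₁ ++ [y])) : ¬ OLinked G a b := by
  intro hab
  have hcx := h.chain_closing hclaw hA hx
  have hcy := h.symm.chain_closing hclaw hB hy
  refine h.not_longer (l := U ++ y :: (B₁.reverse ++ (A₂.reverse ++ a :: b :: (B₂ ++ A₁))))
    h.ear.ne_nil (List.prefix_refl U) ?_ ?_
  · classical
    rw [List.perm_iff_count]; intro z; simp [hA, hB, List.count_cons]; omega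
  · have : List.IsChain (OLinked G)
        ((x :: U) ++ y :: (B₁.reverse ++ (A₂.reverse ++ a :: b :: (B₂ ++ (A₁ ++ [x]))))) := by
      rw [isChain_split]
      refine ⟨isChain_oLinked (by simpa using h.ear.chain), ?_⟩
      have e : y :: (B₁.reverse ++ (A₂.reverse ++ a :: b :: (B₂ ++ (A₁ ++ [x])))) =
          (y :: (B₁.reverse ++ A₂.reverse)) ++ a :: b :: (B₂ ++ (A₁ ++ [x])) := by simp
      rw [e, isChain_append_cons_cons]
      refine ⟨?_, hab, ?_⟩
      · rw [hA, List.append_assoc] at hcy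
        simpa using isChain_oLinked_reverse hcy.right_of_append
      · rw [hB, List.append_assoc] at hcx
        exact hcx.right_of_append
    simpa using this

/-- Along `A` there is a last vertex `p` before the neighbours of `x` are interrupted. -/
theorem exists_interruption (h : IsEaredCycle G x U y A B) (hclaw : ClawOHeavy G) :
    ∃ A₁ p a A₂, A = A₁ ++ p :: a :: A₂ ∧ G.Adj x p ∧ ¬ G.Adj x a ∧ G.Adj p a ∧
      List.IsChain (OLinked G) (A₁ ++ [x]) ∧ List.IsChain (OLinked G) ((A₁ ++ [p]) ++ [x]) := by
  have hAc : List.IsChain (OLinked G) A := isChain_oLinked h.chain_left.tail.left_of_append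
  have chain_concat : ∀ {L M : List V}, A = L ++ M → (∀ u ∈ L, G.Adj x u) →
      List.IsChain (OLinked G) (L ++ [x]) := by
    intro L M hL hadj
    rw [hL] at hAc
    rw [isChain_append]
    refine ⟨hAc.left_of_append, by simp, ?_⟩
    intro p hp q hq
    simp at hq
    subst hq
    exact .inl (hadj p (List.mem_of_getLast? hp)).symm
  obtain ⟨L, a, A₂, hA, ha, hL⟩ := List.exists_first_split (fun z => ¬ G.Adj x z) A (by
    by_contra! hcon
    rcases List.eq_nil_or_concat A with hA | ⟨L, z, hA⟩
    · exact h.ne_nil_right hA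
    · rw [List.concat_eq_append] at hA
      refine h.not_oLinked_right hclaw hA
        (chain_concat hA fun u hu => hcon u (by rw [hA]; simp [hu])) ?_
      have h1 : List.IsChain G.Adj ((x :: L) ++ z :: [y]) := by simpa [hA] using h.chain_left
      exact .inl (by simpa using (isChain_split.mp h1).2))
  simp only [not_not] at hL
  rcases List.eq_nil_or_concat L with rfl | ⟨L, p, rfl⟩
  · have := h.chain_left
    rw [hA] at this
    simp only [List.nil_append, List.cons_append, isChain_cons_cons] at this
    exact absurd this.1 ha
  · rw [List.concat_eq_append] at hA hL
    refine ⟨L, p, a, A₂, by simpa using hA, hL p (by simp), ha, ?_, ?_, chain_concat hA hL⟩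
    · have h1 : List.IsChain G.Adj ((x :: L) ++ p :: a :: (A₂ ++ [y])) := by
        simpa [hA] using h.chain_left
      exact (isChain_append_cons_cons.mp h1).2.1
    · exact chain_concat (by simpa using hA) fun u hu => hL u (by simp [hu])

end IsEaredCycle

theorem isInducedP6_of_adj {W : Type*} {G : SimpleGraph W} {a b c d e f : W}
    (hab : G.Adj a b) (hbc : G.Adj b c) (hcd : G.Adj c d) (hde : G.Adj d e) (hef : G.Adj e f)
    (hac : ¬ G.Adj a c) (had : ¬ G.Adj a d) (hae : ¬ G.Adj a e) (haf : ¬ G.Adj a f)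
    (hbd : ¬ G.Adj b d) (hbe : ¬ G.Adj b e) (hbf : ¬ G.Adj b f)
    (hce : ¬ G.Adj c e) (hcf : ¬ G.Adj c f) (hdf : ¬ G.Adj d f) :
    IsInducedP6 G ![a, b, c, d, e, f] := by
  have key : ∀ i j : Fin 6, G.Adj (![a, b, c, d, e, f] i) (![a, b, c, d, e, f] j) ↔
      (i.val + 1 = j.val ∨ j.val + 1 = i.val) := by
    intro i j
    fin_cases i <;> fin_cases j <;>
      simp [hab, hbc, hcd, hde, hef, hac, had, hae, haf, hbd, hbe, hbf, hce, hcf, hdf,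
        hab.symm, hbc.symm, hcd.symm, hde.symm, hef.symm, G.adj_comm _ a, G.adj_comm d b,
        G.adj_comm e b, G.adj_comm f b, G.adj_comm e c, G.adj_comm f c, G.adj_comm f d]
  refine ⟨fun i j hij => ?_, key⟩
  have rows : ∀ i j : Fin 6, (∀ k : Fin 6, (i.val + 1 = k.val ∨ k.val + 1 = i.val) ↔
      (j.val + 1 = k.val ∨ k.val + 1 = j.val)) → i = j := by decide
  exact rows i j fun k => by rw [← key i k, ← key j k, hij]

/-- A longest cycle with a shortest ear yields an induced path on six vertices. -/
theorem IsEaredCycle.exists_isInducedP6 {x y : V} {U A B : List V}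
    (h : IsEaredCycle G x U y A B) (hclaw : ClawOHeavy G)
    (hmin : ∀ U', IsEar G (x :: (A ++ y :: B)) x U' y → U.length ≤ U'.length) :
    ∃ v, IsInducedP6 G v := by
  obtain ⟨A₁, p, a, A₂, hA, hxp, hxa, hpa, hx₁, hx₂⟩ := h.exists_interruption hclaw
  obtain ⟨B₁, q, b, B₂, hB, hyq, hyb, hqb, hy₁, hy₂⟩ := h.symm.exists_interruption hclaw
  have hA' : A = (A₁ ++ [p]) ++ a :: A₂ := by simpa using hA
  have hB' : B = (B₁ ++ [q]) ++ b :: B₂ := by simpa using hB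
  have of : ∀ {u v}, ¬ OLinked G u v → ¬ G.Adj u v := fun hn hadj => hn (.inl hadj)
  have hpy := of (h.not_oLinked_right hclaw hA hx₁)
  have hay := of (h.not_oLinked_right hclaw hA' hx₂)
  have hqx := of (h.symm.not_oLinked_right hclaw hB hy₁)
  have hbx := of (h.symm.not_oLinked_right hclaw hB' hy₂)
  have hpq := of (h.not_oLinked_across hclaw hA hx₁ hB hy₁)
  have hpb := of (h.not_oLinked_across hclaw hA hx₁ hB' hy₂)
  have haq := of (h.not_oLinked_across hclaw hA' hx₂ hB hy₁)
  have hab := of (h.not_oLinked_across hclaw hA' hx₂ hB' hy₂)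
  have hxa' : ¬ G.Adj a x := fun e => hxa e.symm
  have hqx' : ¬ G.Adj x q := fun e => hqx e.symm
  have hbx' : ¬ G.Adj x b := fun e => hbx e.symm
  have hpu : ∀ u ∈ U, ¬ G.Adj p u := fun u hu => of (h.not_oLinked_ear hclaw hA hx₁ hu)
  have hau : ∀ u ∈ U, ¬ G.Adj a u := fun u hu => of (h.not_oLinked_ear hclaw hA' hx₂ hu)
  by_cases hxy : G.Adj x y
  · exact ⟨_, isInducedP6_of_adj hpa.symm hxp.symm hxy hyq hqb hxa' hay haq hab hpy hpq hpb
      hqx' hbx' hyb⟩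
  have short : ∀ U' : List V, U' ≠ [] → U' <+ U → List.IsChain G.Adj (x :: (U' ++ [y])) →
      U.length ≤ U'.length := fun U' h0 hs hc =>
    hmin U' ⟨h.ear.left_mem, h.ear.right_mem, h.ear.ne, h0, h.ear.nodup.sublist hs,
      fun u hu => h.ear.notMem u (hs.subset hu), hc⟩
  have hch := h.ear.chain
  match U, h.ear.ne_nil with
  | [u], _ =>
    have huq : ¬ G.Adj u q := fun e =>
      of (h.symm.not_oLinked_ear hclaw hB hy₁ (u := u) (by simp)) e.symm
    simp at hch
    exact ⟨_, isInducedP6_of_adj hpa.symm hxp.symm hch.1 hch.2 hyq hxa' (hau u (by simp)) hay haq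
      (hpu u (by simp)) hpy hpq hxy hqx' huq⟩
  | [u, w], _ =>
    simp at hch
    obtain ⟨hxu, huw, hwy⟩ := hch
    have hxw : ¬ G.Adj x w := fun e => by
      have := short [w] (by simp) (by simp) (by simp [e, hwy])
      simp at this
    have huy : ¬ G.Adj u y := fun e => by
      have := short [u] (by simp) (by simp) (by simp [e, hxu])
      simp at this
    exact ⟨_, isInducedP6_of_adj hpa.symm hxp.symm hxu huw hwy hxa' (hau u (by simp))
      (hau w (by simp)) hay (hpu u (by simp)) (hpu w (by simp)) hpy hxw hxy huy⟩
  | u :: w :: z :: U', _ =>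
    simp only [List.cons_append, isChain_cons_cons] at hch
    obtain ⟨hxu, huw, hwz, hrest⟩ := hch
    have hxw : ¬ G.Adj x w := fun e => by
      have := short (w :: z :: U') (by simp) (by simp) (by
        simp only [List.cons_append, isChain_cons_cons]; exact ⟨e, hwz, hrest⟩)
      simp at this
    have hxz : ¬ G.Adj x z := fun e => by
      have := short (z :: U') (by simp)
        ((List.sublist_cons_self _ _).trans (List.sublist_cons_self _ _)) (by
        simp only [List.cons_append, isChain_cons_cons]; exact ⟨e, hrest⟩)
      simp at this
    have huz : ¬ G.Adj u z := fun e => by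
      have := short (u :: z :: U') (by simp) (by simp) (by
        simp only [List.cons_append, isChain_cons_cons]; exact ⟨hxu, e, hrest⟩)
      simp at this
    exact ⟨_, isInducedP6_of_adj hpa.symm hxp.symm hxu huw hwz hxa' (hau u (by simp))
      (hau w (by simp)) (hau z (by simp)) (hpu u (by simp)) (hpu w (by simp)) (hpu z (by simp))
      hxw hxz huz⟩

end LongestCycle

end

/-- Every 2-connected claw-o-heavy and `P₆`-free graph is hamiltonian. -/
theorem stmt_9 {V : Type*} [Fintype V] [DecidableEq V] (G : SimpleGraph V) [DecidableRel G.Adj]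
    (h2conn : TwoConnected G) (hclaw : ClawOHeavy G)
    (hP6free : ∀ v : Fin 6 → V, ¬ IsInducedP6 G v) :
    G.IsHamiltonian := by
  classical
  -- a longest closed sequence of linked vertices
  let S : Set ℕ := {n | ∃ x l, IsClosedChain (OLinked G) x l ∧ l.length + 1 = n}
  have hbdd : ∀ n ∈ S, n ≤ Fintype.card V := by
    rintro n ⟨x, l, hl, rfl⟩
    exact hl.1.length_le_card
  obtain ⟨x₀, l₀, h₀, hl₀⟩ := h2conn.exists_isClosedChain
  have hmem : l₀.length + 1 ∈ S := ⟨x₀, l₀, ⟨h₀.1, isChain_oLinked h₀.2⟩, rfl⟩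
  obtain ⟨N, hN, hmax⟩ : ∃ N ∈ S, ∀ n ∈ S, n ≤ N :=
    ⟨sSup S, Nat.sSup_mem ⟨_, hmem⟩ ⟨_, hbdd⟩, fun n hn => le_csSup ⟨_, hbdd⟩ hn⟩
  obtain ⟨x₁, l₁, h₁, hl₁⟩ := hN
  obtain ⟨c, l, hcl, hlN⟩ := exists_isClosedChain_adj
    (fun x l hl => hmax _ ⟨x, l, hl, rfl⟩) _ x₁ l₁ h₁ hl₁ le_rfl
  have hN3 : 3 ≤ N := hl₀.trans (hmax _ hmem)
  by_cases hall : ∀ z, z ∈ c :: l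
  · refine isHamiltonian_of_isClosedChain h2conn.1 hcl ?_
    have h1 := List.toFinset_card_of_nodup hcl.1
    have h2 : (c :: l).toFinset = Finset.univ := by
      ext z; simpa using hall z
    rw [h2, Finset.card_univ] at h1
    simpa using h1.symm
  · exfalso
    push Not at hall
    obtain ⟨z, hz⟩ := hall
    obtain ⟨d, l', rfl⟩ : ∃ d l', l = d :: l' :=
      List.exists_cons_of_ne_nil (by rintro rfl; simp at hlN; omega)
    have hcd : c ≠ d := by
      rintro rfl
      have := hcl.1
      simp at this
    -- a shortest ear
    obtain ⟨x, U, y, hear, hmin⟩ : ∃ x U y, IsEar G (c :: d :: l') x U y ∧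
        ∀ U', IsEar G (c :: d :: l') x U' y → U.length ≤ U'.length := by
      obtain ⟨x, U₀, y, h⟩ := h2conn.exists_isEar hz (by simp) (by simp) hcd
      let T : Set ℕ := {n | ∃ U, IsEar G (c :: d :: l') x U y ∧ U.length = n}
      have hT : T.Nonempty := ⟨_, U₀, h, rfl⟩
      obtain ⟨U, hU, hlen⟩ := Nat.sInf_mem hT
      exact ⟨x, U, y, hU, fun U' hU' => hlen ▸ Nat.sInf_le ⟨U', hU', rfl⟩⟩
    generalize d :: l' = l at *
    -- rotate the cycle so that it starts at `x`
    obtain ⟨m, hm, hperm⟩ : ∃ m, IsClosedChain G.Adj x m ∧ List.Perm (x :: m) (c :: l) := by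
      rcases List.mem_cons.mp hear.left_mem with rfl | hx
      · exact ⟨l, hcl, List.Perm.refl _⟩
      · obtain ⟨L, M, rfl⟩ := List.append_of_mem hx
        exact ⟨_, hcl.rotate, by
          simpa using List.perm_append_comm (l₁ := x :: M) (l₂ := c :: L)⟩
    have hy : y ∈ m := by
      have := hperm.mem_iff.mpr hear.right_mem
      exact (List.mem_cons.mp this).resolve_left hear.ne.symm
    obtain ⟨A, B, rfl⟩ := List.append_of_mem hy
    have transfer : ∀ {C D : List V} {W}, List.Perm C D → IsEar G C x W y → IsEar G D x W y :=
      fun hCD e => ⟨hCD.mem_iff.mp e.left_mem, hCD.mem_iff.mp e.right_mem, e.ne, e.ne_nil,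
        e.nodup, fun u hu hu' => e.notMem u hu (hCD.mem_iff.mpr hu'), e.chain⟩
    have hcfg : IsEaredCycle G x U y A B := by
      refine ⟨fun w k hk => ?_, hm, transfer hperm.symm hear⟩
      have h1 := hmax _ ⟨w, k, hk, rfl⟩
      have h2 := hperm.length_eq
      simp at h2
      omega
    obtain ⟨v, hv⟩ := hcfg.exists_isInducedP6 hclaw fun U' hU' => hmin U' (transfer hperm hU')
    exact hP6free v hv
end

section
/- Every 2-connected graph that is claw-free and P6-free is hamiltonian. -/
/-- A graph `G` is claw-free if it contains no induced copy of the claw `K_{1,3}`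
(center `a`, leaves `b₁, b₂, b₃`). -/
def ClawFree {V : Type*} (G : SimpleGraph V) : Prop :=
  ∀ a b₁ b₂ b₃ : V, b₁ ≠ b₂ → b₁ ≠ b₃ → b₂ ≠ b₃ →
    G.Adj a b₁ → G.Adj a b₂ → G.Adj a b₃ →
    ¬ (¬ G.Adj b₁ b₂ ∧ ¬ G.Adj b₁ b₃ ∧ ¬ G.Adj b₂ b₃)

namespace SimpleGraph

variable {V : Type*} {G : SimpleGraph V}

/-- `G.ListPath u v l` says that `l` is the list of vertices of a walk from `u` to `v`. -/
inductive ListPath (G : SimpleGraph V) : V → V → List V → Prop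
  | single (v : V) : ListPath G v v [v]
  | cons {u v w : V} {l : List V} : G.Adj u v → ListPath G v w l → ListPath G u w (u :: l)

namespace ListPath

variable {u v w z : V} {l m : List V}

lemma ne_nil (h : G.ListPath u v l) : l ≠ [] := by
  cases h <;> simp

lemma eq_left {c : V} (h : G.ListPath u v (c :: l)) : u = c := by
  cases h <;> rfl

lemma eq_right {c : V} (h : G.ListPath u v [c]) : v = c := by
  cases h with
  | single => rfl
  | cons _ h => cases h

lemma left_mem (h : G.ListPath u v l) : u ∈ l := by
  cases h <;> simp

lemma right_mem (h : G.ListPath u v l) : v ∈ l := by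
  induction h with
  | single => simp
  | cons _ _ ih => exact List.mem_cons_of_mem _ ih

lemma append (h : G.ListPath u v l) (hvw : G.Adj v w) (h' : G.ListPath w z m) :
    G.ListPath u z (l ++ m) := by
  induction h with
  | single => exact .cons hvw h'
  | cons ha _ ih => exact .cons ha (ih hvw)

lemma reverse (h : G.ListPath u v l) : G.ListPath v u l.reverse := by
  induction h with
  | single v => exact .single v
  | cons ha _ ih =>
    rw [List.reverse_cons]
    exact ih.append ha.symm (.single _)

lemma split (h : G.ListPath u v (l ++ m)) (hl : l ≠ []) (hm : m ≠ []) :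
    ∃ w z, G.ListPath u w l ∧ G.Adj w z ∧ G.ListPath z v m := by
  generalize hk : l ++ m = k at h
  induction h generalizing l with
  | single =>
    have := congrArg List.length hk
    have := List.length_pos_iff.2 hl
    have := List.length_pos_iff.2 hm
    simp at *
    omega
  | @cons u c v k ha hr ih =>
    cases l with
    | nil => exact absurd rfl hl
    | cons d l =>
      obtain ⟨rfl, rfl⟩ := List.cons.inj hk
      by_cases hl' : l = []
      · subst hl'
        exact ⟨_, _, .single _, ha, hr⟩
      · obtain ⟨w, z, h1, h2, h3⟩ := ih hl' rfl
        exact ⟨w, z, .cons ha h1, h2, h3⟩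

lemma exists_prefix_of_mem (h : G.ListPath u v l) {c : V} (hc : c ∈ l) :
    ∃ m, m <+: l ∧ G.ListPath u c m := by
  induction h with
  | single v =>
    obtain rfl := List.mem_singleton.1 hc
    exact ⟨[c], List.prefix_refl _, .single c⟩
  | @cons u v w l ha h ih =>
    by_cases hcu : c = u
    · subst hcu
      exact ⟨[c], by simp, .single c⟩
    · obtain ⟨m, hm, hp⟩ := ih ((List.mem_cons.1 hc).resolve_left hcu)
      exact ⟨u :: m, by simpa using hm, .cons ha hp⟩

/-- A vertex list ending in `v` is obtained by appending `v` to an empty or nonempty list. -/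
lemma dropLast_cases (h : G.ListPath u v l) :
    (u = v ∧ l = [v]) ∨ ∃ w m, l = m ++ [v] ∧ G.ListPath u w m ∧ G.Adj w v := by
  induction h with
  | single => simp
  | @cons u v w l ha h ih =>
    right
    rcases ih with ⟨rfl, rfl⟩ | ⟨z, m, rfl, h1, h2⟩
    · exact ⟨u, [u], rfl, .single _, ha⟩
    · exact ⟨z, u :: m, rfl, .cons ha h1, h2⟩

lemma exists_walk (h : G.ListPath u v l) : ∃ p : G.Walk u v, p.support = l := by
  induction h with
  | single => exact ⟨.nil, rfl⟩
  | cons ha _ ih =>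
    obtain ⟨p, rfl⟩ := ih
    exact ⟨.cons ha p, rfl⟩

/-- A path is cut at its first vertex not adjacent to `x`. -/
lemma exists_split_not_adj {x : V} (h : G.ListPath u v l) (hu : G.Adj x u) (hv : ¬ G.Adj x v) :
    ∃ w z p q, l = p ++ q ∧ G.ListPath u w p ∧ G.Adj w z ∧ G.ListPath z v q ∧
      (∀ c ∈ p, G.Adj x c) ∧ ¬ G.Adj x z := by
  induction h with
  | single => exact absurd hu hv
  | @cons u v w l ha h ih =>
    by_cases hxv : G.Adj x v
    · obtain ⟨w', z, p, q, rfl, h1, h2, h3, h4, h5⟩ := ih hxv hv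
      exact ⟨w', z, u :: p, q, rfl, .cons ha h1, h2, h3, by simpa using ⟨hu, h4⟩, h5⟩
    · exact ⟨u, v, [u], l, rfl, .single _, ha, h, by simpa using hu, hxv⟩

end ListPath

/-- A path that starts outside `S` and ends in `S` has an initial part outside `S` followed by a
vertex of `S`. -/
lemma Walk.IsPath.exists_listPath_to_set {S : Set V} {u v : V} {p : G.Walk u v} (hp : p.IsPath)
    (hu : u ∉ S) (hv : v ∈ S) :
    ∃ w x l, G.ListPath u w l ∧ G.Adj w x ∧ x ∈ S ∧ x ∈ p.support ∧ l ⊆ p.support ∧ l.Nodup ∧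
      ∀ c ∈ l, c ∉ S := by
  induction p with
  | nil => exact absurd hv hu
  | @cons u w v ha p ih =>
    rw [Walk.cons_isPath_iff] at hp
    by_cases hw : w ∈ S
    · exact ⟨u, w, [u], .single u, ha, hw, by simp, by simp, by simp, by simpa using hu⟩
    · obtain ⟨z, x, l, h1, h2, h3, h4, h5, h6, h7⟩ := ih hp.1 hw hv
      refine ⟨z, x, u :: l, .cons ha h1, h2, h3, by simp [h4], ?_, ?_, ?_⟩
      · rw [Walk.support_cons]
        exact List.cons_subset_cons _ h5
      · exact List.nodup_cons.2 ⟨fun hul => hp.2 (h5 hul), h6⟩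
      · simpa using ⟨hu, h7⟩

/-- In a graph that stays connected when `x` is deleted, any vertex outside `S` is joined to `S` by
a path avoiding `x`. -/
lemma exists_listPath_to_set_avoiding {S : Set V} {u v x : V}
    (hx : (G.induce ({x}ᶜ : Set V)).Connected) (hu : u ∉ S) (hv : v ∈ S) (hux : u ≠ x)
    (hvx : v ≠ x) :
    ∃ w y l, G.ListPath u w l ∧ G.Adj w y ∧ y ∈ S ∧ y ≠ x ∧ l.Nodup ∧ ∀ c ∈ l, c ∉ S := by
  classical
  obtain ⟨p⟩ := hx.preconnected ⟨u, hux⟩ ⟨v, hvx⟩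
  have hp := p.toPath.2
  set q := p.toPath.1
  have hq : (q.map (Embedding.induce ({x}ᶜ : Set V)).toHom).IsPath :=
    hp.map Subtype.val_injective
  obtain ⟨w, y, l, h1, h2, h3, h4, -, h6, h7⟩ := hq.exists_listPath_to_set hu hv
  refine ⟨w, y, l, h1, h2, h3, ?_, h6, h7⟩
  rw [Walk.support_map, List.mem_map] at h4
  obtain ⟨⟨c, hc⟩, -, rfl⟩ := h4
  exact hc

/-- A vertex list of a cycle (or of a single edge traversed back and forth). -/
def ClosedList (G : SimpleGraph V) (l : List V) : Prop :=
  l.Nodup ∧ ∃ u v, G.ListPath u v l ∧ G.Adj v u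

lemma ClosedList.rotate {l m : List V} (h : G.ClosedList (l ++ m)) : G.ClosedList (m ++ l) := by
  obtain ⟨hn, u, v, h, hvu⟩ := h
  refine ⟨List.nodup_append_comm.1 hn, ?_⟩
  by_cases hl : l = []
  · subst hl
    exact ⟨u, v, by simpa using h, hvu⟩
  by_cases hm : m = []
  · subst hm
    exact ⟨u, v, by simpa using h, hvu⟩
  obtain ⟨w, z, h1, h2, h3⟩ := h.split hl hm
  exact ⟨z, w, h3.append hvu h1, h2⟩

/-- A closed list can be rewritten to start at a prescribed vertex and pass through another. -/
lemma ClosedList.exists_split {l : List V} (h : G.ClosedList l) {x y : V} (hx : x ∈ l) (hy : y ∈ l)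
    (hxy : x ≠ y) :
    ∃ A B, G.ClosedList ([x] ++ A ++ [y] ++ B) ∧ ([x] ++ A ++ [y] ++ B).Perm l := by
  obtain ⟨s, t, rfl⟩ := List.append_of_mem hx
  have hy' : y ∈ t ++ s := by
    simp only [List.mem_append, List.mem_cons] at hy ⊢
    grind
  obtain ⟨A, B, hAB⟩ := List.append_of_mem hy'
  have h' := h.rotate
  have e : [x] ++ A ++ [y] ++ B = x :: t ++ s := by simp [hAB]
  refine ⟨A, B, e ▸ h', ?_⟩
  rw [e]
  exact List.perm_append_comm

/-- A closed list through all vertices of a graph on at least three vertices is a Hamilton cycle. -/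
lemma ClosedList.isHamiltonian [Fintype V] [DecidableEq V] {l : List V} (h : G.ClosedList l)
    (hl : ∀ v, v ∈ l) (hV : 3 ≤ Fintype.card V) : G.IsHamiltonian := by
  intro _
  obtain ⟨hn, u, v, hp, hvu⟩ := h
  obtain ⟨p, rfl⟩ := hp.exists_walk
  have hpath : p.IsPath := (Walk.isPath_def p).2 hn
  have hham : p.IsHamiltonian := hpath.isHamiltonian_of_mem hl
  have hlen : 2 ≤ p.length := by
    have := hham.length_eq
    omega
  refine ⟨v, .cons hvu p, ?_⟩
  rw [Walk.isHamiltonianCycle_iff_isCycle_and_support_count_tail_eq_one]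
  refine ⟨Walk.cons_isCycle_iff _ _ |>.2 ⟨hpath, ?_⟩, fun a => ?_⟩
  · cases p with
    | nil => simp at hlen
    | @cons _ c _ hc q =>
      rw [Walk.cons_isPath_iff] at hpath
      rw [Walk.edges_cons, List.mem_cons, not_or]
      constructor
      · intro he
        have hvc : v = c := by
          have := hc.ne
          grind
        subst hvc
        have := Walk.isPath_iff_nil.1 hpath.1
        rw [← Walk.length_eq_zero_iff] at this
        simp [this] at hlen
      · exact fun he => hpath.2 (q.snd_mem_support_of_mem_edges he)
  · simpa using hham a

/-- A cyclic vertex list `x, A, y, B`, where `A` goes from `a` to `a'` and `B` from `b` to `b'`,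
together with a path `P` from `h` to `h'` outside of it joining `x` to `y`, such that no cycle is
obtained by adding some vertices of `P` to those of the list. -/
structure Detour (G : SimpleGraph V) (x y a a' b b' h h' : V) (A B P : List V) : Prop where
  pathA : G.ListPath a a' A
  pathB : G.ListPath b b' B
  pathP : G.ListPath h h' P
  adj_xa : G.Adj x a
  adj_ay : G.Adj a' y
  adj_yb : G.Adj y b
  adj_bx : G.Adj b' x
  adj_xh : G.Adj x h
  adj_hy : G.Adj h' y
  nodup : ([x] ++ A ++ [y] ++ B ++ P).Nodup
  not_longer : ∀ S : List V, S ≠ [] → S.Nodup → S ⊆ P → ∀ u v m, G.ListPath u v m → G.Adj v u →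
    ¬ m.Perm ([x] ++ A ++ [y] ++ B ++ S)

namespace Detour

variable {x y a a' b b' h h' : V} {A B P : List V}

lemma swap (D : G.Detour x y a a' b b' h h' A B P) :
    G.Detour y x b b' a a' h' h B A P.reverse where
  pathA := D.pathB
  pathB := D.pathA
  pathP := D.pathP.reverse
  adj_xa := D.adj_yb
  adj_ay := D.adj_bx
  adj_yb := D.adj_xa
  adj_bx := D.adj_ay
  adj_xh := D.adj_hy.symm
  adj_hy := D.adj_xh.symm
  nodup := by
    classical
    refine (List.Perm.nodup_iff ?_).1 D.nodup
    rw [List.perm_iff_count]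
    intro c
    simp only [List.count_append, List.count_reverse]
    omega
  not_longer S hS hn hSP u v m hm hvu hp := by
    classical
    refine D.not_longer S hS hn (fun c hc => List.mem_reverse.1 (hSP hc)) u v m hm hvu
      (hp.trans ?_)
    rw [List.perm_iff_count]
    intro c
    simp only [List.count_append]
    omega

lemma nodup_P (D : G.Detour x y a a' b b' h h' A B P) : P.Nodup :=
  (List.nodup_append.1 D.nodup).2.1

/-- A detour whose cyclic list is extended by the whole of `P`. -/
lemma not_longer_all (D : G.Detour x y a a' b b' h h' A B P) {u v : V} {m : List V}
    (hm : G.ListPath u v m) (hvu : G.Adj v u) : ¬ m.Perm ([x] ++ A ++ [y] ++ B ++ P) :=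
  D.not_longer P D.pathP.ne_nil D.nodup_P (List.Subset.refl _) u v m hm hvu

lemma adj_ba (D : G.Detour x y a a' b b' h h' A B P) (hG : ClawFree G) : G.Adj b' a := by
  classical
  have hh := D.pathP.left_mem
  have n1 : ¬ G.Adj h a := fun H => by
    refine D.not_longer [h] (by simp) (by simp) (by simpa using hh) _ _ _
      (((((ListPath.single x).append D.adj_xh (.single h)).append H D.pathA).append
        D.adj_ay (.single y)).append D.adj_yb D.pathB) D.adj_bx ?_
    rw [List.perm_iff_count]
    intro c
    simp only [List.count_append]
    omega
  have n2 : ¬ G.Adj h b' := fun H => by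
    refine D.not_longer [h] (by simp) (by simp) (by simpa using hh) _ _ _
      (((((ListPath.single x).append D.adj_xa D.pathA).append
        D.adj_ay (.single y)).append D.adj_yb D.pathB).append H.symm (.single h)) D.adj_xh.symm
        (List.Perm.refl _)
  have hnd := D.nodup
  have ha := D.pathA.left_mem
  have hb := D.pathB.right_mem
  simp only [List.nodup_append, List.mem_append, List.mem_singleton] at hnd
  have d1 : h ≠ a := by grind
  have d2 : h ≠ b' := by grind
  have d3 : b' ≠ a := by grind
  by_contra H
  exact hG x h b' a d2 d1 d3 D.adj_xh D.adj_bx.symm D.adj_xa ⟨n2, n1, H⟩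

lemma adj_ab (D : G.Detour x y a a' b b' h h' A B P) (hG : ClawFree G) : G.Adj a' b :=
  D.swap.adj_ba hG

lemma not_adj_xa (D : G.Detour x y a a' b b' h h' A B P) (hG : ClawFree G) : ¬ G.Adj x a' := by
  classical
  intro H
  refine D.not_longer_all ((((D.pathA.append H.symm (.single x)).append D.adj_xh D.pathP).append
    D.adj_hy (.single y)).append D.adj_yb D.pathB) (D.adj_ba hG) ?_
  rw [List.perm_iff_count]
  intro c
  simp only [List.count_append]
  omega

end Detour

/-- A detour in which `A` is cut into `A₁`, `A₂` at the first non-neighbour `z` of `x`, and `B` is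
cut into `B₁`, `B₂` at the first non-neighbour `t` of `y`; the vertices before `z` and `t` are `w`
and `s`. -/
structure CutDetour (G : SimpleGraph V) (x y a a' b b' h h' w z s t : V)
    (A₁ A₂ B₁ B₂ P : List V) : Prop where
  detour : G.Detour x y a a' b b' h h' (A₁ ++ A₂) (B₁ ++ B₂) P
  pathA₁ : G.ListPath a w A₁
  adj_wz : G.Adj w z
  pathA₂ : G.ListPath z a' A₂
  adj_A₁ : ∀ c ∈ A₁, G.Adj x c
  not_adj_xz : ¬ G.Adj x z
  pathB₁ : G.ListPath b s B₁
  adj_st : G.Adj s t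
  pathB₂ : G.ListPath t b' B₂
  adj_B₁ : ∀ c ∈ B₁, G.Adj y c
  not_adj_yt : ¬ G.Adj y t

lemma Detour.exists_cut {x y a a' b b' h h' : V} {A B P : List V}
    (D : G.Detour x y a a' b b' h h' A B P) (hG : ClawFree G) :
    ∃ w z s t A₁ A₂ B₁ B₂, G.CutDetour x y a a' b b' h h' w z s t A₁ A₂ B₁ B₂ P := by
  obtain ⟨w, z, A₁, A₂, rfl, h1, h2, h3, h4, h5⟩ :=
    D.pathA.exists_split_not_adj D.adj_xa (D.not_adj_xa hG)
  obtain ⟨s, t, B₁, B₂, rfl, k1, k2, k3, k4, k5⟩ :=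
    D.pathB.exists_split_not_adj D.adj_yb (D.swap.not_adj_xa hG)
  exact ⟨w, z, s, t, A₁, A₂, B₁, B₂, D, h1, h2, h3, h4, h5, k1, k2, k3, k4, k5⟩

namespace CutDetour

variable {x y a a' b b' h h' w z s t : V} {A₁ A₂ B₁ B₂ P : List V}

lemma swap (D : G.CutDetour x y a a' b b' h h' w z s t A₁ A₂ B₁ B₂ P) :
    G.CutDetour y x b b' a a' h' h s t w z B₁ B₂ A₁ A₂ P.reverse :=
  ⟨D.detour.swap, D.pathB₁, D.adj_st, D.pathB₂, D.adj_B₁, D.not_adj_yt, D.pathA₁, D.adj_wz,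
    D.pathA₂, D.adj_A₁, D.not_adj_xz⟩

lemma adj_xw (D : G.CutDetour x y a a' b b' h h' w z s t A₁ A₂ B₁ B₂ P) : G.Adj x w :=
  D.adj_A₁ w D.pathA₁.right_mem

lemma adj_ys (D : G.CutDetour x y a a' b b' h h' w z s t A₁ A₂ B₁ B₂ P) : G.Adj y s :=
  D.swap.adj_xw

lemma not_adj_yz (D : G.CutDetour x y a a' b b' h h' w z s t A₁ A₂ B₁ B₂ P) (hG : ClawFree G) :
    ¬ G.Adj y z := by
  classical
  intro H
  refine D.detour.not_longer_all (((((D.pathA₁.append D.adj_xw.symm (.single x)).append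
    D.detour.adj_xh D.detour.pathP).append D.detour.adj_hy (.single y)).append H D.pathA₂).append
    (D.detour.adj_ab hG) D.detour.pathB) (D.detour.adj_ba hG) ?_
  rw [List.perm_iff_count]
  intro c
  simp only [List.count_append]
  omega

lemma not_adj_zt (D : G.CutDetour x y a a' b b' h h' w z s t A₁ A₂ B₁ B₂ P) (hG : ClawFree G) :
    ¬ G.Adj z t := by
  classical
  intro H
  refine D.detour.not_longer_all ((((((D.pathA₁.append D.adj_xw.symm (.single x)).append
    D.detour.adj_xh D.detour.pathP).append D.detour.adj_hy (.single y)).append D.adj_ys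
    D.pathB₁.reverse).append (D.detour.adj_ab hG).symm D.pathA₂.reverse).append
    H D.pathB₂) (D.detour.adj_ba hG) ?_
  rw [List.perm_iff_count]
  intro c
  simp only [List.count_append, List.count_reverse]
  omega

lemma not_adj_yw (D : G.CutDetour x y a a' b b' h h' w z s t A₁ A₂ B₁ B₂ P) (hG : ClawFree G) :
    ¬ G.Adj y w := by
  classical
  intro H
  have key : ∀ {u l}, G.ListPath b u (B₁ ++ B₂ ++ l) → G.Adj u x →
      (B₁ ++ B₂ ++ l ++ [w]).Perm (B₁ ++ B₂ ++ A₁) → False := by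
    intro u l hl hux hp
    refine D.detour.not_longer_all (((((hl.append hux (.single x)).append
      D.detour.adj_xh D.detour.pathP).append D.detour.adj_hy (.single y)).append H
      (.single w)).append D.adj_wz D.pathA₂) (D.detour.adj_ab hG) ?_
    rw [List.perm_iff_count] at hp ⊢
    intro c
    have := hp c
    simp only [List.count_append] at this ⊢
    omega
  rcases D.pathA₁.dropLast_cases with ⟨-, e⟩ | ⟨u, m, e, hm, -⟩
  · exact key (l := []) (by simpa using D.detour.pathB) D.detour.adj_bx (by simp [e])
  · refine key (D.detour.pathB.append (D.detour.adj_ba hG) hm)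
      (D.adj_A₁ u (e ▸ List.mem_append_left _ hm.right_mem)).symm (by simp [e])

lemma exists_nodup_path_of_mem (D : G.CutDetour x y a a' b b' h h' w z s t A₁ A₂ B₁ B₂ P) {c : V}
    (hc : c ∈ P) : ∃ S, G.ListPath h c S ∧ S.Nodup ∧ S ⊆ P := by
  obtain ⟨S, hS, hp⟩ := D.detour.pathP.exists_prefix_of_mem hc
  exact ⟨S, hp, D.detour.nodup_P.sublist hS.sublist, hS.subset⟩

lemma not_adj_z_of_mem (D : G.CutDetour x y a a' b b' h h' w z s t A₁ A₂ B₁ B₂ P)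
    (hG : ClawFree G) {c : V} (hc : c ∈ P) : ¬ G.Adj z c := by
  classical
  intro H
  obtain ⟨S, hS, hn, hSP⟩ := D.exists_nodup_path_of_mem hc
  refine D.detour.not_longer S hS.ne_nil hn hSP _ _ _ (((((D.pathA₁.append D.adj_xw.symm
    (.single x)).append D.detour.adj_xh hS).append H.symm D.pathA₂).append D.detour.adj_ay
    (.single y)).append D.detour.adj_yb D.detour.pathB) (D.detour.adj_ba hG) ?_
  rw [List.perm_iff_count]
  intro c
  simp only [List.count_append]
  omega

lemma not_adj_w_of_mem (D : G.CutDetour x y a a' b b' h h' w z s t A₁ A₂ B₁ B₂ P)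
    (hG : ClawFree G) {c : V} (hc : c ∈ P) : ¬ G.Adj w c := by
  classical
  intro H
  obtain ⟨S, hS, hn, hSP⟩ := D.exists_nodup_path_of_mem hc
  have key : ∀ {u l}, G.ListPath b u (B₁ ++ B₂ ++ l) → G.Adj u x →
      (B₁ ++ B₂ ++ l ++ [w]).Perm (B₁ ++ B₂ ++ A₁) → False := by
    intro u l hl hux hp
    refine D.detour.not_longer S hS.ne_nil hn hSP _ _ _ (((((hl.append hux (.single x)).append
      D.detour.adj_xh hS).append H.symm (.single w)).append D.adj_wz D.pathA₂).append
      D.detour.adj_ay (.single y)) D.detour.adj_yb ?_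
    rw [List.perm_iff_count] at hp ⊢
    intro c
    have := hp c
    simp only [List.count_append] at this ⊢
    omega
  rcases D.pathA₁.dropLast_cases with ⟨-, e⟩ | ⟨u, m, e, hm, -⟩
  · exact key (l := []) (by simpa using D.detour.pathB) D.detour.adj_bx (by simp [e])
  · refine key (D.detour.pathB.append (D.detour.adj_ba hG) hm)
      (D.adj_A₁ u (e ▸ List.mem_append_left _ hm.right_mem)).symm (by simp [e])

lemma nodup_ends (D : G.CutDetour x y a a' b b' h h' w z s t A₁ A₂ B₁ B₂ P) :
    [x, w, z, y, s, t].Nodup := by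
  have hw := D.pathA₁.right_mem
  have hz := D.pathA₂.left_mem
  have hs := D.pathB₁.right_mem
  have ht := D.pathB₂.left_mem
  refine D.detour.nodup.sublist ?_
  have : [x, w, z, y, s, t] = [x] ++ ([w] ++ [z]) ++ [y] ++ ([s] ++ [t]) ++ [] := rfl
  rw [this]
  exact (((((List.Sublist.refl _).append ((List.singleton_sublist.2 hw).append
    (List.singleton_sublist.2 hz))).append (List.Sublist.refl _)).append
    ((List.singleton_sublist.2 hs).append (List.singleton_sublist.2 ht)))).append
    (List.nil_sublist _)

lemma not_adj_zs (D : G.CutDetour x y a a' b b' h h' w z s t A₁ A₂ B₁ B₂ P) (hG : ClawFree G) :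
    ¬ G.Adj z s := by
  intro H
  have hn := D.nodup_ends
  simp only [List.nodup_cons, List.mem_cons, not_or] at hn
  exact hG s y z t (by grind) (by grind) (by grind) D.adj_ys.symm H.symm D.adj_st
    ⟨D.not_adj_yz hG, D.not_adj_yt, D.not_adj_zt hG⟩

lemma not_adj_ws (D : G.CutDetour x y a a' b b' h h' w z s t A₁ A₂ B₁ B₂ P) (hG : ClawFree G) :
    ¬ G.Adj w s := by
  intro H
  have hn := D.nodup_ends
  simp only [List.nodup_cons, List.mem_cons, not_or] at hn
  exact hG w x z s (by grind) (by grind) (by grind) D.adj_xw.symm D.adj_wz H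
    ⟨D.not_adj_xz, D.swap.not_adj_yw hG, D.not_adj_zs hG⟩

end CutDetour

/-- Six vertices with the adjacencies of a path form an induced path. -/
lemma isInducedP6_of_adj {p q r s t u : V}
    (h₁ : G.Adj p q) (h₂ : G.Adj q r) (h₃ : G.Adj r s) (h₄ : G.Adj s t) (h₅ : G.Adj t u)
    (n₁ : ¬ G.Adj p r) (n₂ : ¬ G.Adj p s) (n₃ : ¬ G.Adj p t) (n₄ : ¬ G.Adj p u)
    (n₅ : ¬ G.Adj q s) (n₆ : ¬ G.Adj q t) (n₇ : ¬ G.Adj q u)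
    (n₈ : ¬ G.Adj r t) (n₉ : ¬ G.Adj r u) (n₁₀ : ¬ G.Adj s u) :
    IsInducedP6 G ![p, q, r, s, t, u] := by
  have key : ∀ i j : Fin 6, G.Adj (![p, q, r, s, t, u] i) (![p, q, r, s, t, u] j) ↔
      (i.val + 1 = j.val ∨ j.val + 1 = i.val) := by
    intro i j
    fin_cases i <;> fin_cases j <;> simp [*, G.adj_comm]
  refine ⟨fun i j hij => ?_, key⟩
  have twin : ∀ i j : Fin 6, (∀ k : Fin 6, (i.val + 1 = k.val ∨ k.val + 1 = i.val) ↔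
      (j.val + 1 = k.val ∨ k.val + 1 = j.val)) → i = j := by decide
  exact twin i j fun k => by rw [← key, ← key, hij]

/-- In a claw-free graph, a detour of minimal length yields an induced `P₆`. -/
lemma CutDetour.exists_isInducedP6 {x y a a' b b' h h' w z s t : V} {A₁ A₂ B₁ B₂ P : List V}
    (D : G.CutDetour x y a a' b b' h h' w z s t A₁ A₂ B₁ B₂ P) (hG : ClawFree G)
    (hmin : ∀ u v S, G.ListPath u v S → S.Sublist P → G.Adj x u → G.Adj v y →
      P.length ≤ S.length) : ∃ v, IsInducedP6 G v := by
  have hwt : ¬ G.Adj w t := fun H => D.swap.not_adj_zs hG H.symm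
  have hxs := D.swap.not_adj_yw hG
  have hyw := D.not_adj_yw hG
  have hyz := D.not_adj_yz hG
  by_cases hxy : G.Adj x y
  · exact ⟨_, isInducedP6_of_adj D.adj_wz.symm D.adj_xw.symm hxy D.adj_ys D.adj_st
      (mt Adj.symm D.not_adj_xz) (mt Adj.symm hyz) (D.not_adj_zs hG) (D.not_adj_zt hG)
      (mt Adj.symm hyw) (D.not_adj_ws hG) hwt hxs (D.swap.not_adj_yz hG) D.not_adj_yt⟩
  have hwP := fun {c} => D.not_adj_w_of_mem hG (c := c)
  have hzP := fun {c} => D.not_adj_z_of_mem hG (c := c)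
  have hsP : ∀ {c}, c ∈ P → ¬ G.Adj c s := fun hc H =>
    D.swap.not_adj_w_of_mem hG (List.mem_reverse.2 hc) H.symm
  have hP := D.detour.pathP
  have hxh := D.detour.adj_xh
  have hhy := D.detour.adj_hy
  cases hP with
  | single =>
    exact ⟨_, isInducedP6_of_adj D.adj_wz.symm D.adj_xw.symm hxh hhy D.adj_ys
      (mt Adj.symm D.not_adj_xz) (hzP (by simp)) (mt Adj.symm hyz) (D.not_adj_zs hG)
      (hwP (by simp)) (mt Adj.symm hyw) (D.not_adj_ws hG) hxy hxs (hsP (by simp))⟩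
  | cons h₁₂ hP =>
    cases hP with
    | single =>
      refine ⟨_, isInducedP6_of_adj D.adj_wz.symm D.adj_xw.symm hxh h₁₂ hhy
        (mt Adj.symm D.not_adj_xz) (hzP (by simp)) (hzP (by simp)) (mt Adj.symm hyz)
        (hwP (by simp)) (hwP (by simp)) (mt Adj.symm hyw) (fun H => ?_) hxy (fun H => ?_)⟩
      · simpa using hmin _ _ _ (.single _) (by simp) H hhy
      · simpa using hmin _ _ _ (.single _) (by simp) hxh H
    | cons h₂₃ hP =>
      have hc := hP.left_mem
      refine ⟨_, isInducedP6_of_adj D.adj_wz.symm D.adj_xw.symm hxh h₁₂ h₂₃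
        (mt Adj.symm D.not_adj_xz) (hzP (by simp)) (hzP (by simp)) (hzP (by simp [hc]))
        (hwP (by simp)) (hwP (by simp)) (hwP (by simp [hc])) (fun H => ?_) (fun H => ?_)
        (fun H => ?_)⟩
      · simpa using hmin _ _ _ (.cons h₂₃ hP) (by simp) H hhy
      · have := hmin _ _ _ hP (by simp) H hhy
        simp at this
      · simpa using hmin _ _ _ (.cons H hP) (by simp) hxh hhy

/-- A longest closed list together with a path outside of it joining two of its vertices is a
detour. -/
lemma exists_detour {x y h h' : V} {A B P : List V} (hC : G.ClosedList ([x] ++ A ++ [y] ++ B))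
    (hmax : ∀ m, G.ClosedList m → m.length ≤ ([x] ++ A ++ [y] ++ B).length)
    (hP : G.ListPath h h' P) (hn : P.Nodup) (hdisj : ∀ c ∈ P, c ∉ [x] ++ A ++ [y] ++ B)
    (hxh : G.Adj x h) (hhy : G.Adj h' y) :
    ∃ a a' b b', G.Detour x y a a' b b' h h' A B P := by
  classical
  have hnl : ∀ S : List V, S ≠ [] → S.Nodup → S ⊆ P → ∀ u v m, G.ListPath u v m → G.Adj v u →
      ¬ m.Perm ([x] ++ A ++ [y] ++ B ++ S) := by
    intro S hS hSn hSP u v m hm hvu hp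
    have h1 : ([x] ++ A ++ [y] ++ B ++ S).Nodup :=
      List.nodup_append.2 ⟨hC.1, hSn, fun c hc d hd e => hdisj d (hSP hd) (e ▸ hc)⟩
    have h2 := hmax m ⟨hp.nodup_iff.2 h1, u, v, hm, hvu⟩
    rw [hp.length_eq, List.length_append] at h2
    have := List.length_pos_iff.2 hS
    omega
  have hnP : ([x] ++ A ++ [y] ++ B ++ P).Nodup :=
    List.nodup_append.2 ⟨hC.1, hn, fun c hc d hd e => hdisj d hd (e ▸ hc)⟩
  obtain ⟨-, u, v, hp, hvu⟩ := hC
  have hB : B ≠ [] := by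
    rintro rfl
    rw [List.append_nil] at hp
    obtain ⟨w, z, h1, h2, h3⟩ := hp.split (by simp) (by simp)
    obtain rfl := h1.eq_left
    obtain rfl := h3.eq_right
    refine hnl P hP.ne_nil hn (List.Subset.refl _) _ _ _ (hp.append hhy.symm hP.reverse)
      hxh.symm ?_
    rw [List.append_nil]
    exact (List.reverse_perm P).append_left _
  obtain ⟨w₁, b, hp₁, e₁, hb⟩ := hp.split (by simp) hB
  obtain ⟨w₂, y', hp₂, e₂, hy⟩ := hp₁.split (by simp) (by simp)
  obtain rfl := hy.eq_left
  obtain rfl := hy.eq_right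
  have hA : A ≠ [] := by
    rintro rfl
    rw [List.append_nil] at hp₂
    obtain rfl := hp₂.eq_left
    refine hnl P hP.ne_nil hn (List.Subset.refl _) _ _ _
      ((((ListPath.single _).append hxh hP).append hhy (.single _)).append e₁ hb) hvu ?_
    rw [List.perm_iff_count]
    intro c
    simp only [List.count_append, List.append_nil]
    omega
  obtain ⟨x', a, hx, e₃, ha⟩ := hp₂.split (by simp) hA
  obtain rfl := hx.eq_left
  obtain rfl := hx.eq_right
  exact ⟨a, w₂, b, v, ha, hb, hP, e₃, e₂, e₁, hvu, hxh, hhy, hnP, hnl⟩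

/-- In a claw-free `P₆`-free graph that stays connected when any vertex is deleted, a longest closed
list contains all vertices. -/
lemma ClosedList.mem_of_longest {l : List V} (hC : G.ClosedList l)
    (hmax : ∀ m, G.ClosedList m → m.length ≤ l.length)
    (hconn : ∀ v : V, (G.induce ({v}ᶜ : Set V)).Connected) (hG : ClawFree G)
    (hP6 : ∀ v : Fin 6 → V, ¬ IsInducedP6 G v) (c : V) : c ∈ l := by
  by_contra hc
  have hjoin : ∃ n x y h h' P, x ∈ l ∧ y ∈ l ∧ x ≠ y ∧ G.ListPath h h' P ∧ P.Nodup ∧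
      (∀ c ∈ P, c ∉ l) ∧ G.Adj x h ∧ G.Adj h' y ∧ P.length = n := by
    obtain ⟨-, u, v, hp, hvu⟩ := hC
    have hu := hp.left_mem
    have hv := hp.right_mem
    obtain ⟨h, x, L, h1, h2, hx, -, -, h3⟩ := exists_listPath_to_set_avoiding (S := {d | d ∈ l})
      (hconn v) hc hu (fun e => hc (e ▸ hv)) hvu.ne'
    have hh : h ∉ l := h3 _ h1.right_mem
    obtain ⟨d, hd, hdx⟩ : ∃ d ∈ l, d ≠ x := by
      by_cases hux : u = x
      · exact ⟨v, hv, hux ▸ hvu.ne⟩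
      · exact ⟨u, hu, hux⟩
    obtain ⟨h', y, P, k1, k2, hy, hyx, k3, k4⟩ := exists_listPath_to_set_avoiding
      (S := {d | d ∈ l}) (hconn x) hh hd (fun e => hh (e ▸ hx)) hdx
    exact ⟨_, x, y, h, h', P, hx, hy, hyx.symm, k1, k3, k4, h2.symm, k2, rfl⟩
  classical
  obtain ⟨x, y, h, h', P, hx, hy, hxy, hP, hn, hdisj, hxh, hhy, hlen⟩ := Nat.find_spec hjoin
  obtain ⟨A, B, hAB, hperm⟩ := hC.exists_split hx hy hxy
  obtain ⟨a, a', b, b', D⟩ := exists_detour hAB (fun m hm => hperm.length_eq ▸ hmax m hm) hP hn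
    (fun c hc => mt hperm.mem_iff.1 (hdisj c hc)) hxh hhy
  obtain ⟨w, z, s, t, A₁, A₂, B₁, B₂, D'⟩ := D.exists_cut hG
  obtain ⟨v, hv⟩ := D'.exists_isInducedP6 hG fun u v S hS hSP hxu hvy => by
    rw [hlen]
    exact Nat.find_min' hjoin ⟨x, y, u, v, S, hx, hy, hxy, hS, hn.sublist hSP,
      fun c hc => hdisj c (hSP.subset hc), hxu, hvy, rfl⟩
  exact hP6 v hv

/-- A finite graph with an edge has a longest closed list. -/
lemma exists_longest_closedList [Fintype V] {u v : V} (huv : G.Adj u v) :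
    ∃ l, G.ClosedList l ∧ ∀ m, G.ClosedList m → m.length ≤ l.length := by
  classical
  have h0 : G.ClosedList [u, v] :=
    ⟨by simpa using huv.ne, u, v, .cons huv (.single v), huv.symm⟩
  let Q : ℕ → Prop := fun n => ∃ l, G.ClosedList l ∧ l.length = n
  have hb : ∀ l, G.ClosedList l → l.length ≤ Fintype.card V := fun l hl => hl.1.length_le_card
  obtain ⟨l, hl, hlen⟩ : Q (Nat.findGreatest Q (Fintype.card V)) :=
    Nat.findGreatest_spec (hb _ h0) ⟨_, h0, rfl⟩
  exact ⟨l, hl, fun m hm => hlen ▸ Nat.le_findGreatest (hb m hm) ⟨m, hm, rfl⟩⟩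

end SimpleGraph

/-- Every 2-connected claw-free and `P₆`-free graph is hamiltonian. -/
theorem stmt_10 {V : Type*} [Fintype V] [DecidableEq V] (G : SimpleGraph V)
    (h2conn : TwoConnected G) (hclaw : ClawFree G)
    (hP6free : ∀ v : Fin 6 → V, ¬ IsInducedP6 G v) :
    G.IsHamiltonian := by
  obtain ⟨hcard, hconn⟩ := h2conn
  obtain ⟨c, u, v, hcu, hcv, huv⟩ := Fintype.two_lt_card_iff.1 hcard
  have hnt : Nontrivial ({c}ᶜ : Set V) :=
    ⟨⟨u, hcu.symm⟩, ⟨v, hcv.symm⟩, fun e => huv (congrArg Subtype.val e)⟩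
  obtain ⟨d, hd⟩ := (hconn c).preconnected.exists_adj_of_nontrivial ⟨u, hcu.symm⟩
  obtain ⟨l, hl, hmax⟩ := SimpleGraph.exists_longest_closedList (G := G) hd
  exact hl.isHamiltonian (hl.mem_of_longest hmax hconn hclaw hP6free) hcard
end

section
/- Every 2-connected claw-o-heavy and P6-f-heavy graph is hamiltonian. -/
/-- A graph `G` of order `n` is `P₆`-f-heavy if for every induced path `v 0, …, v 5`
on 6 vertices and every two of its vertices at distance 2 in the path (i.e. indices
differing by 2), the larger of their degrees in `G` is at least `n/2`. -/
def P6FHeavy {V : Type*} [Fintype V] (G : SimpleGraph V) [DecidableRel G.Adj] : Prop :=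
  ∀ v : Fin 6 → V, IsInducedP6 G v →
    ∀ i j : Fin 6, (i.val + 2 = j.val ∨ j.val + 2 = i.val) →
      Fintype.card V ≤ 2 * max (G.degree (v i)) (G.degree (v j))

namespace HeavyGraph

variable {V : Type*}

/-- `Trail G s u v`: the vertices of the multiset `s` can be listed, with their multiplicities,
as a walk of `G` from `u` to `v`. -/
inductive Trail (G : SimpleGraph V) : Multiset V → V → V → Prop
  | single (u : V) : Trail G {u} u u
  | cons {s : Multiset V} {u v w : V} (h : G.Adj u v) (p : Trail G s v w) : Trail G ({u} + s) u w

namespace Trail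

variable {G H : SimpleGraph V} {s t : Multiset V} {u v w x y z : V}

lemma left_mem (p : Trail G s u v) : u ∈ s := by
  cases p <;> simp

lemma right_mem (p : Trail G s u v) : v ∈ s := by
  induction p <;> simp_all

lemma mono (h : G ≤ H) (p : Trail G s u v) : Trail H s u v := by
  induction p with
  | single u => exact .single u
  | cons ha _ ih => exact .cons (h ha) ih

lemma join (p : Trail G s u v) (h : G.Adj v w) (q : Trail G t w z) : Trail G (s + t) u z := by
  induction p with
  | single u => exact .cons h q
  | cons ha _ ih => rw [add_assoc]; exact .cons ha (ih h)

lemma reverse (p : Trail G s u v) : Trail G s v u := by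
  induction p with
  | single u => exact .single u
  | cons ha _ ih => rw [add_comm]; exact ih.join ha.symm (.single _)

lemma copy (p : Trail G s u v) (h : s = t) : Trail G t u v := h ▸ p

/-- Cut a trail immediately before one of its vertices. -/
lemma cut_before (p : Trail G s u v) (hx : x ∈ s) :
    x = u ∨ ∃ s₁ s₂ y, Trail G s₁ u y ∧ G.Adj y x ∧ Trail G s₂ x v ∧ s = s₁ + s₂ := by
  induction p with
  | single u => simp_all
  | @cons s u v w ha p ih =>
    rcases Multiset.mem_add.1 hx with hx | hx
    · exact .inl (by simpa using hx)
    · right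
      rcases ih hx with rfl | ⟨s₁, s₂, y, h₁, h₂, h₃, rfl⟩
      · exact ⟨_, _, u, .single u, ha, p, rfl⟩
      · exact ⟨_, _, y, .cons ha h₁, h₂, h₃, (add_assoc _ _ _).symm⟩

/-- Cut a trail immediately after one of its vertices. -/
lemma cut_after (p : Trail G s u v) (hx : x ∈ s) :
    x = v ∨ ∃ s₁ s₂ y, Trail G s₁ u x ∧ G.Adj x y ∧ Trail G s₂ y v ∧ s = s₁ + s₂ := by
  rcases p.reverse.cut_before hx with h | ⟨s₁, s₂, y, h₁, h₂, h₃, rfl⟩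
  · exact .inl h
  · exact .inr ⟨s₂, s₁, y, h₃.reverse, h₂.symm, h₁.reverse, add_comm _ _⟩

lemma eq_singleton (p : Trail G s u u) (hs : s.Nodup) : s = {u} := by
  cases p with
  | single => rfl
  | cons ha p =>
    exact absurd hs fun h => Multiset.disjoint_left.1 (Multiset.nodup_add.1 h).2.2
      (Multiset.mem_singleton_self u) p.right_mem

end Trail

lemma false_of_mem_mem {s t r : Multiset V} {x : V} (hr : r.Nodup) (h : r = s + t) (hs : x ∈ s)
    (ht : x ∈ t) : False := by
  subst h
  exact Multiset.disjoint_left.1 (Multiset.nodup_add.1 hr).2.2 hs ht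

section
variable {G : SimpleGraph V} {s : Multiset V} {u v x y : V}

/-- Adding a single edge to a trail. -/
lemma Trail.of_sup_edge (p : Trail (G ⊔ SimpleGraph.edge u v) s x y) (hs : s.Nodup) :
    Trail G s x y ∨ ∃ s₁ s₂, s = s₁ + s₂ ∧
      (Trail G s₁ x u ∧ Trail G s₂ v y ∨ Trail G s₁ x v ∧ Trail G s₂ u y) := by
  induction p with
  | single u => exact .inl (.single u)
  | @cons s x z y ha p ih =>
    obtain ⟨-, hs', hd⟩ := Multiset.nodup_add.1 hs
    have hx : x ∉ s := fun h => Multiset.disjoint_left.1 hd (Multiset.mem_singleton_self x) h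
    by_cases hxz : G.Adj x z
    · rcases ih hs' with h | ⟨s₁, s₂, rfl, ⟨h₁, h₂⟩ | ⟨h₁, h₂⟩⟩
      · exact .inl (.cons hxz h)
      · exact .inr ⟨_, s₂, (add_assoc _ _ _).symm, .inl ⟨.cons hxz h₁, h₂⟩⟩
      · exact .inr ⟨_, s₂, (add_assoc _ _ _).symm, .inr ⟨.cons hxz h₁, h₂⟩⟩
    · have hxz' : x = u ∧ z = v ∨ x = v ∧ z = u := by
        rw [SimpleGraph.sup_adj, SimpleGraph.edge_adj] at ha
        tauto
      rcases ih hs' with h | ⟨s₁, s₂, rfl, ⟨h₁, h₂⟩ | ⟨h₁, h₂⟩⟩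
      · rcases hxz' with ⟨rfl, rfl⟩ | ⟨rfl, rfl⟩
        · exact .inr ⟨{x}, s, rfl, .inl ⟨.single x, h⟩⟩
        · exact .inr ⟨{x}, s, rfl, .inr ⟨.single x, h⟩⟩
      · have := h₁.right_mem
        have := h₂.left_mem
        rcases hxz' with ⟨rfl, rfl⟩ | ⟨rfl, rfl⟩ <;> simp_all
      · have := h₁.right_mem
        have := h₂.left_mem
        rcases hxz' with ⟨rfl, rfl⟩ | ⟨rfl, rfl⟩ <;> simp_all

open Classical in
lemma Trail.exists_crossing_or (P Q : V → Prop) (p : Trail G s x y) :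
    (∃ s₁ s₂ a b, Trail G s₁ x a ∧ Trail G s₂ b y ∧ s = s₁ + s₂ ∧ P b ∧ Q a) ∨
      s.countP P + s.countP Q + 1 ≤
        Multiset.card s + (if P x then 1 else 0) + (if Q y then 1 else 0) := by
  induction p with
  | single x => right; simp [← Multiset.cons_zero, Multiset.countP_cons]
  | @cons s x z y ha p ih =>
    rcases ih with ⟨s₁, s₂, a, b, h₁, h₂, rfl, h⟩ | ih
    · exact .inl ⟨_, s₂, a, b, .cons ha h₁, h₂, (add_assoc _ _ _).symm, h⟩
    · by_cases h : P z ∧ Q x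
      · exact .inl ⟨_, _, x, z, .single x, p, rfl, h⟩
      · right
        rw [Multiset.singleton_add, Multiset.countP_cons, Multiset.countP_cons, Multiset.card_cons]
        rw [not_and_or] at h
        rcases h with h | h
        · rw [if_neg h] at ih
          split_ifs at * <;> omega
        · rw [if_neg h]
          split_ifs at * <;> omega

end

section
variable [Fintype V] {G H : SimpleGraph V} {s t : Multiset V} {u v w x y z : V}

/-- A Hamilton path from `u` to `v`. -/
def HamPath (G : SimpleGraph V) (u v : V) : Prop := Trail G (Finset.univ : Finset V).val u v

/-- A Hamilton cycle, as a Hamilton path with adjacent ends. -/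
def Ham (G : SimpleGraph V) : Prop := ∃ u v, HamPath G u v ∧ G.Adj v u

noncomputable def deg (G : SimpleGraph V) (v : V) : ℕ := (G.neighborSet v).ncard

lemma Ham.mono (h : G ≤ H) : Ham G → Ham H := fun ⟨u, v, p, ha⟩ => ⟨u, v, Trail.mono h p, h ha⟩

lemma deg_mono (h : G ≤ H) (v : V) : deg G v ≤ deg H v :=
  Set.ncard_le_ncard (fun _ hw => h hw) (Set.toFinite _)

lemma HamPath.reverse (p : HamPath G u v) : HamPath G v u := Trail.reverse p

lemma Trail.ham (p : Trail G s u v) (hs : s = (Finset.univ : Finset V).val) (h : G.Adj v u) :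
    Ham G := ⟨u, v, p.copy hs, h⟩

lemma ham_of_crossing (p : Trail G s u y) (q : Trail G t z v)
    (h : (Finset.univ : Finset V).val = s + t) (huz : G.Adj u z) (hvy : G.Adj v y) : Ham G :=
  (p.reverse.join huz q).ham h.symm hvy

lemma hamPath_of_ham_sup_edge (hn : 3 ≤ Fintype.card V) (hG : ¬ Ham G)
    (h : Ham (G ⊔ SimpleGraph.edge u v)) : HamPath G u v := by
  obtain ⟨a, b, p, hba⟩ := h
  have hnd := (Finset.univ : Finset V).nodup
  have hc : ∀ c d : V, (Finset.univ : Finset V).val ≠ {c} + {d} := by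
    intro c d h
    have := congrArg Multiset.card h
    simp at this
    omega
  have hba' : G.Adj b a ∨ b = u ∧ a = v ∨ b = v ∧ a = u := by
    rw [SimpleGraph.sup_adj, SimpleGraph.edge_adj] at hba
    tauto
  rcases p.of_sup_edge hnd with h | ⟨s₁, s₂, hs, ⟨h₁, h₂⟩ | ⟨h₁, h₂⟩⟩
  · rcases hba' with h' | ⟨rfl, rfl⟩ | ⟨rfl, rfl⟩
    · exact absurd ⟨a, b, h, h'⟩ hG
    · exact h.reverse
    · exact h
  · rcases hba' with h' | ⟨rfl, rfl⟩ | ⟨rfl, rfl⟩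
    · exact ((h₂.join h' h₁).copy ((add_comm _ _).trans hs.symm)).reverse
    · exact (false_of_mem_mem hnd hs h₁.right_mem h₂.right_mem).elim
    · obtain ⟨n₁, n₂, -⟩ := Multiset.nodup_add.1 (hs ▸ hnd)
      exact (hc _ _ (hs.trans (by rw [h₁.eq_singleton n₁, h₂.eq_singleton n₂]))).elim
  · rcases hba' with h' | ⟨rfl, rfl⟩ | ⟨rfl, rfl⟩
    · exact ((h₂.join h' h₁).copy ((add_comm _ _).trans hs.symm))
    · obtain ⟨n₁, n₂, -⟩ := Multiset.nodup_add.1 (hs ▸ hnd)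
      exact (hc _ _ (hs.trans (by rw [h₁.eq_singleton n₁, h₂.eq_singleton n₂]))).elim
    · exact (false_of_mem_mem hnd hs h₁.right_mem h₂.right_mem).elim

open Classical in
lemma countP_adj (G : SimpleGraph V) (u : V) :
    (Finset.univ : Finset V).val.countP (G.Adj u) = deg G u := by
  have h : G.neighborSet u = (Finset.univ.filter (G.Adj u) : Finset V) := by ext; simp
  rw [deg, Multiset.countP_eq_card_filter, h, Set.ncard_coe_finset]
  rfl

/-- Ore's lemma. -/
lemma HamPath.ham_of_card_le (p : HamPath G u v)
    (h : Fintype.card V ≤ deg G u + deg G v) : Ham G := by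
  rcases Trail.exists_crossing_or (G.Adj u) (G.Adj v) p with
    ⟨s₁, s₂, a, b, h₁, h₂, hs, hb, ha⟩ | hle
  · exact ham_of_crossing h₁ h₂ hs hb ha
  · rw [countP_adj, countP_adj] at hle
    simp at hle
    omega

/-- Join all pairs of vertices with degree sum at least the order. -/
def star (G : SimpleGraph V) : SimpleGraph V where
  Adj u v := G.Adj u v ∨ u ≠ v ∧ Fintype.card V ≤ deg G u + deg G v
  symm := ⟨fun u v h => h.imp (·.symm) fun h => ⟨h.1.symm, by omega⟩⟩
  loopless := ⟨fun u h => by simp at h⟩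

lemma le_star (G : SimpleGraph V) : G ≤ star G := fun _ _ h => .inl h

lemma star_mono (h : G ≤ H) : star G ≤ star H := fun a b hab =>
  hab.imp (h ·) fun h' => ⟨h'.1, h'.2.trans (add_le_add (deg_mono h a) (deg_mono h b))⟩

lemma exists_maximal_not_ham (hGH : G ≤ H) (hG : ¬ Ham G) :
    ∃ K, G ≤ K ∧ K ≤ H ∧ ¬ Ham K ∧ ∀ L, K ≤ L → L ≤ H → ¬ Ham L → L = K := by
  obtain ⟨K, hK, hm⟩ := (Set.toFinite {K : SimpleGraph V | K ≤ H ∧ ¬ Ham K}).exists_le_maximal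
    (show G ∈ _ from ⟨hGH, hG⟩)
  exact ⟨K, hK, hm.prop.1, hm.prop.2, fun L hL hLH hn => le_antisymm (hm.le_of_ge ⟨hLH, hn⟩ hL) hL⟩

lemma adj_of_heavy_of_maximal {K : SimpleGraph V} (hn : 3 ≤ Fintype.card V) (hK : ¬ Ham K)
    (hm : ∀ L, K ≤ L → L ≤ H → ¬ Ham L → L = K) (hKH : K ≤ H) (huv : H.Adj u v)
    (hd : Fintype.card V ≤ deg K u + deg K v) : K.Adj u v := by
  by_contra hadj
  have hne := huv.ne
  by_cases hh : Ham (K ⊔ SimpleGraph.edge u v)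
  · exact hK ((hamPath_of_ham_sup_edge hn hK hh).ham_of_card_le hd)
  · have := hm _ le_sup_left (sup_le hKH ?_) hh
    · apply hadj
      rw [← this, SimpleGraph.sup_adj, SimpleGraph.edge_adj]
      tauto
    · intro a b hab
      rw [SimpleGraph.edge_adj] at hab
      rcases hab with ⟨⟨rfl, rfl⟩ | ⟨rfl, rfl⟩, -⟩
      exacts [huv, huv.symm]

lemma not_ham_star (hn : 3 ≤ Fintype.card V) (hG : ¬ Ham G) : ¬ Ham (star G) := by
  obtain ⟨K, hGK, hKs, hK, hm⟩ := exists_maximal_not_ham (le_star G) hG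
  have : star G ≤ K := by
    intro a b hab
    rcases hab with h | h
    · exact hGK h
    · exact adj_of_heavy_of_maximal hn hK hm hKs (.inr h)
        (h.2.trans (add_le_add (deg_mono hGK a) (deg_mono hGK b)))
  exact fun h => hK (h.mono this)

end

end HeavyGraph

namespace HeavyGraph

section
variable {V : Type*} {G : SimpleGraph V} {x v : V}

/-- Make the neighbourhood of `x` a clique. -/
def completion (G : SimpleGraph V) (x : V) : SimpleGraph V where
  Adj u v := G.Adj u v ∨ u ≠ v ∧ G.Adj x u ∧ G.Adj x v
  symm := ⟨fun u v h => h.imp (·.symm) fun h => ⟨h.1.symm, h.2.2, h.2.1⟩⟩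
  loopless := ⟨fun u h => by simp at h⟩

lemma le_completion (G : SimpleGraph V) (x : V) : G ≤ completion G x := fun _ _ h => .inl h

lemma adj_of_completion_adj (h : (completion G x).Adj x v) : G.Adj x v :=
  h.elim id fun h => h.2.2

end

variable {V : Type*} [Fintype V] {G S : SimpleGraph V} {a b c s t : Multiset V}
  {u v w x y z w' x' p q : V}

lemma univ_nodup : (Finset.univ : Finset V).val.Nodup := Finset.nodup _

/-- Any three neighbours of `x` in `G` contain a pair that is adjacent in `S`. -/
def ClawsAt (G S : SimpleGraph V) (x : V) : Prop :=
  ∀ b₁ b₂ b₃, b₁ ≠ b₂ → b₁ ≠ b₃ → b₂ ≠ b₃ → G.Adj x b₁ → G.Adj x b₂ → G.Adj x b₃ →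
    S.Adj b₁ b₂ ∨ S.Adj b₁ b₃ ∨ S.Adj b₂ b₃

lemma false_of_segments (hGS : G ≤ S) (hS : ¬ Ham S) (A : Trail G a u w') (hw' : G.Adj w' w)
    (hwy : G.Adj w y) (B : Trail G b y x') (hx' : G.Adj x' x) (hxz : G.Adj x z)
    (C : Trail G c z v) (hs : (Finset.univ : Finset V).val = a + ({w} + (b + ({x} + c))))
    (hxu : G.Adj x u) (hxv : G.Adj x v) (huw : S.Adj u w) (hwv : S.Adj w v) (huv : ¬ S.Adj u v)
    (hne : u ≠ v) (hX : ClawsAt G S x)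
    (hW : ∀ y₁ y₂, G.Adj w y₁ → G.Adj w y₂ → y₁ = y₂ ∨ y₁ = x ∨ y₂ = x ∨ S.Adj y₁ y₂ ∨
      S.Adj x y₁ ∨ S.Adj x y₂) : False := by
  have hnd := univ_nodup (V := V)
  have h1 : u ≠ x' := by
    rintro rfl
    exact false_of_mem_mem hnd hs A.left_mem (by simp [B.right_mem])
  have h2 : v ≠ x' := by
    rintro rfl
    exact false_of_mem_mem (x := v) hnd (hs.trans (by abel : _ = (a + {w} + b) + ({x} + c)))
      (by simp [B.right_mem]) (by simp [C.right_mem])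
  have h3 : w' ≠ y := by
    rintro rfl
    exact false_of_mem_mem hnd hs A.right_mem (by simp [B.left_mem])
  have h4 : w' ≠ x := by
    rintro rfl
    exact false_of_mem_mem hnd hs A.right_mem (by simp)
  have h5 : y ≠ x := by
    rintro rfl
    exact false_of_mem_mem (x := y) hnd (hs.trans (by abel : _ = (a + {w} + b) + ({y} + c)))
      (by simp [B.left_mem]) (by simp)
  have A' := A.mono hGS
  have B' := B.mono hGS
  have C' := C.mono hGS
  have hv : ¬ S.Adj v x' := fun h => hS <| ham_of_crossing
    ((A'.join (hGS hw') (.single w)).join (hGS hwy) B')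
    (.cons (hGS hxz) C') (by rw [hs]; abel) (hGS hxu.symm) h
  have hu : S.Adj u x' := by
    rcases hX u v x' hne h1 h2 hxu hxv hx'.symm with h | h | h
    exacts [absurd h huv, h, absurd h hv]
  rcases hW w' y hw'.symm hwy with h | h | h | h | h | h
  · exact h3 h
  · exact h4 h
  · exact h5 h
  · exact hS <| (B'.reverse.join h.symm <| A'.reverse.join huw <| .cons hwv <|
      C'.reverse.join (hGS hxz.symm) (.single x)).ham (by rw [hs]; abel) (hGS hx'.symm)
  · exact hS <| (A'.reverse.join hu <| B'.reverse.join (hGS hwy.symm) <| .cons hwv <|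
      C'.reverse.join (hGS hxz.symm) (.single x)).ham (by rw [hs]; abel) h
  · exact hS <| (B'.join hu.symm <| (A'.join (hGS hw') (.single w)).join hwv <|
      C'.reverse.join (hGS hxz.symm) (.single x)).ham (by rw [hs]; abel) h

lemma false_of_cut (hGS : G ≤ S) (hS : ¬ Ham S) (P : Trail G s u x') (hx' : G.Adj x' x)
    (Q : Trail G t x v) (hs : (Finset.univ : Finset V).val = s + t) (hw : w ∈ s)
    (hxu : G.Adj x u) (hxv : G.Adj x v) (hxw : G.Adj x w) (huw : S.Adj u w) (hwv : S.Adj w v)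
    (huv : ¬ S.Adj u v) (hne : u ≠ v) (hX : ClawsAt G S x)
    (hW : ∀ y₁ y₂, G.Adj w y₁ → G.Adj w y₂ → y₁ = y₂ ∨ y₁ = x ∨ y₂ = x ∨ S.Adj y₁ y₂ ∨
      S.Adj x y₁ ∨ S.Adj x y₂) : False := by
  rcases P.cut_before hw with rfl | ⟨s₁, s₂, w', P₁, h, P₂, rfl⟩
  · exact huw.ne rfl
  cases P₂ with
  | single =>
    exact hS (ham_of_crossing (P.mono hGS) (Q.mono hGS) hs (hGS hxu.symm) hwv.symm)
  | cons h₂ P₂ =>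
    cases Q with
    | single => exact hxv.ne rfl
    | cons h₃ Q =>
      exact false_of_segments hGS hS P₁ h h₂ P₂ hx' h₃ Q (by rw [hs]; abel) hxu hxv huw hwv huv
        hne hX hW

lemma not_hamPath_of_common_neighbor (hGS : G ≤ S) (hS : ¬ Ham S)
    (hxu : G.Adj x u) (hxv : G.Adj x v) (hxw : G.Adj x w) (huw : S.Adj u w) (hwv : S.Adj w v)
    (huv : ¬ S.Adj u v) (hne : u ≠ v) (hX : ClawsAt G S x)
    (hW : ∀ y₁ y₂, G.Adj w y₁ → G.Adj w y₂ → y₁ = y₂ ∨ y₁ = x ∨ y₂ = x ∨ S.Adj y₁ y₂ ∨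
      S.Adj x y₁ ∨ S.Adj x y₂) : ¬ HamPath G u v := by
  intro P
  rcases P.cut_before (Finset.mem_univ_val x) with rfl | ⟨s, t, x', P, hx', Q, hs⟩
  · exact hxu.ne rfl
  by_cases hw : w ∈ s
  · exact false_of_cut hGS hS P hx' Q hs hw hxu hxv hxw huw hwv huv hne hX hW
  · have hw : w ∈ t := by
      have := Finset.mem_univ_val w
      rw [hs, Multiset.mem_add] at this
      tauto
    cases Q with
    | single => exact hxv.ne rfl
    | cons h Q =>
      have hw : w ∈ _ := (Multiset.mem_add.1 hw).resolve_left (by simpa using hxw.ne')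
      exact false_of_cut hGS hS Q.reverse h.symm (.cons hx'.symm P.reverse) (by rw [hs]; abel) hw
        hxv hxu hxw hwv.symm huw.symm (fun h => huv h.symm) hne.symm hX hW

lemma false_of_cut_of_common_neighbors (hGS : G ≤ S) (hS : ¬ Ham S) (P : Trail G s p x)
    (hxu : G.Adj x u) (Q : Trail G t u q) (hs : (Finset.univ : Finset V).val = s + t) (hv : v ∈ s)
    (hup : G.Adj u p) (huq : G.Adj u q) (hvp : G.Adj v p) (hvq : G.Adj v q) (huv : S.Adj u v)
    (hpq : ¬ S.Adj p q) (hne : p ≠ q) (hU : ClawsAt G S u) (hV : ClawsAt G S v) : False := by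
  have hnd := univ_nodup (V := V)
  rcases P.cut_after hv with rfl | ⟨s₁, s₂, y, P₁, h, P₂, rfl⟩
  · exact hS (ham_of_crossing (P.mono hGS) (Q.mono hGS) hs (hGS hup.symm) (hGS hvq.symm))
  have A := P₁.mono hGS
  have B := P₂.mono hGS
  have C := Q.mono hGS
  have hpx : p ≠ x := by
    rintro rfl
    exact false_of_mem_mem hnd (hs.trans (add_assoc _ _ _)) A.left_mem (by simp [B.right_mem])
  have hqx : q ≠ x := by
    rintro rfl
    exact false_of_mem_mem hnd hs (by simp [B.right_mem]) C.right_mem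
  have hpy : p ≠ y := by
    rintro rfl
    exact false_of_mem_mem hnd (hs.trans (add_assoc _ _ _)) A.left_mem (by simp [B.left_mem])
  have hqy : q ≠ y := by
    rintro rfl
    exact false_of_mem_mem hnd hs (by simp [B.left_mem]) C.right_mem
  have h1 : S.Adj p x := by
    rcases hU p q x hne hpx hqx hup huq hxu.symm with h' | h' | h'
    · exact absurd h' hpq
    · exact h'
    · exact absurd (ham_of_crossing (A.join (hGS h) B) C hs (hGS hup.symm) h') hS
  have h2 : S.Adj q y := by
    rcases hV p q y hne hpy hqy hvp hvq h with h' | h' | h'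
    · exact absurd h' hpq
    · exact absurd (ham_of_crossing A (B.join (hGS hxu) C) (hs.trans (add_assoc _ _ _)) h'
        (hGS hvq.symm)) hS
    · exact h'
  exact hS <| (B.join h1.symm <| A.join huv.symm C).ham (by rw [hs]; abel) h2

lemma not_hamPath_of_common_neighbors (hGS : G ≤ S) (hS : ¬ Ham S)
    (hup : G.Adj u p) (huq : G.Adj u q) (hvp : G.Adj v p) (hvq : G.Adj v q) (huv : S.Adj u v)
    (hpq : ¬ S.Adj p q) (hne : p ≠ q) (hU : ClawsAt G S u) (hV : ClawsAt G S v) :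
    ¬ HamPath G p q := by
  intro P
  rcases P.cut_before (Finset.mem_univ_val u) with rfl | ⟨s, t, x, P, hx, Q, hs⟩
  · exact hup.ne rfl
  by_cases hv : v ∈ s
  · exact false_of_cut_of_common_neighbors hGS hS P hx Q hs hv hup huq hvp hvq huv hpq hne hU hV
  · have hv : v ∈ t := by
      have := Finset.mem_univ_val v
      rw [hs, Multiset.mem_add] at this
      tauto
    rcases Q.cut_before hv with rfl | ⟨t₁, t₂, y, Q₁, h, Q₂, rfl⟩
    · exact huv.ne rfl
    · exact false_of_cut_of_common_neighbors hGS hS (P.join hx Q₁) h Q₂ (by rw [hs]; abel)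
        (by simp [Q₁.left_mem]) hvp hvq hup huq huv.symm hpq hne hV hU

/-- Every claw has two leaves with degree sum at least the order. -/
def ClawHeavy (G : SimpleGraph V) : Prop := ∀ x, ClawsAt G (star G) x

lemma not_ham_completion {G₁ : SimpleGraph V} (hn : 3 ≤ Fintype.card V) (hG : ClawHeavy G)
    (hp : G.Adj x p) (hq : G.Adj x q) (hne : p ≠ q) (hpq : ¬ (star G).Adj p q) (hG₁ : G ≤ G₁)
    (hG₁x : G₁ ≤ completion G x) (hham : ¬ Ham G₁) (hpq₁ : G₁.Adj p q) :
    ¬ Ham (completion G x) := by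
  obtain ⟨K, hK₁, hKx, hK, hm⟩ := exists_maximal_not_ham hG₁x hham
  have hGK := hG₁.trans hK₁
  have hheavy : ∀ {a b}, G.Adj x a → G.Adj x b → (star K).Adj a b → K.Adj a b := by
    intro a b ha hb h
    rcases h with h | h
    · exact h
    · exact adj_of_heavy_of_maximal hn hK hm hKx (.inr ⟨h.1, ha, hb⟩) h.2
  have hxK : ∀ {a}, K.Adj x a → G.Adj x a := fun h => adj_of_completion_adj (hKx h)
  have htrans : ∀ {a b c}, G.Adj x a → G.Adj x b → G.Adj x c → K.Adj a b → K.Adj b c → a ≠ c →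
      K.Adj a c := by
    intro a b c ha hb hc hab hbc hac
    by_contra hcon
    have hpath : HamPath K a c := by
      refine hamPath_of_ham_sup_edge hn hK (not_not.1 fun hh => ?_)
      refine hcon ?_
      rw [← hm _ le_sup_left (sup_le hKx ?_) hh, SimpleGraph.sup_adj, SimpleGraph.edge_adj]
      · tauto
      · intro d e hde
        rw [SimpleGraph.edge_adj] at hde
        rcases hde with ⟨⟨rfl, rfl⟩ | ⟨rfl, rfl⟩, h⟩
        exacts [.inr ⟨h, ha, hc⟩, .inr ⟨h, hc, ha⟩]
    refine not_hamPath_of_common_neighbor (le_star K) (not_ham_star hn hK) (hGK ha) (hGK hc)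
      (hGK hb) (.inl hab) (.inl hbc) (fun h => hcon (hheavy ha hc h)) hac ?_ ?_ hpath
    · intro b₁ b₂ b₃ h₁₂ h₁₃ h₂₃ h₁ h₂ h₃
      exact (hG x b₁ b₂ b₃ h₁₂ h₁₃ h₂₃ (hxK h₁) (hxK h₂) (hxK h₃)).imp (star_mono hGK ·)
        (.imp (star_mono hGK ·) (star_mono hGK ·))
    · intro y₁ y₂ h₁ h₂
      rcases hKx h₁ with h₁ | h₁
      · rcases hKx h₂ with h₂ | h₂
        · by_cases e₁ : y₁ = y₂
          · exact .inl e₁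
          by_cases e₂ : y₁ = x
          · exact .inr (.inl e₂)
          by_cases e₃ : y₂ = x
          · exact .inr (.inr (.inl e₃))
          rcases hG b y₁ y₂ x e₁ e₂ e₃ h₁ h₂ hb.symm with h | h | h
          · simp [star_mono hGK h]
          · simp [(star_mono hGK h).symm]
          · simp [(star_mono hGK h).symm]
        · simp [le_star K (hGK h₂.2.2)]
      · simp [le_star K (hGK h₁.2.2)]
  have hall : ∀ {a}, G.Adj x a → a = p ∨ K.Adj p a := by
    intro a ha
    by_cases hap : a = p
    · exact .inl hap
    by_cases haq : a = q
    · subst haq; exact .inr (hK₁ hpq₁)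
    right
    rcases hG x p q a hne (Ne.symm hap) (Ne.symm haq) hp hq ha with h | h | h
    · exact absurd h hpq
    · exact hheavy hp ha (star_mono hGK h)
    · exact htrans hp hq ha (hK₁ hpq₁) (hheavy hq ha (star_mono hGK h)) (Ne.symm hap)
  have : completion G x ≤ K := by
    rintro a b (h | ⟨h, ha, hb⟩)
    · exact hGK h
    · rcases hall ha with rfl | ha'
      · exact (hall hb).resolve_left (Ne.symm h)
      · rcases hall hb with rfl | hb'
        · exact ha'.symm
        · exact htrans ha hp hb ha'.symm hb' h
  exact fun h => hK (h.mono this)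

end HeavyGraph

namespace HeavyGraph

section
variable {V : Type*} {G H : SimpleGraph V} {x a b c d e f : V}

/-- `a, b, c, d, e, f` is an induced path. -/
structure P6 (G : SimpleGraph V) (a b c d e f : V) : Prop where
  ab : G.Adj a b
  bc : G.Adj b c
  cd : G.Adj c d
  de : G.Adj d e
  ef : G.Adj e f
  ac : ¬ G.Adj a c
  ad : ¬ G.Adj a d
  ae : ¬ G.Adj a e
  af : ¬ G.Adj a f
  bd : ¬ G.Adj b d
  be : ¬ G.Adj b e
  bf : ¬ G.Adj b f
  ce : ¬ G.Adj c e
  cf : ¬ G.Adj c f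
  df : ¬ G.Adj d f

lemma P6.reverse (h : P6 G a b c d e f) : P6 G f e d c b a where
  ab := h.ef.symm
  bc := h.de.symm
  cd := h.cd.symm
  de := h.bc.symm
  ef := h.ab.symm
  ac := fun h' => h.df h'.symm
  ad := fun h' => h.cf h'.symm
  ae := fun h' => h.bf h'.symm
  af := fun h' => h.af h'.symm
  bd := fun h' => h.ce h'.symm
  be := fun h' => h.be h'.symm
  bf := fun h' => h.ae h'.symm
  ce := fun h' => h.bd h'.symm
  cf := fun h' => h.ad h'.symm
  df := fun h' => h.ac h'.symm

lemma P6.nodup (h : P6 G a b c d e f) : [a, b, c, d, e, f].Nodup := by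
  obtain ⟨h1, h2, h3, h4, h5, h6, h7, h8, h9, h10, h11, h12, h13, h14, h15⟩ := h
  have hs : ∀ {y z}, G.Adj y z → G.Adj z y := fun h => h.symm
  simp only [List.nodup_cons, List.mem_cons, List.not_mem_nil, or_false, not_or, not_false_eq_true,
    List.nodup_nil, and_true]
  refine ⟨⟨h1.ne, ?_, ?_, ?_, ?_⟩, ⟨h2.ne, ?_, ?_, ?_⟩, ⟨h3.ne, ?_, ?_⟩, ⟨h4.ne, ?_⟩, h5.ne⟩ <;>
    rintro rfl <;> simp_all [G.adj_comm]

lemma completion_adj {u v : V} :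
    (completion G x).Adj u v ↔ G.Adj u v ∨ u ≠ v ∧ G.Adj x u ∧ G.Adj x v := Iff.rfl

end

variable {V : Type*} [Fintype V] {G : SimpleGraph V} {x a b c d e f : V}

lemma deg_le_deg_completion (h : G.Adj x b) : deg G x ≤ deg (completion G x) b := by
  classical
  refine Set.ncard_le_ncard_of_injOn (fun y => if y = b then x else y) ?_ ?_ (Set.toFinite _)
  · intro y hy
    by_cases hyb : y = b
    · simpa [hyb] using le_completion G x h.symm
    · simpa [hyb] using completion_adj.2 (.inr ⟨Ne.symm hyb, h, hy⟩)
  · intro y hy z hz hyz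
    have hy' : x ≠ y := G.ne_of_adj hy
    have hz' : x ≠ z := G.ne_of_adj hz
    dsimp only at hyz
    split_ifs at hyz <;> simp_all

/-- The neighbourhood completion creates no claw without a heavy pair. -/
lemma ClawHeavy.completion (hG : ClawHeavy G) (x : V) : ClawHeavy (completion G x) := by
  have key : ∀ {a b c d}, b ≠ c → b ≠ d → c ≠ d → a ≠ b → G.Adj x a → G.Adj x b →
      (HeavyGraph.completion G x).Adj a c → (HeavyGraph.completion G x).Adj a d →
      (star (HeavyGraph.completion G x)).Adj b c ∨ (star (HeavyGraph.completion G x)).Adj b d ∨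
        (star (HeavyGraph.completion G x)).Adj c d := by
    intro a b c d hbc hbd hcd hab hxa hxb hac had
    have hle := le_star (HeavyGraph.completion G x)
    by_cases hc : G.Adj x c
    · exact .inl (hle (.inr ⟨hbc, hxb, hc⟩))
    by_cases hd : G.Adj x d
    · exact .inr (.inl (hle (.inr ⟨hbd, hxb, hd⟩)))
    by_cases hxc : x = c
    · exact .inl (hle (.inl (hxc ▸ hxb.symm)))
    by_cases hxd : x = d
    · exact .inr (.inl (hle (.inl (hxd ▸ hxb.symm))))
    have hdeg := deg_le_deg_completion hxb
    rcases hG a x c d hxc hxd hcd hxa.symm (hac.resolve_right fun h => hc h.2.2)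
      (had.resolve_right fun h => hd h.2.2) with (h | h) | (h | h) | h
    · exact absurd h hc
    · exact .inl (.inr ⟨hbc, h.2.trans (add_le_add hdeg (deg_mono (le_completion G x) c))⟩)
    · exact absurd h hd
    · exact .inr (.inl (.inr ⟨hbd, h.2.trans (add_le_add hdeg (deg_mono (le_completion G x) d))⟩))
    · exact .inr (.inr (star_mono (le_completion G x) h))
  intro a b c d hbc hbd hcd hb hc hd
  rcases hb with hb' | hb'
  · rcases hc with hc' | hc'
    · rcases hd with hd' | hd'
      · exact (hG a b c d hbc hbd hcd hb' hc' hd').imp (star_mono (le_completion G x) ·)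
          (.imp (star_mono (le_completion G x) ·) (star_mono (le_completion G x) ·))
      · rcases key hbd.symm hcd.symm hbc hd'.1 hd'.2.1 hd'.2.2 (.inl hb') (.inl hc') with h | h | h
        exacts [.inr (.inl h.symm), .inr (.inr h.symm), .inl h]
    · rcases key hbc.symm hcd hbd hc'.1 hc'.2.1 hc'.2.2 (.inl hb') hd with h | h | h
      exacts [.inl h.symm, .inr (.inr h), .inr (.inl h)]
  · exact key hbc hbd hcd hb'.1 hb'.2.1 hb'.2.2 hc hd

/-- A vertex of degree at least half the order. -/
def Heavy (G : SimpleGraph V) (v : V) : Prop := Fintype.card V ≤ 2 * deg G v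

/-- Induced paths on six vertices have a heavy vertex in each pair at distance two. -/
def P6Heavy (G : SimpleGraph V) : Prop := ∀ ⦃a b c d e f⦄, P6 G a b c d e f →
  (Heavy G a ∨ Heavy G c) ∧ (Heavy G b ∨ Heavy G d) ∧ (Heavy G c ∨ Heavy G e) ∧
    (Heavy G d ∨ Heavy G f)

lemma Heavy.mono {H : SimpleGraph V} (h : G ≤ H) (ha : Heavy G a) : Heavy H a :=
  le_trans ha (Nat.mul_le_mul_left 2 (deg_mono h a))

lemma Heavy.completion (hx : Heavy G x) (ha : G.Adj x a) : Heavy (completion G x) a :=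
  le_trans hx (Nat.mul_le_mul_left 2 (deg_le_deg_completion ha))

lemma P6Heavy.completion (hG : P6Heavy G) (x : V) : P6Heavy (completion G x) := by
  intro a b c d e f h
  have hnd := h.nodup
  simp only [List.nodup_cons, List.mem_cons, List.not_mem_nil, or_false, not_or, not_false_eq_true,
    List.nodup_nil, and_true] at hnd
  have hm : ∀ {a}, Heavy G a → Heavy (HeavyGraph.completion G x) a := Heavy.mono (le_completion G x)
  have hx : ∀ {a}, Heavy G x → G.Adj x a → Heavy (HeavyGraph.completion G x) a := Heavy.completion
  obtain ⟨ab, bc, cd, de, ef, ac, ad, ae, af, bd, be, bf, ce, cf, df⟩ := h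
  simp only [completion_adj, not_or, not_and] at *
  have hs : ∀ {y z}, G.Adj y z → G.Adj z y := fun h => h.symm
  by_cases h1 : G.Adj a b
  case neg =>
    have A : P6 G a x b c d e := by constructor <;> grind
    have B : P6 G x b c d e f := by constructor <;> grind
    have := hG A
    have := hG B
    grind
  by_cases h2 : G.Adj b c
  case neg =>
    have A : P6 G a b x c d e := by constructor <;> grind
    have B : P6 G b x c d e f := by constructor <;> grind
    have := hG A
    have := hG B
    grind
  by_cases h3 : G.Adj c d
  case neg =>
    have A : P6 G a b c x d e := by constructor <;> grind
    have B : P6 G b c x d e f := by constructor <;> grind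
    have := hG A
    have := hG B
    grind
  by_cases h4 : G.Adj d e
  case neg =>
    have A : P6 G a b c d x e := by constructor <;> grind
    have B : P6 G b c d x e f := by constructor <;> grind
    have := hG A
    have := hG B
    grind
  by_cases h5 : G.Adj e f
  case neg =>
    have A : P6 G a b c d e x := by constructor <;> grind
    have B : P6 G b c d e x f := by constructor <;> grind
    have := hG A
    have := hG B
    grind
  have A : P6 G a b c d e f := by constructor <;> grind
  have := hG A
  grind

end HeavyGraph

namespace HeavyGraph

variable {V : Type*} [Fintype V] {G : SimpleGraph V} {x a b c d e f u v w p q : V}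

/-- An edge-maximal counterexample. -/
structure Extremal (G : SimpleGraph V) : Prop where
  card : 3 ≤ Fintype.card V
  conn : ∀ v : V, (G.induce ({v}ᶜ : Set V)).Connected
  claw : ClawHeavy G
  p6 : P6Heavy G
  not_ham : ¬ Ham G
  clique : ∀ x, ¬ Ham (completion G x) → ∀ ⦃u v⦄, G.Adj x u → G.Adj x v → u ≠ v → G.Adj u v

lemma ClawHeavy.of_distinct (hG : ClawHeavy G) (hx : G.Adj w x) (ha : G.Adj w a) (hb : G.Adj w b) :
    a = b ∨ a = x ∨ b = x ∨ (star G).Adj a b ∨ (star G).Adj x a ∨ (star G).Adj x b := by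
  by_cases e₁ : a = b
  · exact .inl e₁
  by_cases e₂ : a = x
  · exact .inr (.inl e₂)
  by_cases e₃ : b = x
  · exact .inr (.inr (.inl e₃))
  have := hG w a b x e₁ e₂ e₃ ha hb hx
  simp only [(star G).adj_comm _ x] at this
  tauto

namespace Extremal

lemma hamPath_of_not_star (hG : Extremal G) (hp : G.Adj x p) (hq : G.Adj x q) (hne : p ≠ q)
    (hpq : ¬ (star G).Adj p q) : HamPath G p q := by
  refine hamPath_of_ham_sup_edge hG.card hG.not_ham (not_not.1 fun hh => ?_)
  refine hpq (.inl (hG.clique x (not_ham_completion hG.card hG.claw hp hq hne hpq le_sup_left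
    (sup_le (le_completion G x) ?_) hh ?_) hp hq hne))
  · intro d e hde
    rw [SimpleGraph.edge_adj] at hde
    rcases hde with ⟨⟨rfl, rfl⟩ | ⟨rfl, rfl⟩, h⟩
    exacts [.inr ⟨h, hp, hq⟩, .inr ⟨h, hq, hp⟩]
  · rw [SimpleGraph.sup_adj, SimpleGraph.edge_adj]
    tauto

lemma star_trans (hG : Extremal G) (hu : G.Adj x u) (hw : G.Adj x w) (hv : G.Adj x v)
    (huw : (star G).Adj u w) (hwv : (star G).Adj w v) (hne : u ≠ v) : (star G).Adj u v := by
  by_contra huv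
  exact not_hamPath_of_common_neighbor (le_star G) (not_ham_star hG.card hG.not_ham) hu hv hw
    huw hwv huv hne (hG.claw x) (fun _ _ => hG.claw.of_distinct hw.symm)
    (hG.hamPath_of_not_star hu hv hne huv)

lemma star_of_common_neighbors (hG : Extremal G) (huv : (star G).Adj u v) (hup : G.Adj u p)
    (huq : G.Adj u q) (hvp : G.Adj v p) (hvq : G.Adj v q) (hne : p ≠ q) : (star G).Adj p q := by
  by_contra hpq
  exact not_hamPath_of_common_neighbors (le_star G) (not_ham_star hG.card hG.not_ham) hup huq hvp
    hvq huv hpq hne (hG.claw u) (hG.claw v) (hG.hamPath_of_not_star hup huq hne hpq)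

lemma adj_of_star (hG : Extremal G) (huv : (star G).Adj u v) : G.Adj u v := by
  by_contra hadj
  have hne := huv.ne
  have hdeg : Fintype.card V ≤ deg G u + deg G v := (huv.resolve_left hadj).2
  have hex : ∀ t, G.Adj u t → G.Adj v t → ∃ m, G.Adj t m ∧ m ≠ u ∧ ¬ (star G).Adj m u := by
    intro t hut hvt
    by_contra hcon
    push Not at hcon
    refine hadj (hG.clique t (fun h => not_ham_star hG.card hG.not_ham (h.mono ?_))
      hut.symm hvt.symm hne)
    rintro a b (h | ⟨hab, ha, hb⟩)
    · exact .inl h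
    · by_cases hau : a = u
      · subst hau
        exact (hcon b hb (Ne.symm hab)).symm
      by_cases hbu : b = u
      · subst hbu
        exact hcon a ha hab
      exact hG.star_trans ha hut.symm hb (hcon a ha hau) (hcon b hb hbu).symm hab
  choose! f hf using hex
  have hinj : (G.neighborSet u ∩ G.neighborSet v).ncard ≤
      ((G.neighborSet u ∪ G.neighborSet v ∪ {u, v})ᶜ : Set V).ncard := by
    refine Set.ncard_le_ncard_of_injOn f ?_ ?_ (Set.toFinite _)
    · rintro t ⟨hut, hvt⟩
      obtain ⟨h₁, h₂, h₃⟩ := hf t hut hvt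
      have hmv : f t ≠ v := fun h => h₃ (h ▸ huv.symm)
      have h₄ : ¬ G.Adj v (f t) := fun h =>
        h₃ (hG.star_trans h₁ hvt.symm hut.symm (.inl h.symm) huv.symm h₂)
      have h₅ : ¬ G.Adj u (f t) := fun h => h₃ (.inl h.symm)
      simp [h₂, hmv, h₄, h₅]
    · rintro s ⟨hus, hvs⟩ t ⟨hut, hvt⟩ hst
      by_contra hne'
      obtain ⟨h₁, h₂, h₃⟩ := hf t hut hvt
      obtain ⟨h₄, -, -⟩ := hf s hus hvs
      have := hG.star_of_common_neighbors huv hus hut hvs hvt hne'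
      exact h₃ (hG.star_of_common_neighbors this (hst ▸ h₄) hus.symm h₁ hut.symm h₂)
  have h1 := Set.ncard_union_add_ncard_inter (G.neighborSet u) (G.neighborSet v)
  have h2 : (G.neighborSet u ∪ G.neighborSet v ∪ {u, v}).ncard =
      (G.neighborSet u ∪ G.neighborSet v).ncard + 2 := by
    rw [Set.ncard_union_eq, Set.ncard_pair hne]
    rw [Set.disjoint_left]
    rintro y hy (rfl | rfl)
    · simp_all [G.adj_comm]
    · simp_all
  have h3 := Set.ncard_add_ncard_compl (G.neighborSet u ∪ G.neighborSet v ∪ {u, v})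
  rw [Nat.card_eq_fintype_card] at h3
  unfold deg at hdeg
  omega

end Extremal

/-- The structure of an edge-maximal counterexample. -/
structure Reduced (G : SimpleGraph V) : Prop where
  conn : ∀ v : V, (G.induce ({v}ᶜ : Set V)).Connected
  card : 3 ≤ Fintype.card V
  not_ham : ¬ Ham G
  claw : ∀ x, ClawsAt G G x
  diamond : ∀ ⦃a b c e⦄, G.Adj a b → G.Adj a c → G.Adj b c → G.Adj a e → G.Adj b e → c ≠ e →
    G.Adj c e
  heavy_adj : ∀ ⦃a b⦄, Heavy G a → Heavy G b → a ≠ b → G.Adj a b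
  hamPath : ∀ ⦃x p q⦄, G.Adj x p → G.Adj x q → p ≠ q → ¬ G.Adj p q → HamPath G p q
  heavy_of_p6 : ∀ ⦃a b c d e f⦄, P6 G a b c d e f → Heavy G c ∧ Heavy G d

lemma Extremal.reduced (hG : Extremal G) : Reduced G := by
  have hs : star G = G := le_antisymm (fun _ _ => hG.adj_of_star) (le_star G)
  have hheavy : ∀ ⦃a b⦄, Heavy G a → Heavy G b → a ≠ b → G.Adj a b := fun a b ha hb hab =>
    hG.adj_of_star (.inr ⟨hab, by unfold Heavy at ha hb; omega⟩)
  refine ⟨hG.conn, hG.card, hG.not_ham, fun x => ?_, ?_, hheavy, ?_, ?_⟩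
  · simpa [hs] using hG.claw x
  · intro a b c e hab hac hbc hae hbe hce
    exact hG.adj_of_star (hG.star_of_common_neighbors (.inl hab) hac hae hbc hbe hce)
  · intro x p q hp hq hne hpq
    exact hG.hamPath_of_not_star hp hq hne (by rwa [hs])
  · intro a b c d e f h
    obtain ⟨h₁, h₂, h₃, h₄⟩ := hG.p6 h
    have hnd := h.nodup
    simp only [List.nodup_cons, List.mem_cons, List.not_mem_nil, or_false, not_or,
      not_false_eq_true, List.nodup_nil, and_true] at hnd
    have had : ¬ (Heavy G a ∧ Heavy G d) := fun h' => h.ad (hheavy h'.1 h'.2 hnd.1.2.2.1)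
    have haf : ¬ (Heavy G a ∧ Heavy G f) := fun h' => h.af (hheavy h'.1 h'.2 hnd.1.2.2.2.2)
    have hcf : ¬ (Heavy G c ∧ Heavy G f) := fun h' => h.cf (hheavy h'.1 h'.2 hnd.2.2.1.2.2)
    tauto

end HeavyGraph

namespace HeavyGraph

section
variable {V : Type*} {G : SimpleGraph V} {s : Multiset V} {a b u v x y z : V} {l : List V}

/-- The vertex `r` is adjacent to two consecutive entries of a list. -/
def Dominates (G : SimpleGraph V) (r : V) : List V → Prop
  | a :: b :: l => G.Adj r a ∧ G.Adj r b ∨ Dominates G r (b :: l)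
  | _ => False

/-- The entries of the list, in order, form an induced path. -/
def IndPath (G : SimpleGraph V) : List V → Prop
  | a :: b :: l => G.Adj a b ∧ (∀ y ∈ l, a ≠ y ∧ ¬ G.Adj a y) ∧ IndPath G (b :: l)
  | _ => True

lemma IndPath.tail (h : IndPath G (a :: l)) : IndPath G l := by
  cases l with
  | nil => trivial
  | cons b l => exact h.2.2

lemma IndPath.right_of_append {l₁ l₂ : List V} (h : IndPath G (l₁ ++ l₂)) : IndPath G l₂ := by
  induction l₁ with
  | nil => exact h
  | cons a l₁ ih => exact ih h.tail

lemma IndPath.concat (h : IndPath G (l ++ [z])) (hzx : G.Adj z x)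
    (hl : ∀ y ∈ l, y ≠ x ∧ ¬ G.Adj y x) : IndPath G (l ++ [z] ++ [x]) := by
  induction l with
  | nil => exact ⟨hzx, by simp, trivial⟩
  | cons a l ih =>
    have ih := ih h.tail fun y hy => hl y (List.mem_cons_of_mem a hy)
    cases l with
    | nil => exact ⟨h.1, by simpa using hl a, ih⟩
    | cons b l =>
      refine ⟨h.1, fun y hy => ?_, ih⟩
      rcases List.mem_append.1 (show y ∈ (l ++ [z]) ++ [x] from hy) with hy | hy
      · exact h.2.1 y hy
      rw [List.mem_singleton.1 hy]
      exact hl a (by simp)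

lemma exists_last_of_exists_mem {P : V → Prop} (h : ∃ y ∈ l, P y) :
    ∃ l₁ y l₂, l = l₁ ++ y :: l₂ ∧ P y ∧ ∀ w ∈ l₂, ¬ P w := by
  induction l with
  | nil => simp at h
  | cons a l ih =>
    by_cases h' : ∃ y ∈ l, P y
    · obtain ⟨l₁, y, l₂, rfl, h₁, h₂⟩ := ih h'
      exact ⟨a :: l₁, y, l₂, rfl, h₁, h₂⟩
    · push Not at h'
      refine ⟨[], a, l, rfl, ?_, h'⟩
      obtain ⟨y, hy, hP⟩ := h
      rcases List.mem_cons.1 hy with rfl | hy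
      · exact hP
      · exact absurd hP (h' y hy)

lemma Trail.exists_indPath_last {B : V → Prop} (p : Trail G s u v) (hv : B v) :
    ∃ l z, IndPath G (l ++ [z]) ∧ (l ++ [z]).head? = some u ∧ B z ∧ (∀ y ∈ l, ¬ B y) ∧
      ∀ y ∈ l ++ [z], y ∈ s := by
  induction p with
  | single u => exact ⟨[], u, trivial, rfl, hv, by simp, by simp⟩
  | @cons s u v w h p ih =>
    by_cases hu : B u
    · exact ⟨[], u, trivial, rfl, hu, by simp, by simp⟩
    obtain ⟨l, z, h₁, h₂, h₃, h₄, h₅⟩ := ih hv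
    have hvl : v ∈ l ++ [z] := List.mem_of_head? h₂
    obtain ⟨l₁, y, l₂, he, hy, hl₂⟩ := exists_last_of_exists_mem
      (P := fun y => u = y ∨ G.Adj u y) ⟨v, hvl, .inr h⟩
    rw [he] at h₁ h₅
    have hind := h₁.right_of_append
    obtain ⟨m, hm⟩ : ∃ m, y :: l₂ = m ++ [z] := by
      rcases List.eq_nil_or_concat l₂ with rfl | ⟨m, w, rfl⟩
      · refine ⟨[], ?_⟩
        have := congrArg List.getLast? he
        simpa using this.symm
      · refine ⟨y :: m, ?_⟩
        rw [List.concat_eq_append, ← List.cons_append, ← List.append_assoc] at he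
        rw [List.concat_eq_append, List.cons_append,
          List.singleton_inj.1 (List.append_inj' he rfl).2]
    have hml : ∀ w ∈ m, ¬ B w := by
      intro w hw
      rw [hm, ← List.append_assoc] at he
      exact h₄ w (by rw [List.append_cancel_right he]; simp [hw])
    have hs : ∀ w ∈ m ++ [z], w ∈ ({u} + s : Multiset V) := by
      intro w hw
      exact Multiset.mem_add.2 (.inr (h₅ w (List.mem_append_right _ (hm ▸ hw))))
    rcases hy with rfl | hy
    · exact ⟨m, z, hm ▸ hind, by simp [← hm], h₃, hml, hs⟩
    · refine ⟨u :: m, z, ?_, rfl, h₃, ?_, ?_⟩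
      · rw [List.cons_append, ← hm]
        exact ⟨hy, fun w hw => not_or.1 (hl₂ w hw), hind⟩
      · simpa [hu] using hml
      · intro w hw
        rcases List.mem_cons.1 hw with rfl | hw
        · simp
        · exact hs w hw

/-- A shortest path between two classes of vertices. -/
lemma Trail.exists_indPath {A B : V → Prop} (p : Trail G s u v) (hu : A u) (hv : B v) :
    (∃ z ∈ s, A z ∧ B z) ∨ ∃ a m z, IndPath G (a :: (m ++ [z])) ∧ A a ∧ B z ∧
      (∀ y ∈ m, ¬ A y ∧ ¬ B y) ∧ ¬ B a ∧ ¬ A z ∧ ∀ y ∈ a :: (m ++ [z]), y ∈ s := by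
  obtain ⟨l, z, h₁, h₂, h₃, h₄, h₅⟩ := p.exists_indPath_last hv
  by_cases hz : A z
  · exact .inl ⟨z, h₅ z (by simp), hz, h₃⟩
  right
  have hul : u ∈ l ++ [z] := List.mem_of_head? h₂
  have hul : u ∈ l := by
    rcases List.mem_append.1 hul with h | h
    · exact h
    · rw [List.mem_singleton.1 h] at hu
      exact absurd hu hz
  obtain ⟨l₁, a, m, rfl, ha, hm⟩ := exists_last_of_exists_mem ⟨u, hul, hu⟩
  refine ⟨a, m, z, ?_, ha, h₃, fun y hy => ⟨hm y hy, h₄ y (by simp [hy])⟩, h₄ a (by simp), hz, ?_⟩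
  · rw [List.append_assoc] at h₁
    exact h₁.right_of_append
  · intro y hy
    apply h₅
    simp at hy ⊢
    tauto

lemma exists_trail_of_walk {W : Set V} {u v : W} (p : (G.induce W).Walk u v) :
    ∃ s, Trail G s u v ∧ ∀ y ∈ s, y ∈ W := by
  induction p with
  | nil => exact ⟨_, .single _, by simp⟩
  | @cons u v w h p ih =>
    obtain ⟨s, h₁, h₂⟩ := ih
    exact ⟨_, .cons h h₁, by simpa using h₂⟩

end

variable {V : Type*} [Fintype V] {G : SimpleGraph V} {s : Multiset V} {a b c d e f g h x y z p q : V}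

namespace Reduced

lemma exists_trail_common (hG : Reduced G) (hab : G.Adj a b) (R : Multiset V) (hR : R.Nodup)
    (h : ∀ r ∈ R, G.Adj r a ∧ G.Adj r b) : ∃ z, Trail G ({a} + R) a z ∧ G.Adj z b := by
  induction R using Multiset.induction with
  | empty => exact ⟨a, .single a, hab⟩
  | cons t R ih =>
    obtain ⟨htR, hR⟩ := Multiset.nodup_cons.1 hR
    obtain ⟨z, hz, hzb⟩ := ih hR fun r hr => h r (Multiset.mem_cons_of_mem hr)
    obtain ⟨hta, htb⟩ := h t (Multiset.mem_cons_self t R)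
    refine ⟨t, (hz.join ?_ (.single t)).copy ?_, htb⟩
    · rcases Multiset.mem_add.1 hz.right_mem with h' | h'
      · rw [Multiset.mem_singleton.1 h']
        exact hta.symm
      · refine hG.diamond hab (h z (Multiset.mem_cons_of_mem h')).1.symm hzb.symm hta.symm htb.symm ?_
        rintro rfl
        exact htR h'
    · rw [← Multiset.singleton_add]
      abel

lemma exists_trail_of_dominates (hG : Reduced G) (l : List V) :
    ∀ (a b : V), (a :: (l ++ [b])).IsChain G.Adj → ∀ R : Multiset V, R.Nodup →
      (∀ r ∈ R, Dominates G r (a :: (l ++ [b]))) →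
      ∃ z, Trail G (((a :: l : List V) : Multiset V) + R) a z ∧ G.Adj z b := by
  classical
  induction l with
  | nil =>
    intro a b hc R hR h
    exact hG.exists_trail_common (by simpa using hc) R hR fun r hr => by
      simpa [Dominates] using h r hr
  | cons c l ih =>
    intro a b hc R hR h
    rw [List.cons_append, List.isChain_cons_cons] at hc
    obtain ⟨y, hy, hyc⟩ := hG.exists_trail_common hc.1 (R.filter fun r => G.Adj r a ∧ G.Adj r c)
      (hR.filter _) fun r hr => (Multiset.mem_filter.1 hr).2
    obtain ⟨z, hz, hzb⟩ := ih c b hc.2 (R.filter fun r => ¬ (G.Adj r a ∧ G.Adj r c))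
      (hR.filter _) fun r hr => by
        rw [Multiset.mem_filter] at hr
        exact (h r hr.1).resolve_left hr.2
    refine ⟨z, (hy.join hyc hz).copy ?_, hzb⟩
    conv_rhs => rw [← Multiset.filter_add_not (fun r => G.Adj r a ∧ G.Adj r c) R]
    rw [← Multiset.cons_coe a, ← Multiset.singleton_add]
    abel

lemma exists_not_dominates (hG : Reduced G) (hl : (a :: l).Nodup)
    (hc : (a :: (l ++ [a])).IsChain G.Adj) : ∃ r ∉ a :: l, ¬ Dominates G r (a :: (l ++ [a])) := by
  classical
  by_contra! h
  have hle : ((a :: l : List V) : Multiset V) ≤ (Finset.univ : Finset V).val :=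
    (Multiset.le_iff_subset (Multiset.coe_nodup.2 hl)).2 fun _ _ => Finset.mem_univ_val _
  obtain ⟨R, hR⟩ := Multiset.le_iff_exists_add.1 hle
  have hnd := univ_nodup (V := V)
  have hRn : R.Nodup := (Multiset.nodup_add.1 (hR ▸ hnd)).2.1
  obtain ⟨z, hz, hza⟩ := hG.exists_trail_of_dominates l a a hc R hRn fun r hr =>
    h r fun hr' => false_of_mem_mem hnd hR hr' hr
  exact hG.not_ham (hz.ham hR.symm hza)

lemma preconnected (hG : Reduced G) : G.Preconnected := by
  intro u v
  classical
  obtain ⟨w, hw⟩ : ∃ w, w ∉ ({u, v} : Finset V) := by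
    by_contra! h
    have := Finset.card_le_card (fun w _ => h w : (Finset.univ : Finset V) ⊆ {u, v})
    have h2 := Finset.card_le_two (a := u) (b := v)
    rw [Finset.card_univ] at this
    have := hG.card
    omega
  simp only [Finset.mem_insert, Finset.mem_singleton, not_or] at hw
  exact ((hG.conn w).preconnected ⟨u, Ne.symm hw.1⟩ ⟨v, Ne.symm hw.2⟩).map
    (SimpleGraph.Embedding.induce _).toHom

lemma exists_adj_boundary (hG : Reduced G) (S : Set V) (ha : a ∈ S) (hb : b ∉ S) :
    ∃ g ∈ S, ∃ h ∉ S, G.Adj g h := by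
  obtain ⟨p⟩ := hG.preconnected a b
  obtain ⟨d, -, h₁, h₂⟩ := p.exists_boundary_dart S ha hb
  exact ⟨_, h₁, _, h₂, d.adj⟩

lemma exists_induced_path (hG : Reduced G) :
    ∃ x p q, G.Adj x p ∧ G.Adj x q ∧ p ≠ q ∧ ¬ G.Adj p q := by
  by_contra! hcon
  have hall : ∀ a b : V, a ≠ b → G.Adj a b := by
    intro a b hab
    by_contra h
    obtain ⟨g, hg, h, hh, hgh⟩ := hG.exists_adj_boundary {y | y = a ∨ G.Adj a y} (.inl rfl)
      (b := b) (by simp [h, Ne.symm hab])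
    simp only [Set.mem_ofPred_eq, not_or] at hh hg
    rcases hg with rfl | hg
    · exact hh.2 hgh
    · exact hh.2 (hcon g a h hg.symm hgh (Ne.symm hh.1))
  have : Nontrivial V := Fintype.one_lt_card_iff_nontrivial.1 (by have := hG.card; omega)
  obtain ⟨a, b, hab⟩ := exists_pair_ne V
  obtain ⟨r, hr, hr'⟩ := hG.exists_not_dominates (a := a) (l := [b]) (by simpa using hab)
    (by simp [hall a b hab, hall b a hab.symm])
  simp only [List.mem_cons, List.not_mem_nil, or_false, not_or] at hr
  exact hr' (.inl ⟨hall r a hr.1, hall r b hr.2⟩)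

lemma not_adj_of_diamond (hG : Reduced G) (hab : G.Adj a b) (hac : G.Adj a c) (hbc : G.Adj b c)
    (hae : G.Adj a e) (hce : ¬ G.Adj c e) (hne : c ≠ e) : ¬ G.Adj b e :=
  fun hbe => hce (hG.diamond hab hac hbc hae hbe hne)

end Reduced

end HeavyGraph

namespace HeavyGraph

variable {V : Type*} {G : SimpleGraph V} {a b c d e f g h x y z p q r t : V}

/-- An induced cycle on four vertices. -/
structure C4 (G : SimpleGraph V) (a b c d : V) : Prop where
  ab : G.Adj a b
  bc : G.Adj b c
  cd : G.Adj c d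
  da : G.Adj d a
  ac : ¬ G.Adj a c
  bd : ¬ G.Adj b d
  ac_ne : a ≠ c
  bd_ne : b ≠ d

lemma C4.swap (h : C4 G a b c d) : C4 G a d c b :=
  ⟨h.da.symm, h.cd.symm, h.bc.symm, h.ab.symm, h.ac, mt .symm h.bd, h.ac_ne, h.bd_ne.symm⟩

/-- An induced cycle on five vertices. -/
structure C5 (G : SimpleGraph V) (a b c d e : V) : Prop where
  ab : G.Adj a b
  bc : G.Adj b c
  cd : G.Adj c d
  de : G.Adj d e
  ea : G.Adj e a
  ac : ¬ G.Adj a c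
  ad : ¬ G.Adj a d
  bd : ¬ G.Adj b d
  be : ¬ G.Adj b e
  ce : ¬ G.Adj c e

/-- An induced cycle on six vertices. -/
structure C6 (G : SimpleGraph V) (a b c d e f : V) : Prop where
  ab : G.Adj a b
  bc : G.Adj b c
  cd : G.Adj c d
  de : G.Adj d e
  ef : G.Adj e f
  fa : G.Adj f a
  ac : ¬ G.Adj a c
  ad : ¬ G.Adj a d
  ae : ¬ G.Adj a e
  bd : ¬ G.Adj b d
  be : ¬ G.Adj b e
  bf : ¬ G.Adj b f
  ce : ¬ G.Adj c e
  cf : ¬ G.Adj c f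
  df : ¬ G.Adj d f

lemma C5.rotate (h : C5 G a b c d e) : C5 G b c d e a :=
  ⟨h.bc, h.cd, h.de, h.ea, h.ab, h.bd, h.be, h.ce, mt .symm h.ac, mt .symm h.ad⟩

lemma C6.rotate (h : C6 G a b c d e f) : C6 G b c d e f a :=
  ⟨h.bc, h.cd, h.de, h.ef, h.fa, h.ab, h.bd, h.be, h.bf, h.ce, h.cf, mt .symm h.ac, h.df,
    mt .symm h.ad, mt .symm h.ae⟩

lemma C5.nodup (h : C5 G a b c d e) : [a, b, c, d, e].Nodup := by
  have := h.ab.ne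
  have := h.bc.ne
  have := h.cd.ne
  have := h.de.ne
  have := h.ea.ne
  have hac : a ≠ c := fun h' => h.ad (h' ▸ h.cd)
  have had : a ≠ d := fun h' => h.ac (h' ▸ h.cd.symm)
  have hbd : b ≠ d := fun h' => h.be (h' ▸ h.de)
  have hbe : b ≠ e := fun h' => h.bd (h' ▸ h.de.symm)
  have hce : c ≠ e := fun h' => h.ac (h' ▸ h.ea.symm)
  simp_all [Ne.symm]

lemma C6.nodup (h : C6 G a b c d e f) : [a, b, c, d, e, f].Nodup := by
  have := h.ab.ne
  have := h.bc.ne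
  have := h.cd.ne
  have := h.de.ne
  have := h.ef.ne
  have := h.fa.ne
  have hac : a ≠ c := fun h' => h.ad (h' ▸ h.cd)
  have had : a ≠ d := fun h' => h.ac (h' ▸ h.cd.symm)
  have hae : a ≠ e := fun h' => h.ad (h' ▸ h.de.symm)
  have hbd : b ≠ d := fun h' => h.be (h' ▸ h.de)
  have hbe : b ≠ e := fun h' => h.bd (h' ▸ h.de.symm)
  have hbf : b ≠ f := fun h' => h.be (h' ▸ h.ef.symm)
  have hce : c ≠ e := fun h' => h.cf (h' ▸ h.ef)
  have hcf : c ≠ f := fun h' => h.ac (h' ▸ h.fa.symm)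
  have hdf : d ≠ f := fun h' => h.ad (h' ▸ h.fa.symm)
  simp_all [Ne.symm]

namespace Reduced

variable [Fintype V]

lemma adj_or_of_claw (hG : Reduced G) (ha : G.Adj x a) (hb : G.Adj x b) (hr : G.Adj x r)
    (hab : ¬ G.Adj a b) (hne : a ≠ b) (hra : r ≠ a) (hrb : r ≠ b) : G.Adj r a ∨ G.Adj r b := by
  have := hG.claw x a b r hne hra.symm hrb.symm ha hb hr
  rw [G.adj_comm r a, G.adj_comm r b]
  tauto

lemma not_adj_of_pendant (hG : Reduced G) (hgh : G.Adj g h) (hga : G.Adj g a) (hah : ¬ G.Adj a h)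
    (hth : ¬ G.Adj t h) (hat : ¬ G.Adj a t) (hne : a ≠ t) (hha : h ≠ a) (hht : h ≠ t) :
    ¬ G.Adj g t := fun hgt =>
  (hG.adj_or_of_claw hga hgt hgh hat hne hha hht).elim (fun h' => hah h'.symm) fun h' => hth h'.symm

lemma false_of_c5_of_pendant (hG : Reduced G) (hC : C5 G a b c d e) (hg : g ∉ [a, b, c, d, e])
    (hga : G.Adj g a) (hh : ∀ t ∈ [a, b, c, d, e], ¬ G.Adj t h) (hgh : G.Adj g h) : False := by
  wlog hgb : G.Adj g b generalizing a b c d e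
  · have hge : G.Adj g e := by
      refine (hG.adj_or_of_claw hC.ab hC.ea.symm hga.symm hC.be ?_ ?_ ?_).resolve_left hgb
      · rintro rfl
        exact hC.bd hC.de.symm
      all_goals
        rintro rfl
        simp at hg
    exact this hC.rotate.rotate.rotate.rotate (by simpa [or_comm, or_assoc, or_left_comm] using hg)
      hge (by simpa [and_comm, and_assoc, and_left_comm] using hh) hga
  have hnd := hC.nodup
  simp only [List.mem_cons, List.not_mem_nil, or_false, not_or, List.nodup_cons, forall_eq_or_imp,
    forall_eq] at hg hh hnd
  obtain ⟨ha, hb, hc, hd, he⟩ := hh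
  have ha' : h ≠ a := fun h' => hb (h' ▸ hC.ab.symm)
  have hb' : h ≠ b := fun h' => hc (h' ▸ hC.bc.symm)
  have hc' : h ≠ c := fun h' => hd (h' ▸ hC.cd.symm)
  have hd' : h ≠ d := fun h' => he (h' ▸ hC.de.symm)
  have he' : h ≠ e := fun h' => ha (h' ▸ hC.ea.symm)
  have hgc := hG.not_adj_of_pendant hgh hga ha hc hC.ac (by tauto) ha' hc'
  have hgd := hG.not_adj_of_pendant hgh hga ha hd hC.ad (by tauto) ha' hd'
  have hge := hG.not_adj_of_pendant hgh hgb hb he hC.be (by tauto) hb' he'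
  rw [G.adj_comm _ h] at ha hb hc hd he
  have h₁ := hG.heavy_of_p6 (⟨hgh.symm, hgb, hC.bc, hC.cd, hC.de, hb, hc, hd, he, hgc, hgd, hge,
    hC.bd, hC.be, hC.ce⟩ : P6 G h g b c d e)
  have h₂ := hG.heavy_of_p6 (⟨hgh.symm, hga, hC.ea.symm, hC.de.symm, hC.cd.symm, ha, he, hd, hc,
    hge, hgd, hgc, hC.ad, hC.ac, mt .symm hC.ce⟩ : P6 G h g a e d c)
  exact hC.be (hG.heavy_adj h₁.1 h₂.2 (by tauto))

lemma not_c5 (hG : Reduced G) : ¬ C5 G a b c d e := by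
  intro hC
  obtain ⟨r, hr, hdom⟩ := hG.exists_not_dominates (a := a) (l := [b, c, d, e]) hC.nodup
    (by simp [hC.ab, hC.bc, hC.cd, hC.de, hC.ea])
  have hnd := hC.nodup
  have hra : ∀ t ∈ [a, b, c, d, e], ¬ G.Adj t r := by
    simp only [List.mem_cons, List.not_mem_nil, or_false, not_or, List.nodup_cons,
      forall_eq_or_imp, forall_eq, List.cons_append, List.nil_append, Dominates] at hr hdom hnd ⊢
    have h₁ := fun h => hG.adj_or_of_claw (r := r) hC.ab hC.ea.symm h hC.be
    have h₂ := fun h => hG.adj_or_of_claw (r := r) hC.bc hC.ab.symm h (mt .symm hC.ac)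
    have h₃ := fun h => hG.adj_or_of_claw (r := r) hC.cd hC.bc.symm h (mt .symm hC.bd)
    have h₄ := fun h => hG.adj_or_of_claw (r := r) hC.de hC.cd.symm h (mt .symm hC.ce)
    have h₅ := fun h => hG.adj_or_of_claw (r := r) hC.ea hC.de.symm h hC.ad
    simp only [G.adj_comm r] at *
    grind
  obtain ⟨g, hg, h, hh, hgh⟩ := hG.exists_adj_boundary
    {t | t ∈ [a, b, c, d, e] ∨ ∃ s ∈ [a, b, c, d, e], G.Adj s t} (.inl (List.mem_cons_self ..))
    (b := r) (by simpa using ⟨by simpa using hr, by simpa using hra⟩)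
  simp only [Set.mem_ofPred_eq, not_or, not_exists, not_and] at hg hh
  have hgC : g ∉ [a, b, c, d, e] := fun hgC => hh.2 g hgC hgh
  obtain ⟨s, hs, hsg⟩ := hg.resolve_left hgC
  have key : ∀ {a b c d e}, C5 G a b c d e → g ∉ [a, b, c, d, e] →
      (∀ t ∈ [a, b, c, d, e], ¬ G.Adj t h) → ¬ G.Adj a g := fun hC h₁ h₂ h₃ =>
    hG.false_of_c5_of_pendant hC h₁ h₃.symm h₂ hgh
  have h' := hh.2
  clear hra hr hdom hnd hg hh
  simp only [List.mem_cons, List.not_mem_nil, or_false, not_or, forall_eq_or_imp, forall_eq] at *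
  have h₁ := key hC
  have h₂ := key hC.rotate
  have h₃ := key hC.rotate.rotate
  have h₄ := key hC.rotate.rotate.rotate
  have h₅ := key hC.rotate.rotate.rotate.rotate
  grind

lemma false_of_c6_of_pendant (hG : Reduced G) (hC : C6 G a b c d e f)
    (hg : g ∉ [a, b, c, d, e, f])
    (hga : G.Adj g a) (hh : ∀ t ∈ [a, b, c, d, e, f], ¬ G.Adj t h) (hgh : G.Adj g h) : False := by
  wlog hgb : G.Adj g b generalizing a b c d e f
  · have hgf : G.Adj g f := by
      refine (hG.adj_or_of_claw hC.ab hC.fa.symm hga.symm hC.bf ?_ ?_ ?_).resolve_left hgb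
      · rintro rfl
        exact hC.be hC.ef.symm
      all_goals
        rintro rfl
        simp at hg
    exact this hC.rotate.rotate.rotate.rotate.rotate
      (by simpa [or_comm, or_assoc, or_left_comm] using hg)
      hgf (by simpa [and_comm, and_assoc, and_left_comm] using hh) hga
  have hnd := hC.nodup
  simp only [List.mem_cons, List.not_mem_nil, or_false, not_or, List.nodup_cons, forall_eq_or_imp,
    forall_eq] at hg hh hnd
  obtain ⟨ha, hb, hc, hd, he, hf⟩ := hh
  have ha' : h ≠ a := fun h' => hb (h' ▸ hC.ab.symm)
  have hb' : h ≠ b := fun h' => hc (h' ▸ hC.bc.symm)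
  have hc' : h ≠ c := fun h' => hd (h' ▸ hC.cd.symm)
  have hd' : h ≠ d := fun h' => he (h' ▸ hC.de.symm)
  have he' : h ≠ e := fun h' => hf (h' ▸ hC.ef.symm)
  have hf' : h ≠ f := fun h' => ha (h' ▸ hC.fa.symm)
  have hgc := hG.not_adj_of_pendant hgh hga ha hc hC.ac (by tauto) ha' hc'
  have hgd := hG.not_adj_of_pendant hgh hga ha hd hC.ad (by tauto) ha' hd'
  have hge := hG.not_adj_of_pendant hgh hgb hb he hC.be (by tauto) hb' he'
  have hgf := hG.not_adj_of_pendant hgh hgb hb hf hC.bf (by tauto) hb' hf'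
  rw [G.adj_comm _ h] at ha hb hc hd he hf
  have h₁ := hG.heavy_of_p6 (⟨hgh.symm, hgb, hC.bc, hC.cd, hC.de, hb, hc, hd, he, hgc, hgd, hge,
    hC.bd, hC.be, hC.ce⟩ : P6 G h g b c d e)
  have h₂ := hG.heavy_of_p6 (⟨hgh.symm, hga, hC.fa.symm, hC.ef.symm, hC.de.symm, ha, hf, he, hd,
    hgf, hge, hgd, hC.ae, hC.ad, mt .symm hC.df⟩ : P6 G h g a f e d)
  exact hC.bf (hG.heavy_adj h₁.1 h₂.2 (by tauto))

lemma not_c6 (hG : Reduced G) : ¬ C6 G a b c d e f := by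
  intro hC
  obtain ⟨r, hr, hdom⟩ := hG.exists_not_dominates (a := a) (l := [b, c, d, e, f]) hC.nodup
    (by simp [hC.ab, hC.bc, hC.cd, hC.de, hC.ef, hC.fa])
  have hnd := hC.nodup
  have hra : ∀ t ∈ [a, b, c, d, e, f], ¬ G.Adj t r := by
    simp only [List.mem_cons, List.not_mem_nil, or_false, not_or, List.nodup_cons,
      forall_eq_or_imp, forall_eq, List.cons_append, List.nil_append, Dominates] at hr hdom hnd ⊢
    have h₁ := fun h => hG.adj_or_of_claw (r := r) hC.ab hC.fa.symm h hC.bf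
    have h₂ := fun h => hG.adj_or_of_claw (r := r) hC.bc hC.ab.symm h (mt .symm hC.ac)
    have h₃ := fun h => hG.adj_or_of_claw (r := r) hC.cd hC.bc.symm h (mt .symm hC.bd)
    have h₄ := fun h => hG.adj_or_of_claw (r := r) hC.de hC.cd.symm h (mt .symm hC.ce)
    have h₅ := fun h => hG.adj_or_of_claw (r := r) hC.ef hC.de.symm h (mt .symm hC.df)
    have h₆ := fun h => hG.adj_or_of_claw (r := r) hC.fa hC.ef.symm h hC.ae
    simp only [G.adj_comm r] at *
    grind
  obtain ⟨g, hg, h, hh, hgh⟩ := hG.exists_adj_boundary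
    {t | t ∈ [a, b, c, d, e, f] ∨ ∃ s ∈ [a, b, c, d, e, f], G.Adj s t}
    (.inl (List.mem_cons_self ..)) (b := r) (by simpa using ⟨by simpa using hr, by simpa using hra⟩)
  simp only [Set.mem_ofPred_eq, not_or, not_exists, not_and] at hg hh
  have hgC : g ∉ [a, b, c, d, e, f] := fun hgC => hh.2 g hgC hgh
  obtain ⟨s, hs, hsg⟩ := hg.resolve_left hgC
  have key : ∀ {a b c d e f}, C6 G a b c d e f → g ∉ [a, b, c, d, e, f] →
      (∀ t ∈ [a, b, c, d, e, f], ¬ G.Adj t h) → ¬ G.Adj a g := fun hC h₁ h₂ h₃ =>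
    hG.false_of_c6_of_pendant hC h₁ h₃.symm h₂ hgh
  have h' := hh.2
  clear hra hr hdom hnd hg hh
  simp only [List.mem_cons, List.not_mem_nil, or_false, not_or, forall_eq_or_imp, forall_eq] at *
  have h₁ := key hC
  have h₂ := key hC.rotate
  have h₃ := key hC.rotate.rotate
  have h₄ := key hC.rotate.rotate.rotate
  have h₅ := key hC.rotate.rotate.rotate.rotate
  have h₆ := key hC.rotate.rotate.rotate.rotate.rotate
  grind

lemma false_of_indPath (hG : Reduced G) {m : List V} (hm : 2 ≤ m.length)
    (hp : IndPath G (a :: (m ++ [z]))) (hya : G.Adj y a) (hyz : G.Adj y z)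
    (hy : ∀ w ∈ m, ¬ G.Adj y w) : False := by
  obtain _ | ⟨b, _ | ⟨c, _ | ⟨d, _ | ⟨e, m⟩⟩⟩⟩ := m
  · simp at hm
  · simp at hm
  · simp [IndPath] at hp hy
    exact hG.not_c5 (⟨hp.1, hp.2.2.1, hp.2.2.2.2, hyz.symm, hya, hp.2.1.1.2, hp.2.1.2.2,
      hp.2.2.2.1.2, mt .symm hy.1, mt .symm hy.2⟩ : C5 G a b c z y)
  · simp [IndPath] at hp hy
    obtain ⟨hab, ⟨hac, had, haz⟩, hbc, ⟨hbd, hbz⟩, hcd, hcz, hdz⟩ := hp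
    exact hG.not_c6 (⟨hab, hbc, hcd, hdz, hyz.symm, hya, hac.2, had.2, haz.2, hbd.2, hbz.2,
      mt .symm hy.1, hcz.2, mt .symm hy.2.1, mt .symm hy.2.2⟩ : C6 G a b c d z y)
  · simp only [IndPath, List.cons_append, List.mem_cons, List.mem_append, List.not_mem_nil,
      or_false, forall_eq_or_imp] at hp hy
    obtain ⟨hab, ⟨hac, had, hae, haz⟩, hbc, ⟨hbd, hbe, hbz⟩, hcd, ⟨hce, hcz⟩, hde, hdz, -⟩ := hp
    have h₁ := hG.heavy_of_p6 (⟨hya, hab, hbc, hcd, hde, hy.1, hy.2.1, hy.2.2.1, hy.2.2.2.1,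
      hac.2, had.2, hae.2, hbd.2, hbe.2, hce.2⟩ : P6 G y a b c d e)
    have hza := (haz z (.inr rfl)).2
    have hzb := (hbz z (.inr rfl)).2
    have hzc := (hcz z (.inr rfl)).2
    have hzd := (hdz z (.inr rfl)).2
    rw [G.adj_comm _ z] at hza hzb hzc hzd
    have h₂ := hG.heavy_of_p6 (⟨hyz.symm, hya, hab, hbc, hcd, hza, hzb, hzc, hzd, hy.1, hy.2.1,
      hy.2.2.1, hac.2, had.2, hbd.2⟩ : P6 G z y a b c d)
    exact hac.2 (hG.heavy_adj h₂.1 h₁.2 hac.1)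

lemma exists_c4 (hG : Reduced G) : ∃ a b c d, C4 G a b c d := by
  obtain ⟨x, p, q, hp, hq, hne, hpq⟩ := hG.exists_induced_path
  obtain ⟨w⟩ := (hG.conn x).preconnected ⟨q, hq.ne'⟩ ⟨p, hp.ne'⟩
  obtain ⟨s, hs, hsx⟩ := exists_trail_of_walk w
  have hα : ∀ y, G.Adj x y → (G.Adj x y ∧ (y = q ∨ G.Adj y q)) ∨
      (G.Adj x y ∧ (y = p ∨ G.Adj y p)) := by
    intro y hy
    by_cases h₁ : y = q
    · exact .inl ⟨hy, .inl h₁⟩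
    by_cases h₂ : y = p
    · exact .inr ⟨hy, .inl h₂⟩
    have := hG.adj_or_of_claw hp hq hy hpq hne h₂ h₁
    tauto
  rcases hs.exists_indPath (A := fun y => G.Adj x y ∧ (y = q ∨ G.Adj y q))
    (B := fun y => G.Adj x y ∧ (y = p ∨ G.Adj y p)) ⟨hq, .inl rfl⟩ ⟨hp, .inl rfl⟩ with
    ⟨z, -, ⟨hz, h₁⟩, -, h₂⟩ | ⟨a, m, z, hi, ⟨ha, ha'⟩, ⟨hz, hz'⟩, hm, hBa, hAz, has⟩
  · exfalso
    rcases h₁ with rfl | h₁ <;> rcases h₂ with rfl | h₂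
    · exact hne rfl
    · exact hpq h₂.symm
    · exact hpq h₁
    · exact hpq (hG.diamond hz hp h₂ hq h₁ hne)
  have hmx : ∀ y ∈ m, ¬ G.Adj x y := fun y hy h => (hα y h).elim (hm y hy).1 (hm y hy).2
  have haz : ¬ G.Adj a z := by
    intro haz
    have h₁ : G.Adj a q := ha'.resolve_left (by rintro rfl; exact hAz ⟨hz, .inr haz.symm⟩)
    refine hAz ⟨hz, .inr (hG.diamond ha hz haz hq h₁ ?_)⟩
    rintro rfl
    exact hAz ⟨hz, .inl rfl⟩
  obtain _ | ⟨b, _ | ⟨c, m⟩⟩ := m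
  · simp [IndPath] at hi
    exact (haz hi).elim
  · simp [IndPath] at hi hmx
    exact ⟨x, a, b, z, ha, hi.1, hi.2.2, hz.symm, hmx, hi.2.1.2,
      fun h => hsx b (has b (by simp)) h.symm, hi.2.1.1⟩
  · exact (hG.false_of_indPath (by simp) hi ha hz hmx).elim

end Reduced

end HeavyGraph

namespace HeavyGraph

variable {V : Type*} [Fintype V] {G : SimpleGraph V} {a b c d e f g h x y z p q r t : V}
  {s₁ s₂ s₃ : Multiset V} {e₁ e₂ e₃ e₄ : V}

/-- An induced four-cycle, with a triangle on each of its edges and a trail that joins two of these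
triangles outside the cycle. -/
structure TriangleRing (G : SimpleGraph V) (a b c d : V) : Prop extends C4 G a b c d where
  exists_ab : ∃ t, G.Adj t a ∧ G.Adj t b
  exists_cd : ∃ t, G.Adj t c ∧ G.Adj t d
  exists_trail : ∃ s u v, Trail G s u v ∧ (G.Adj u b ∧ G.Adj u c) ∧ (G.Adj v a ∧ G.Adj v d) ∧
    ∀ y ∈ s, y ≠ a ∧ y ≠ b ∧ y ≠ c ∧ y ≠ d

namespace Reduced

lemma triangleRing_of_trails (hG : Reduced G) (hC : C4 G a b c d) (p₁ : Trail G s₁ d e₁)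
    (h₁ : G.Adj e₁ c) (h₂ : G.Adj c e₂) (p₂ : Trail G s₂ e₂ e₃) (h₃ : G.Adj e₃ a)
    (h₄ : G.Adj a e₄) (p₃ : Trail G s₃ e₄ b)
    (hu : (Finset.univ : Finset V).val = s₁ + ({c} + (s₂ + ({a} + s₃)))) :
    TriangleRing G a b c d := by
  have hnd : (s₁ + ({c} + (s₂ + ({a} + s₃)))).Nodup := hu ▸ univ_nodup
  have hs : ∀ y ∈ s₂, y ≠ a ∧ y ≠ b ∧ y ≠ c ∧ y ≠ d := by
    simp only [Multiset.nodup_add, Multiset.disjoint_left, Multiset.mem_add] at hnd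
    rintro y hy
    refine ⟨?_, ?_, ?_, ?_⟩
    · rintro rfl
      exact hnd.2.1.2.1.2.2 hy (by simp)
    · rintro rfl
      exact hnd.2.1.2.1.2.2 hy (.inr p₃.right_mem)
    · rintro rfl
      exact hnd.2.1.2.2 (by simp) (.inl hy)
    · rintro rfl
      exact hnd.2.2 p₁.left_mem (.inr (.inl hy))
  have hs₁ : e₁ ≠ b := by
    rintro rfl
    exact false_of_mem_mem univ_nodup hu p₁.right_mem (by simp [p₃.right_mem])
  have hs₄ : e₄ ≠ d := by
    rintro rfl
    exact false_of_mem_mem univ_nodup hu p₁.left_mem (by simp [p₃.left_mem])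
  obtain ⟨-, h₂b, -, h₂d⟩ := hs _ p₂.left_mem
  obtain ⟨-, h₃b, -, h₃d⟩ := hs _ p₂.right_mem
  have pc := Trail.single (G := G) c
  have pa := Trail.single (G := G) a
  have hn₂ : ¬ G.Adj d e₂ := fun h => hG.not_ham <|
    ham_of_crossing (p₁.join h₁ pc) (p₂.join h₃ (pa.join h₄ p₃)) (by rw [hu]; abel) h hC.bc
  have hn₁ : ¬ G.Adj b e₁ := fun h => hG.not_ham <|
    ham_of_crossing p₁ (pc.join h₂ (p₂.join h₃ (pa.join h₄ p₃))) (by rw [hu]) hC.cd.symm h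
  have hn₃ : ¬ G.Adj b e₃ := fun h => hG.not_ham <|
    ham_of_crossing (p₁.join h₁ (pc.join h₂ p₂)) (pa.join h₄ p₃) (by rw [hu]; abel) hC.da h
  have hn₄ : ¬ G.Adj d e₄ := fun h => hG.not_ham <|
    ham_of_crossing (p₁.join h₁ (pc.join h₂ (p₂.join h₃ pa))) p₃ (by rw [hu]; abel) h hC.ab.symm
  have had₂ : G.Adj e₂ b := (hG.adj_or_of_claw hC.bc.symm hC.cd h₂ hC.bd hC.bd_ne h₂b
    h₂d).resolve_right fun h => hn₂ h.symm
  have had₃ : G.Adj e₃ d := (hG.adj_or_of_claw hC.ab hC.da.symm h₃.symm hC.bd hC.bd_ne h₃b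
    h₃d).resolve_left fun h => hn₃ h.symm
  have hne₁ : e₁ ≠ d := by
    rintro rfl
    exact hG.not_ham ((p₂.join had₃ (p₁.join hC.da (pa.join h₄ (p₃.join hC.bc pc)))).ham
      (by rw [hu]; abel) h₂)
  have hne₄ : e₄ ≠ b := by
    rintro rfl
    exact hG.not_ham ((p₃.join hC.bc (pc.join h₁.symm (p₁.reverse.join hC.da
      (pa.join h₃.symm p₂.reverse)))).ham (by rw [hu]; abel) had₂)
  have had₁ : G.Adj e₁ d := (hG.adj_or_of_claw hC.bc.symm hC.cd h₁.symm hC.bd hC.bd_ne hs₁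
    hne₁).resolve_left fun h => hn₁ h.symm
  have had₄ : G.Adj e₄ b := (hG.adj_or_of_claw hC.ab hC.da.symm h₄ hC.bd hC.bd_ne hne₄
    hs₄).resolve_right fun h => hn₄ h.symm
  exact ⟨hC, ⟨e₄, h₄.symm, had₄⟩, ⟨e₁, h₁, had₁⟩, s₂, e₂, e₃, p₂, ⟨had₂, h₂.symm⟩, ⟨h₃, had₃⟩, hs⟩

lemma triangleRing (hG : Reduced G) (hC : C4 G a b c d) :
    TriangleRing G a b c d ∨ TriangleRing G a d c b := by
  have p : Trail G _ d b := hG.hamPath hC.da.symm hC.ab hC.bd_ne.symm (mt .symm hC.bd)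
  obtain ⟨t₁, t₂, e₁, p₁, h₁, p₂, ht⟩ := (p.cut_before (Finset.mem_univ_val c)).resolve_left hC.cd.ne
  obtain ⟨t₃, t₄, e₂, p₃, h₃, p₄, rfl⟩ := (p₂.cut_after p₂.left_mem).resolve_left hC.bc.ne'
  have ht₃ := p₃.eq_singleton (by
    have := univ_nodup (V := V)
    rw [ht, Multiset.nodup_add, Multiset.nodup_add] at this
    exact this.2.1.1)
  subst ht₃
  have ha : a ∈ t₁ ∨ a ∈ t₄ := by
    have := Finset.mem_univ_val a
    rw [ht] at this
    simpa [hC.ac_ne] using this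
  have key : ∀ {b d t₁ t₄ e₁ e₂}, C4 G a b c d → Trail G t₁ d e₁ → G.Adj e₁ c → G.Adj c e₂ →
      Trail G t₄ e₂ b → (Finset.univ : Finset V).val = t₁ + ({c} + t₄) → a ∈ t₄ →
      TriangleRing G a b c d := by
    intro b d t₁ t₄ e₁ e₂ hC p₁ h₁ h₂ p₂ ht ha
    obtain ⟨t₅, t₆, e₃, p₅, h₅, p₆, rfl⟩ := (p₂.cut_before ha).resolve_left (by
      rintro rfl
      exact hC.ac h₂.symm)
    obtain ⟨t₇, t₈, e₄, p₇, h₇, p₈, rfl⟩ := (p₆.cut_after p₆.left_mem).resolve_left hC.ab.ne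
    have ht₇ := p₇.eq_singleton (by
      have := univ_nodup (V := V)
      simp only [ht, Multiset.nodup_add] at this
      exact this.2.1.2.1.2.1.1)
    subst ht₇
    exact hG.triangleRing_of_trails hC p₁ h₁ h₂ p₅ h₅ h₇ p₈ ht
  rcases ha with ha | ha
  · exact .inr (key hC.swap p₄.reverse h₃.symm h₁.symm p₁.reverse (by rw [ht]; abel) ha)
  · exact .inl (key hC p₁ h₁ h₃ p₄ ht ha)

end Reduced

end HeavyGraph

namespace HeavyGraph

variable {V : Type*} [Fintype V] {G : SimpleGraph V} {a b c d e f g h x y z p q r t : V}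

namespace Reduced

lemma exists_opposite (hG : Reduced G) (hC : C4 G a b c d) : ∃ t, G.Adj t c ∧ G.Adj t d := by
  rcases hG.triangleRing hC with h | h
  · exact h.exists_cd
  · obtain ⟨s, u, v, -, hu, -⟩ := h.exists_trail
    exact ⟨u, hu.symm⟩

lemma exists_link (hG : Reduced G) (hR : TriangleRing G a b c d) :
    ∃ u v, (G.Adj u b ∧ G.Adj u c ∧ ¬ G.Adj u a ∧ ¬ G.Adj u d) ∧
      (G.Adj v a ∧ G.Adj v d ∧ ¬ G.Adj v b ∧ ¬ G.Adj v c) ∧ G.Adj u v := by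
  have hC := hR.toC4
  obtain ⟨s, u, v, p, hu, hv, hs⟩ := hR.exists_trail
  have hA : ∀ y, G.Adj y b → G.Adj y c → ¬ G.Adj y a ∧ ¬ G.Adj y d := fun y h₁ h₂ =>
    ⟨hG.not_adj_of_diamond h₁.symm hC.bc h₂ hC.ab.symm (mt .symm hC.ac) hC.ac_ne.symm,
      hG.not_adj_of_diamond h₂.symm hC.bc.symm h₁ hC.cd hC.bd hC.bd_ne⟩
  rcases p.exists_indPath (A := fun y => G.Adj y b ∧ G.Adj y c)
    (B := fun y => (G.Adj y a ∧ G.Adj y b) ∨ (G.Adj y a ∧ G.Adj y d) ∨ (G.Adj y c ∧ G.Adj y d))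
    hu (.inr (.inl hv)) with ⟨z, -, hz, hz'⟩ | ⟨u, m, z, hi, hu, hz, hm, -, hAz, hs'⟩
  · have := hA z hz.1 hz.2
    tauto
  have hu' := hA u hu.1 hu.2
  have hm' : ∀ y ∈ m, ¬ G.Adj y a ∧ ¬ G.Adj y b ∧ ¬ G.Adj y c ∧ ¬ G.Adj y d := by
    intro y hy
    obtain ⟨h₁, h₂⟩ := hm y hy
    obtain ⟨ha, hb, hc, hd⟩ := hs y (hs' y (by simp [hy]))
    have h₃ := fun h => hG.adj_or_of_claw (r := y) hC.ab hC.da.symm h hC.bd hC.bd_ne hb hd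
    have h₄ := fun h => hG.adj_or_of_claw (r := y) hC.ab.symm hC.bc h hC.ac hC.ac_ne ha hc
    have h₅ := fun h => hG.adj_or_of_claw (r := y) hC.bc.symm hC.cd h hC.bd hC.bd_ne hb hd
    have h₆ := fun h => hG.adj_or_of_claw (r := y) hC.da hC.cd.symm h hC.ac hC.ac_ne ha hc
    simp only [G.adj_comm _ y] at h₃ h₄ h₅ h₆
    clear hm hs hs' hA hu' hi
    grind
  have hne : ∀ y ∈ u :: (m ++ [z]), y ≠ a ∧ y ≠ b ∧ y ≠ c ∧ y ≠ d := fun y hy => hs y (hs' y hy)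
  simp only [List.mem_cons, List.mem_append, List.not_mem_nil, or_false, forall_eq_or_imp] at hne
  obtain ⟨hneu, hnem⟩ := hne
  have hnez := hnem z (.inr rfl)
  replace hnem := fun y hy => hnem y (.inl hy)
  rcases hz with hz | hz | hz
  · have hzc : ¬ G.Adj z c :=
      hG.not_adj_of_diamond hz.2.symm hC.ab.symm hz.1 hC.bc hC.ac hC.ac_ne
    have hzd : ¬ G.Adj z d :=
      hG.not_adj_of_diamond hz.1.symm hC.ab hz.2 hC.da.symm hC.bd hC.bd_ne
    refine (hG.false_of_indPath (m := u :: (m ++ [z])) (by simp) (IndPath.concat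
      (l := c :: u :: m) ⟨hu.2.symm, ?_, hi⟩ hz.1 ?_) hC.cd.symm hC.da ?_).elim
    · intro y hy
      rcases List.mem_append.1 (show y ∈ m ++ [z] from hy) with hy | hy
      · exact ⟨(hnem y hy).2.2.1.symm, mt .symm (hm' y hy).2.2.1⟩
      · rw [List.mem_singleton.1 hy]
        exact ⟨hnez.2.2.1.symm, mt .symm hzc⟩
    · simp only [List.mem_cons]
      rintro y (rfl | rfl | hy)
      · exact ⟨hC.ac_ne.symm, mt .symm hC.ac⟩
      · exact ⟨hneu.1, hu'.1⟩
      · exact ⟨(hnem y hy).1, (hm' y hy).1⟩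
    · simp only [List.mem_cons, List.mem_append, List.not_mem_nil, or_false]
      rintro y (rfl | hy | rfl)
      · exact mt .symm hu'.2
      · exact mt .symm (hm' y hy).2.2.2
      · exact mt .symm hzd
  · have hzb : ¬ G.Adj z b :=
      hG.not_adj_of_diamond hz.1.symm hC.da.symm hz.2 hC.ab (mt .symm hC.bd) hC.bd_ne.symm
    have hzc : ¬ G.Adj z c :=
      hG.not_adj_of_diamond hz.2.symm hC.da hz.1 hC.cd.symm hC.ac hC.ac_ne
    obtain _ | ⟨y, m⟩ := m
    · exact ⟨u, z, ⟨hu.1, hu.2, hu'⟩, ⟨hz.1, hz.2, hzb, hzc⟩, hi.1⟩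
    refine (hG.false_of_indPath (m := u :: y :: m) (by simp) ⟨hu.1.symm, ?_, hi⟩ hC.ab hz.1.symm
      ?_).elim
    · intro w hw
      rcases List.mem_append.1 (show w ∈ (y :: m) ++ [z] from hw) with hw | hw
      · exact ⟨(hnem w hw).2.1.symm, mt .symm (hm' w hw).2.1⟩
      · rw [List.mem_singleton.1 hw]
        exact ⟨hnez.2.1.symm, mt .symm hzb⟩
    · intro w hw
      rcases List.mem_cons.1 hw with rfl | hw
      · exact mt .symm hu'.1
      · exact mt .symm (hm' w hw).1
  · have hza : ¬ G.Adj z a :=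
      hG.not_adj_of_diamond hz.2.symm hC.cd.symm hz.1 hC.da (mt .symm hC.ac) hC.ac_ne.symm
    have hzb : ¬ G.Adj z b :=
      hG.not_adj_of_diamond hz.1.symm hC.cd hz.2 hC.bc.symm (mt .symm hC.bd) hC.bd_ne.symm
    refine (hG.false_of_indPath (m := u :: (m ++ [z])) (by simp) (IndPath.concat
      (l := b :: u :: m) ⟨hu.1.symm, ?_, hi⟩ hz.2 ?_) hC.ab hC.da.symm ?_).elim
    · intro y hy
      rcases List.mem_append.1 (show y ∈ m ++ [z] from hy) with hy | hy
      · exact ⟨(hnem y hy).2.1.symm, mt .symm (hm' y hy).2.1⟩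
      · rw [List.mem_singleton.1 hy]
        exact ⟨hnez.2.1.symm, mt .symm hzb⟩
    · simp only [List.mem_cons]
      rintro y (rfl | rfl | hy)
      · exact ⟨hC.bd_ne, hC.bd⟩
      · exact ⟨hneu.2.2.2, hu'.2⟩
      · exact ⟨(hnem y hy).2.2.2, (hm' y hy).2.2.2⟩
    · simp only [List.mem_cons, List.mem_append, List.not_mem_nil, or_false]
      rintro y (rfl | hy | rfl)
      · exact mt .symm hu'.1
      · exact mt .symm (hm' y hy).1
      · exact mt .symm hza

end Reduced

lemma not_reduced (hG : Reduced G) : False := by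
  obtain ⟨a, b, c, d, hC⟩ := hG.exists_c4
  wlog hR : TriangleRing G a b c d generalizing b d
  · exact this d b hC.swap ((hG.triangleRing hC).resolve_left hR)
  obtain ⟨f₂, f₁, ⟨hb₂, hc₂, ha₂, hd₂⟩, ⟨ha₁, hd₁, hb₁, hc₁⟩, hff⟩ := hG.exists_link hR
  obtain ⟨g, hga, hgb⟩ := hR.exists_ab
  obtain ⟨k, hkc, hkd⟩ := hR.exists_cd
  have hne₁ : a ≠ f₂ := fun h => hd₂ (h ▸ hC.da.symm)
  have hne₂ : b ≠ f₁ := fun h => hC.bd (h ▸ hd₁)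
  have hne₃ : f₁ ≠ c := fun h => hC.ac (h ▸ ha₁.symm)
  have hne₄ : f₂ ≠ d := fun h => ha₂ (h ▸ hC.da)
  obtain ⟨f, hf₂, hf₁⟩ := hG.exists_opposite
    (⟨hC.ab, hb₂.symm, hff, ha₁, mt .symm ha₂, mt .symm hb₁, hne₁, hne₂⟩ : C4 G a b f₂ f₁)
  have hgd : ¬ G.Adj g d := hG.not_adj_of_diamond hga.symm hC.ab hgb hC.da.symm hC.bd hC.bd_ne
  have hgc : ¬ G.Adj g c := hG.not_adj_of_diamond hgb.symm hC.ab.symm hga hC.bc hC.ac hC.ac_ne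
  have hg₂ : ¬ G.Adj g f₂ :=
    hG.not_adj_of_diamond hgb.symm hC.ab.symm hga hb₂.symm (mt .symm ha₂) hne₁
  have hfa : ¬ G.Adj f a := hG.not_adj_of_diamond hf₁.symm hff.symm hf₂ ha₁ ha₂ hne₁.symm
  have hfd : ¬ G.Adj f d := hG.not_adj_of_diamond hf₁.symm hff.symm hf₂ hd₁ hd₂ hne₄
  have hfc : ¬ G.Adj f c := hG.not_adj_of_diamond hf₂.symm hff hf₁ hc₂ hc₁ hne₃
  have hfb : ¬ G.Adj f b := hG.not_adj_of_diamond hf₂.symm hff hf₁ hb₂ hb₁ hne₂.symm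
  have hka : ¬ G.Adj k a :=
    hG.not_adj_of_diamond hkd.symm hC.cd.symm hkc hC.da (mt .symm hC.ac) hC.ac_ne.symm
  have hkb : ¬ G.Adj k b :=
    hG.not_adj_of_diamond hkc.symm hC.cd hkd hC.bc.symm (mt .symm hC.bd) hC.bd_ne.symm
  have hk₂ : ¬ G.Adj k f₂ :=
    hG.not_adj_of_diamond hkc.symm hC.cd hkd hc₂.symm (mt .symm hd₂) hne₄.symm
  have hgf : ¬ G.Adj g f := fun h => hG.not_c6 (⟨hga, hC.da.symm, hC.cd.symm, hc₂.symm, hf₂.symm,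
    h.symm, hgd, hgc, hg₂, hC.ac, mt .symm ha₂, mt .symm hfa, mt .symm hd₂, mt .symm hfd,
    mt .symm hfc⟩ : C6 G g a d c f₂ f)
  have hkf : ¬ G.Adj k f := fun h => hG.not_c6 (⟨hkd, hC.da, hC.ab, hb₂.symm, hf₂.symm,
    h.symm, hka, hkb, hk₂, mt .symm hC.bd, mt .symm hd₂, mt .symm hfd, mt .symm ha₂, mt .symm hfa,
    mt .symm hfb⟩ : C6 G k d a b f₂ f)
  have h₁ := hG.heavy_of_p6 (⟨hga, hC.da.symm, hC.cd.symm, hc₂.symm, hf₂.symm, hgd, hgc, hg₂, hgf,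
    hC.ac, mt .symm ha₂, mt .symm hfa, mt .symm hd₂, mt .symm hfd, mt .symm hfc⟩ :
    P6 G g a d c f₂ f)
  have h₂ := hG.heavy_of_p6 (⟨hkd, hC.da, hC.ab, hb₂.symm, hf₂.symm, hka, hkb, hk₂, hkf,
    mt .symm hC.bd, mt .symm hd₂, mt .symm hfd, mt .symm ha₂, mt .symm hfa, mt .symm hfb⟩ :
    P6 G k d a b f₂ f)
  exact hC.bd (hG.heavy_adj h₂.2 h₁.1 hC.bd_ne)

end HeavyGraph

namespace HeavyGraph

lemma Trail.exists_walk {V : Type*} {G : SimpleGraph V} {s : Multiset V} {u v : V}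
    (p : Trail G s u v) : ∃ q : G.Walk u v, (q.support : Multiset V) = s := by
  induction p with
  | single u => exact ⟨.nil, rfl⟩
  | cons h p ih =>
    obtain ⟨q, rfl⟩ := ih
    exact ⟨.cons h q, by simp⟩

variable {V : Type*} [Fintype V] {G : SimpleGraph V}

lemma Ham.isHamiltonian [DecidableEq V] (hn : 3 ≤ Fintype.card V) (hG : Ham G) :
    G.IsHamiltonian := by
  obtain ⟨u, v, p, h⟩ := hG
  obtain ⟨q, hq⟩ := Trail.exists_walk p
  have hpath : q.IsPath := by
    rw [SimpleGraph.Walk.isPath_def, ← Multiset.coe_nodup, hq]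
    exact univ_nodup
  have hlen : q.length + 1 = Fintype.card V := by
    rw [← SimpleGraph.Walk.length_support, ← Multiset.coe_card, hq]
    rfl
  refine fun _ => ⟨v, .cons h q, SimpleGraph.Walk.isHamiltonianCycle_iff_isCycle_and_length_eq.2
    ⟨(q.cons_isCycle_iff h).2 ⟨hpath, fun he => ?_⟩, hlen⟩⟩
  have := hpath.length_eq_one_of_mem_edges (Sym2.eq_swap ▸ he)
  omega

lemma deg_eq_degree [DecidableRel G.Adj] (v : V) : deg G v = G.degree v := by
  rw [deg, Set.ncard_eq_toFinset_card']
  rfl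

lemma ham_of_heavy (hn : 3 ≤ Fintype.card V) (hconn : ∀ v : V, (G.induce ({v}ᶜ : Set V)).Connected)
    (hclaw : ClawHeavy G) (hp6 : P6Heavy G) : Ham G := by
  by_contra hG
  obtain ⟨K, hGK, hK⟩ := (Set.toFinite {K : SimpleGraph V |
    (∀ v, (K.induce ({v}ᶜ : Set V)).Connected) ∧ ClawHeavy K ∧ P6Heavy K ∧ ¬ Ham K}).exists_le_maximal
    ⟨hconn, hclaw, hp6, hG⟩
  obtain ⟨h₁, h₂, h₃, h₄⟩ := hK.prop
  refine not_reduced (G := K) (Extremal.reduced ⟨hn, h₁, h₂, h₃, h₄, fun x hx u v hu hv huv => ?_⟩)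
  exact hK.le_of_ge ⟨fun v => (h₁ v).mono (SimpleGraph.comap_monotone _ (le_completion K x)),
    h₂.completion x, h₃.completion x, hx⟩ (le_completion K x) (.inr ⟨huv, hu, hv⟩)

lemma clawHeavy_of_clawOHeavy [DecidableRel G.Adj] (hG : ClawOHeavy G) : ClawHeavy G := by
  intro a b₁ b₂ b₃ h₁₂ h₁₃ h₂₃ h₁ h₂ h₃
  by_cases n₁₂ : G.Adj b₁ b₂
  · exact .inl (.inl n₁₂)
  by_cases n₁₃ : G.Adj b₁ b₃
  · exact .inr (.inl (.inl n₁₃))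
  by_cases n₂₃ : G.Adj b₂ b₃
  · exact .inr (.inr (.inl n₂₃))
  obtain ⟨u, v, hu, hv, hne, hadj, hdeg⟩ := hG a b₁ b₂ b₃ h₁₂ h₁₃ h₂₃ h₁ h₂ h₃ n₁₂ n₁₃ n₂₃
  rw [← deg_eq_degree, ← deg_eq_degree] at hdeg
  have key : (star G).Adj u v := .inr ⟨hne, hdeg⟩
  have key' := key.symm
  simp only [Set.mem_insert_iff, Set.mem_singleton_iff] at hu hv
  rcases hu with rfl | rfl | rfl | rfl <;> rcases hv with rfl | rfl | rfl | rfl <;>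
    simp_all [G.adj_comm]

lemma p6Heavy_of_p6FHeavy [DecidableRel G.Adj] (hG : P6FHeavy G) : P6Heavy G := by
  intro a b c d e f h
  have hnd := h.nodup
  have hind : IsInducedP6 G ![a, b, c, d, e, f] := by
    constructor
    · rw [← List.nodup_ofFn]
      simpa using hnd
    · obtain ⟨h1, h2, h3, h4, h5, h6, h7, h8, h9, h10, h11, h12, h13, h14, h15⟩ := h
      intro i j
      fin_cases i <;> fin_cases j <;> simp <;>
        first | assumption | exact SimpleGraph.Adj.symm ‹_› | exact mt SimpleGraph.Adj.symm ‹_›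
  have key : ∀ i j : Fin 6, i.val + 2 = j.val →
      Heavy G (![a, b, c, d, e, f] i) ∨ Heavy G (![a, b, c, d, e, f] j) := by
    intro i j hij
    have := hG _ hind i j (.inl hij)
    rw [Heavy, Heavy, deg_eq_degree, deg_eq_degree]
    omega
  exact ⟨key 0 2 rfl, key 1 3 rfl, key 2 4 rfl, key 3 5 rfl⟩

end HeavyGraph

/-- Every 2-connected claw-o-heavy and `P₆`-f-heavy graph is hamiltonian. -/
theorem stmt_11 {V : Type*} [Fintype V] [DecidableEq V] (G : SimpleGraph V) [DecidableRel G.Adj]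
    (h2conn : TwoConnected G) (hclaw : ClawOHeavy G) (hP6 : P6FHeavy G) :
    G.IsHamiltonian :=
  (HeavyGraph.ham_of_heavy h2conn.1 h2conn.2 (HeavyGraph.clawHeavy_of_clawOHeavy hclaw)
    (HeavyGraph.p6Heavy_of_p6FHeavy hP6)).isHamiltonian h2conn.1
end
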